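/- arXiv:0706.0545 — 2 statements merged into one kernel-verified Lean document; each statement's English description precedes it below -/
import Mathlib

section
/- For every weighted tree T = (V,E) and every p ≥ 1, c_p(T) ≤ 4 · [log(2/δ*(T))]^{min(1/p, 1/2)}. -/
open scoped ENNReal

namespace TreePaper

/-- `HasEmbedding dX dY D`: there is a bi-Lipschitz embedding of the distance space
`(X, dX)` into `(Y, dY)` with distortion at most `D`. -/
def HasEmbedding {X Y : Type*} (dX : X → X → ℝ) (dY : Y → Y → ℝ) (D : ℝ) : Prop :=
  ∃ f : X → Y, ∃ s : ℝ, 0 < s ∧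
    ∀ x x' : X, s * dX x x' ≤ dY (f x) (f x') ∧ dY (f x) (f x') ≤ s * D * dX x x'

/-- `cDist dX dY` is the infimal distortion of bi-Lipschitz embeddings of `X` into `Y`
(`⊤` if no bi-Lipschitz embedding exists); it is at least `1` by convention. -/
noncomputable def cDist {X Y : Type*} (dX : X → X → ℝ) (dY : Y → Y → ℝ) : ℝ≥0∞ :=
  1 ⊔ sInf {c : ℝ≥0∞ | ∃ r : ℝ, c = ENNReal.ofReal r ∧ HasEmbedding dX dY r}

/-- The Lebesgue space `L_p(ℝ)`. -/
noncomputable def LpSpace (p : ℝ) : Type :=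
  MeasureTheory.Lp ℝ (ENNReal.ofReal p) (MeasureTheory.volume : MeasureTheory.Measure ℝ)

noncomputable instance (p : ℝ) : Dist (LpSpace p) :=
  inferInstanceAs (Dist (MeasureTheory.Lp ℝ (ENNReal.ofReal p) MeasureTheory.volume))

/-- `cLp p dX` is the `L_p`-distortion of the distance space `(X, dX)`. -/
noncomputable def cLp (p : ℝ) {X : Type*} (dX : X → X → ℝ) : ℝ≥0∞ :=
  cDist dX (fun g h : LpSpace p => dist g h)

/-- A metric tree: a connected graph-theoretic tree together with positive edge weights.
The associated metric is the induced weighted shortest-path metric on the vertices. -/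
structure MetricTree where
  V : Type
  G : SimpleGraph V
  isTree : G.IsTree
  w : Sym2 V → ℝ
  w_pos : ∀ e ∈ G.edgeSet, 0 < w e

/-- The unique path between two vertices of a metric tree. -/
noncomputable def MetricTree.path (T : MetricTree) (u v : T.V) : T.G.Walk u v :=
  (T.isTree.existsUnique_path u v).exists.choose

/-- The weighted shortest-path metric of a metric tree. -/
noncomputable def MetricTree.dist (T : MetricTree) (u v : T.V) : ℝ :=
  ((T.path u v).edges.map T.w).sum

/-- `ℓ^χ_k(u,v)`: total weight of the edges of color `k` on the path from `u` to `v`. -/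
noncomputable def colorLen (T : MetricTree) (χ : Sym2 T.V → ℤ) (k : ℤ) (u v : T.V) : ℝ :=
  (((T.path u v).edges.filter (fun e => χ e = k)).map T.w).sum

/-- An edge coloring of the tree `T` rooted at `r` is monotone if each color class is the
edge set of a monotone path, i.e. of a path joining a vertex `a` to a descendant `b`. -/
def IsMonotoneColoring (T : MetricTree) (r : T.V) (χ : Sym2 T.V → ℤ) : Prop :=
  ∀ m : ℤ, ∃ a b : T.V, a ∈ (T.path r b).support ∧
    ∀ e ∈ T.G.edgeSet, (χ e = m ↔ e ∈ (T.path a b).edges)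

/-- The total length of the path from `u` to `v` covered by color classes whose length
along this path is at least `α · d_T(u,v)`. -/
noncomputable def coveredLen (T : MetricTree) (χ : Sym2 T.V → ℤ) (α : ℝ) (u v : T.V) : ℝ :=
  ∑ k ∈ ((T.path u v).edges.map χ).toFinset,
    (if α * T.dist u v ≤ colorLen T χ k u v then colorLen T χ k u v else 0)

/-- A `δ`-strong coloring: monotone, and for all `u,v` at least half of the length of the
path joining `u` and `v` is covered by color classes of length at least `δ · d_T(u,v)`. -/
def IsStrongColoring (T : MetricTree) (r : T.V) (δ : ℝ) (χ : Sym2 T.V → ℤ) : Prop :=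
  IsMonotoneColoring T r χ ∧ ∀ u v : T.V, T.dist u v / 2 ≤ coveredLen T χ δ u v

/-- `δ*(T)`: the supremal `δ ∈ (0,1)` for which `T` admits a `δ`-strong coloring. -/
noncomputable def deltaStar (T : MetricTree) (r : T.V) : ℝ :=
  sSup {δ : ℝ | 0 < δ ∧ δ < 1 ∧ ∃ χ : Sym2 T.V → ℤ, IsStrongColoring T r δ χ}

/-- An `ε`-good coloring: monotone, and every path from `u` to `v` contains a monochromatic
segment of length at least `ε · d_T(u,v)`. -/
def IsGoodColoring (T : MetricTree) (r : T.V) (ε : ℝ) (χ : Sym2 T.V → ℤ) : Prop :=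
  IsMonotoneColoring T r χ ∧ ∀ u v : T.V, u ≠ v → ∃ a b : T.V,
    a ∈ (T.path u v).support ∧ b ∈ (T.path u v).support ∧
    (∃ k : ℤ, ∀ e ∈ (T.path a b).edges, χ e = k) ∧ ε * T.dist u v ≤ T.dist a b

/-- `ε*(T)`: the supremal `ε ∈ (0,1]` for which `T` admits an `ε`-good coloring. -/
noncomputable def epsilonStar (T : MetricTree) (r : T.V) : ℝ :=
  sSup {ε : ℝ | 0 < ε ∧ ε ≤ 1 ∧ ∃ χ : Sym2 T.V → ℤ, IsGoodColoring T r ε χ}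

section LpMaps

open MeasureTheory ProbabilityTheory

/-- The sum of the `r`-th powers of the absolute values of the coordinates. -/
noncomputable def powSum {ι : Type*} (r : ℝ) (c : ι →₀ ℝ) : ℝ := c.sum fun _ x => |x| ^ r

lemma norm_linearCombination_toLp {ι Ω : Type*} [MeasurableSpace Ω] {μ : Measure Ω} {p : ℝ≥0∞}
    {f : ι → Ω → ℝ} (hf : ∀ i, MemLp (f i) p μ) (c : ι →₀ ℝ) :
    ‖Finsupp.linearCombination ℝ (fun i => (hf i).toLp (f i)) c‖ =
      (eLpNorm (fun x => ∑ i ∈ c.support, c i * f i x) p μ).toReal := by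
  classical
  rw [Finsupp.linearCombination_apply, Finsupp.sum, Lp.norm_def]
  congr 1
  apply eLpNorm_congr_ae
  generalize c.support = s
  induction s using Finset.induction_on with
  | empty =>
    simp only [Finset.sum_empty]
    exact Lp.coeFn_zero _ _ _
  | insert a s ha ih =>
    simp only [Finset.sum_insert ha]
    filter_upwards [Lp.coeFn_add (c a • (hf a).toLp (f a)) (∑ i ∈ s, c i • (hf i).toLp (f i)),
      Lp.coeFn_smul (c a) ((hf a).toLp (f a)), (hf a).coeFn_toLp, ih] with x h1 h2 h3 h4
    rw [h1, Pi.add_apply, h2, Pi.smul_apply, h3, h4, smul_eq_mul]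

lemma exists_linearMap_Lp_of_powSum {ι : Type*} [Countable ι] {p : ℝ} (hp : 1 ≤ p) :
    ∃ J : (ι →₀ ℝ) →ₗ[ℝ] Lp ℝ (ENNReal.ofReal p) (volume : Measure ℝ), ∃ κ : ℝ, 0 < κ ∧
      ∀ c, ‖J c‖ = κ * powSum p c ^ (1 / p) := by
  classical
  obtain ⟨n, hn⟩ := exists_injective_nat ι
  set I : ι → Set ℝ := fun i => Set.Ico (n i : ℝ) (n i + 1) with hI
  have hm : ∀ i, MeasurableSet (I i) := fun i => measurableSet_Ico
  have hvol : ∀ i, volume (I i) = 1 := fun i => by simp [hI]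
  have hdisj : ∀ i j x, x ∈ I i → x ∈ I j → i = j := by
    intro i j x hi hj
    simp only [hI, Set.mem_Ico] at hi hj
    have h1 : n i < n j + 1 := by exact_mod_cast lt_of_le_of_lt hi.1 hj.2
    have h2 : n j < n i + 1 := by exact_mod_cast lt_of_le_of_lt hj.1 hi.2
    exact hn (by omega)
  have hf : ∀ i, MemLp ((I i).indicator fun _ => (1 : ℝ)) (ENNReal.ofReal p) volume :=
    fun i => memLp_indicator_const _ (hm i) _ (Or.inr (by simp [hvol]))
  have hp0 : 0 < p := by linarith
  refine ⟨_, 1, one_pos, fun c => (norm_linearCombination_toLp hf c).trans ?_⟩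
  have key : ∀ x, ‖∑ i ∈ c.support, c i * (I i).indicator (fun _ => (1 : ℝ)) x‖ₑ ^ p =
      ∑ i ∈ c.support, (I i).indicator (fun _ => ENNReal.ofReal (|c i| ^ p)) x := by
    intro x
    by_cases hx : ∃ i ∈ c.support, x ∈ I i
    · obtain ⟨i, hi, hxi⟩ := hx
      rw [Finset.sum_eq_single_of_mem i hi, Finset.sum_eq_single_of_mem i hi]
      · simp only [Set.indicator_of_mem hxi, mul_one]
        rw [Real.enorm_eq_ofReal_abs, ENNReal.ofReal_rpow_of_nonneg (abs_nonneg _) hp0.le]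
      · exact fun j _ hj => Set.indicator_of_notMem (fun h => hj (hdisj _ _ _ h hxi)) _
      · exact fun j _ hj => by
          rw [Set.indicator_of_notMem (fun h => hj (hdisj _ _ _ h hxi)), mul_zero]
    · push Not at hx
      rw [Finset.sum_eq_zero, Finset.sum_eq_zero]
      · simp [hp0]
      · exact fun j hj => Set.indicator_of_notMem (hx j hj) _
      · exact fun j hj => by rw [Set.indicator_of_notMem (hx j hj), mul_zero]
  rw [eLpNorm_eq_lintegral_rpow_enorm_toReal (by simp [hp0]) (by simp),
    ENNReal.toReal_ofReal hp0.le]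
  simp only [key]
  rw [lintegral_finsetSum _ (fun i _ => measurable_const.indicator (hm i))]
  simp only [lintegral_indicator_const (hm _), hvol, mul_one]
  rw [← ENNReal.ofReal_sum_of_nonneg (fun i _ => by positivity),
    ENNReal.ofReal_rpow_of_nonneg (Finset.sum_nonneg fun i _ => by positivity) (by positivity),
    ENNReal.toReal_ofReal (by positivity), one_mul]
  rfl

lemma map_sum_gaussian {ι Ω : Type*} [MeasurableSpace Ω] {P : Measure Ω} [IsProbabilityMeasure P]
    {X : ι → Ω → ℝ} (hX : ∀ i, P.map (X i) = gaussianReal 0 1) (hm : ∀ i, Measurable (X i))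
    (hind : iIndepFun X P) (c : ι → ℝ) (s : Finset ι) :
    P.map (fun ω => ∑ i ∈ s, c i * X i ω) =
      gaussianReal 0 (∑ i ∈ s, (c i ^ 2).toNNReal) := by
  classical
  induction s using Finset.induction_on with
  | empty => simp
  | insert a s ha ih =>
    have h1 : P.map (fun ω => c a * X a ω) = gaussianReal 0 (c a ^ 2).toNNReal := by
      have := gaussianReal_map_const_mul (μ := 0) (v := 1) (c a)
      rw [← hX a, Measure.map_map (by fun_prop) (hm a)] at this
      rw [show (fun ω => c a * X a ω) = (c a * ·) ∘ X a from rfl, this]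
      congr 1
      · simp
      · ext; simp [Real.coe_toNNReal _ (sq_nonneg _)]
    have hind' : iIndepFun (fun i ω => c i * X i ω) P :=
      hind.comp (fun i x => c i * x) (fun i => by fun_prop)
    have h2 := hind'.indepFun_finsetSum_of_notMem (fun i => by have := hm i; fun_prop) ha
    have h3 := gaussianReal_add_gaussianReal_of_indepFun h2.symm h1
      (by rw [← ih]; congr 1; ext ω; simp)
    simp only [Finset.sum_insert ha]
    rw [zero_add] at h3
    rw [← h3]
    congr 1; ext ω; simp

lemma exists_linearMap_Lp_of_powSum_two {ι : Type*} [Countable ι] {p : ℝ} (hp : 1 ≤ p) :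
    ∃ J : (ι →₀ ℝ) →ₗ[ℝ] Lp ℝ (ENNReal.ofReal p) (volume : Measure ℝ), ∃ κ : ℝ, 0 < κ ∧
      ∀ c, ‖J c‖ = κ * powSum 2 c ^ (1 / 2 : ℝ) := by
  classical
  set P : Measure (ι → ℝ) := Measure.infinitePi (fun _ => gaussianReal 0 1) with hP
  obtain ⟨g0, hg0m, hg0⟩ := Measure.exists_measurable_map_eq P
  set g : ℝ → (ι → ℝ) := g0 ∘ Set.projIcc 0 1 zero_le_one with hg
  have hgm : Measurable g := hg0m.comp continuous_projIcc.measurable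
  have hmap : (volume.restrict (Set.Icc (0 : ℝ) 1)).map g = P := by
    rw [← hg0, ← (measurePreserving_subtype_coe (μa := (volume : Measure ℝ))
      (measurableSet_Icc (a := (0 : ℝ)) (b := 1))).map_eq, Measure.map_map hgm (by fun_prop)]
    congr 1
    ext x
    simp [hg]
  have hXm : ∀ i, Measurable (fun ω : ι → ℝ => ω i) := fun i => measurable_pi_apply i
  have hX : ∀ i, P.map (fun ω => ω i) = gaussianReal 0 1 := fun i =>
    (measurePreserving_eval_infinitePi (fun _ : ι => gaussianReal 0 1) i).map_eq
  have hind : iIndepFun (fun (i : ι) (ω : ι → ℝ) => ω i) P :=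
    iIndepFun_infinitePi (P := fun _ : ι => gaussianReal 0 1) (X := fun _ x => x)
      (fun _ => measurable_id)
  have hq0 : ENNReal.ofReal p ≠ ⊤ := by simp
  have hrep : ∀ F : (ι → ℝ) → ℝ, Measurable F →
      eLpNorm ((Set.Icc (0 : ℝ) 1).indicator (F ∘ g)) (ENNReal.ofReal p) volume =
        eLpNorm F (ENNReal.ofReal p) P := fun F hF => by
    rw [eLpNorm_indicator_eq_eLpNorm_restrict measurableSet_Icc, ← hmap,
      eLpNorm_map_measure hF.aestronglyMeasurable hgm.aemeasurable]
  have hrep2 : ∀ (F : (ι → ℝ) → ℝ) (v : NNReal), Measurable F → P.map F = gaussianReal 0 v →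
      eLpNorm F (ENNReal.ofReal p) P = eLpNorm id (ENNReal.ofReal p) (gaussianReal 0 v) :=
    fun F v hF h => by
      rw [← h, eLpNorm_map_measure measurable_id.aestronglyMeasurable hF.aemeasurable]; rfl
  have hf : ∀ i, MemLp ((Set.Icc (0 : ℝ) 1).indicator ((fun ω : ι → ℝ => ω i) ∘ g))
      (ENNReal.ofReal p) volume := fun i =>
    ⟨(((hXm i).comp hgm).indicator measurableSet_Icc).aestronglyMeasurable, by
      rw [hrep _ (hXm i), hrep2 _ _ (hXm i) (hX i)]
      exact (memLp_id_gaussianReal' _ hq0).2⟩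
  have hp0 : 0 < p := by linarith
  set N := eLpNorm id (ENNReal.ofReal p) (gaussianReal 0 1) with hN
  have hNtop : N ≠ ⊤ := (memLp_id_gaussianReal' _ hq0).2.ne
  have hN0 : N ≠ 0 := by
    intro h
    rw [hN, eLpNorm_eq_zero_iff measurable_id.aestronglyMeasurable (by simp [hp0])] at h
    have h2 : gaussianReal 0 1 {x : ℝ | x ≠ 0} = 0 := h
    have h3 : gaussianReal 0 1 ({0} : Set ℝ) = 0 := by
      have := nullSingletonClass_gaussianReal (μ := 0) (v := 1) one_ne_zero
      exact measure_singleton _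
    have h4 : gaussianReal 0 1 (Set.univ : Set ℝ) ≤ 0 := by
      rw [← Set.compl_union_self ({0} : Set ℝ)]
      refine (measure_union_le _ _).trans ?_
      rw [h3, show ({0} : Set ℝ)ᶜ = {x : ℝ | x ≠ 0} from rfl, h2, add_zero]
    simp at h4
  refine ⟨_, N.toReal, ENNReal.toReal_pos hN0 hNtop,
    fun c => (norm_linearCombination_toLp hf c).trans ?_⟩
  have h1 : (fun x => ∑ i ∈ c.support,
      c i * (Set.Icc (0 : ℝ) 1).indicator ((fun ω : ι → ℝ => ω i) ∘ g) x) =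
      (Set.Icc (0 : ℝ) 1).indicator ((fun ω : ι → ℝ => ∑ i ∈ c.support, c i * ω i) ∘ g) := by
    ext x
    by_cases hx : x ∈ Set.Icc (0 : ℝ) 1
    · simp only [Set.indicator_of_mem hx, Function.comp]
    · simp only [Set.indicator_of_notMem hx, mul_zero, Finset.sum_const_zero]
  set v : NNReal := ∑ i ∈ c.support, (c i ^ 2).toNNReal with hv
  have hvv : powSum 2 c = v := by
    rw [powSum, Finsupp.sum, hv, NNReal.coe_sum]
    refine Finset.sum_congr rfl fun i _ => ?_
    rw [Real.coe_toNNReal _ (sq_nonneg _), Real.rpow_two, sq_abs]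
  have hFm : Measurable fun ω : ι → ℝ => ∑ i ∈ c.support, c i * ω i := by fun_prop
  rw [h1, hrep _ hFm, hrep2 _ v hFm (map_sum_gaussian hX hXm hind c _), hvv]
  have h5 : gaussianReal 0 v = (gaussianReal 0 1).map (Real.sqrt v * ·) := by
    rw [gaussianReal_map_const_mul, mul_zero]
    congr 1
    ext; simp
  rw [h5, eLpNorm_map_measure measurable_id.aestronglyMeasurable (by fun_prop),
    show (id ∘ fun x => Real.sqrt v * x) = (Real.sqrt v) • (id : ℝ → ℝ) from rfl,
    eLpNorm_const_smul, ← hN, ENNReal.toReal_mul, ← Real.sqrt_eq_rpow]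
  simp [abs_of_nonneg (Real.sqrt_nonneg _), mul_comm]

end LpMaps

/-- The total length of a list of runs (color, length). -/
def tot (R : List (ℤ × ℝ)) : ℝ := (R.map Prod.snd).sum

@[simp] lemma tot_nil : tot [] = 0 := rfl
@[simp] lemma tot_cons (x : ℤ × ℝ) (R : List (ℤ × ℝ)) : tot (x :: R) = x.2 + tot R := by simp [tot]
@[simp] lemma tot_append (R R' : List (ℤ × ℝ)) : tot (R ++ R') = tot R + tot R' := by simp [tot]

lemma tot_nonneg {R : List (ℤ × ℝ)} (h : ∀ x ∈ R, 0 ≤ x.2) : 0 ≤ tot R :=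
  List.sum_nonneg (by simpa using fun b a hm => h (a, b) hm)

/-- The truncated length of a list of runs lying at distance `c` from a base point: every run
is shortened by `τ` times the distance from the base point to its end. -/
noncomputable def truncLen (τ : ℝ) : ℝ → List (ℤ × ℝ) → ℝ
  | _, [] => 0
  | c, x :: R => max (x.2 - τ * (c + x.2)) 0 + truncLen τ (c + x.2) R

lemma truncLen_append_singleton (τ c z : ℝ) (m : ℤ) (R : List (ℤ × ℝ)) :
    truncLen τ c (R ++ [(m, z)]) = truncLen τ c R + max (z - τ * (c + tot R + z)) 0 := by
  induction R generalizing c with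
  | nil => simp [truncLen]
  | cons x R ih => simp [truncLen, ih, ← add_assoc]

lemma truncLen_nonneg (τ c : ℝ) (R : List (ℤ × ℝ)) : 0 ≤ truncLen τ c R := by
  induction R generalizing c with
  | nil => simp [truncLen]
  | cons x R ih => exact add_nonneg (le_max_right _ _) (ih _)

/-- The vector assigned to the list of runs of a root-vertex path. -/
noncomputable def runVec (r a τ : ℝ) : List (ℤ × ℝ) → (ℤ →₀ ℝ)
  | [] => 0
  | x :: R => Finsupp.single x.1 (x.2 ^ (1 / r) * (a * x.2 + truncLen τ x.2 R) ^ (1 - 1 / r)) +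
      runVec r a τ R

/-- The truncated lengths seen from every run are at least `h` times the full lengths. -/
def IsCovered (a τ h : ℝ) : List (ℤ × ℝ) → Prop
  | [] => True
  | x :: R => h * (x.2 + tot R) ≤ a * x.2 + truncLen τ x.2 R ∧ IsCovered a τ h R

/-- The derivative of `runVec` when the length of the last run varies. -/
noncomputable def runVecDeriv (r a τ : ℝ) (m : ℤ) (z : ℝ) : List (ℤ × ℝ) → (ℤ →₀ ℝ)
  | [] => Finsupp.single m (a ^ (1 - 1 / r))
  | x :: R => Finsupp.single x.1 (x.2 ^ (1 / r) *
      ((if τ * (x.2 + tot R) ≤ (1 - τ) * z then 1 - τ else 0) * (1 - 1 / r) *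
        (a * x.2 + truncLen τ x.2 (R ++ [(m, z)])) ^ (1 - 1 / r - 1))) + runVecDeriv r a τ m z R

lemma hasDerivWithinAt_max_zero {τ D z : ℝ} (hτ : τ < 1) :
    HasDerivWithinAt (fun y => max (y - τ * (D + y)) 0)
      (if τ * D ≤ (1 - τ) * z then 1 - τ else 0) (Set.Ici z) z := by
  split_ifs with h
  · have h1 : HasDerivWithinAt (fun y => (1 - τ) * y - τ * D) (1 - τ) (Set.Ici z) z := by
      simpa using (((hasDerivAt_id z).const_mul (1 - τ)).sub_const (τ * D)).hasDerivWithinAt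
    refine h1.congr (fun y hy => ?_) ?_
    · have : (1 - τ) * z ≤ (1 - τ) * y := mul_le_mul_of_nonneg_left hy (by linarith)
      rw [max_eq_left (by linarith)]; ring
    · rw [max_eq_left (by linarith)]; ring
  · push Not at h
    have h1 : ∀ᶠ y in nhds z, (1 - τ) * y < τ * D :=
      (continuous_const.mul continuous_id).continuousAt.eventually_lt continuousAt_const h
    refine HasDerivAt.hasDerivWithinAt ((hasDerivAt_const z (0 : ℝ)).congr_of_eventuallyEq ?_)
    filter_upwards [h1] with y hy
    rw [max_eq_right (by linarith)]

lemma rpow_one_div_mul_rpow {r b : ℝ} (hb : 0 ≤ b) :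
    b ^ (1 / r) * b ^ (1 - 1 / r) = b := by
  rw [← Real.rpow_add' hb (by simp)]; simp

lemma runVec_singleton {r a τ z : ℝ} {m : ℤ} (ha : 0 < a) (hz : 0 ≤ z) :
    runVec r a τ [(m, z)] = Finsupp.single m (a ^ (1 - 1 / r) * z) := by
  simp only [runVec, truncLen, add_zero]
  rw [Real.mul_rpow ha.le hz, mul_left_comm, rpow_one_div_mul_rpow hz]

lemma hasDerivWithinAt_runVec {E : Type*} [NormedAddCommGroup E] [NormedSpace ℝ E]
    (J : (ℤ →₀ ℝ) →ₗ[ℝ] E) {r a τ : ℝ} (ha : 0 < a) (hτ : τ < 1) (m : ℤ)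
    {z : ℝ} (hz : 0 ≤ z) {R : List (ℤ × ℝ)} (hR : ∀ x ∈ R, 0 < x.2) :
    HasDerivWithinAt (fun y => J (runVec r a τ (R ++ [(m, y)]))) (J (runVecDeriv r a τ m z R))
      (Set.Ici z) z := by
  have hJ : ∀ k x, J (Finsupp.single k x) = x • J (Finsupp.single k 1) := fun k x => by
    rw [← map_smul, Finsupp.smul_single, smul_eq_mul, mul_one]
  induction R with
  | nil =>
    have h1 : HasDerivWithinAt (fun y => (a ^ (1 - 1 / r) * y) • J (Finsupp.single m 1))
        ((a ^ (1 - 1 / r) * 1) • J (Finsupp.single m 1)) (Set.Ici z) z :=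
      (((hasDerivAt_id z).const_mul _).smul_const _).hasDerivWithinAt
    have h2 : ∀ y ∈ Set.Ici z, J (runVec r a τ ([] ++ [(m, y)])) =
        (a ^ (1 - 1 / r) * y) • J (Finsupp.single m 1) := fun y hy => by
      rw [List.nil_append, runVec_singleton ha (hz.trans hy), hJ]
    rw [runVecDeriv, hJ, ← mul_one (a ^ (1 - 1 / r))]
    exact h1.congr h2 (h2 z Set.self_mem_Ici)
  | cons x R ih =>
    have hx := hR x (by simp)
    have h1 := ih fun y hy => hR y (by simp [hy])
    simp only [List.cons_append, runVec, runVecDeriv, map_add]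
    refine HasDerivWithinAt.add ?_ h1
    simp only [hJ x.1 (_ * _)]
    have hs : 0 < a * x.2 + truncLen τ x.2 (R ++ [(m, z)]) :=
      add_pos_of_pos_of_nonneg (mul_pos ha hx) (truncLen_nonneg _ _ _)
    refine HasDerivWithinAt.smul_const (HasDerivWithinAt.const_mul _ ?_) _
    refine HasDerivWithinAt.rpow_const ?_ (Or.inl hs.ne')
    simp only [truncLen_append_singleton, ← add_assoc]
    exact (hasDerivWithinAt_max_zero hτ).const_add _

lemma powSum_single_add {ι : Type*} {r : ℝ} (hr : r ≠ 0) {k : ι} (x : ℝ) {c : ι →₀ ℝ}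
    (hk : c k = 0) : powSum r (Finsupp.single k x + c) = |x| ^ r + powSum r c := by
  classical
  rw [powSum, powSum, Finsupp.sum_add_index_of_disjoint, Finsupp.sum_single_index]
  · simp [hr]
  · rw [Finset.disjoint_left]
    intro i hi hi'
    have := Finsupp.support_single_subset hi
    rw [Finset.mem_singleton] at this
    subst this
    simp [hk] at hi'

lemma powSum_single {ι : Type*} {r : ℝ} (hr : r ≠ 0) (k : ι) (x : ℝ) :
    powSum r (Finsupp.single k x) = |x| ^ r := by
  rw [powSum, Finsupp.sum_single_index]; simp [hr]

lemma runVecDeriv_apply_of_notMem {r a τ z : ℝ} {m k : ℤ} {R : List (ℤ × ℝ)}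
    (hk : k ∉ (R ++ [(m, z)]).map Prod.fst) : runVecDeriv r a τ m z R k = 0 := by
  induction R with
  | nil => simp at hk; simp [runVecDeriv, hk]
  | cons x R ih =>
    simp only [List.cons_append, List.map_cons, List.mem_cons, not_or] at hk
    simp [runVecDeriv, ih hk.2, hk.1]

lemma runVec_apply_of_notMem {r a τ : ℝ} {k : ℤ} {R : List (ℤ × ℝ)}
    (hk : k ∉ R.map Prod.fst) : runVec r a τ R k = 0 := by
  induction R with
  | nil => simp [runVec]
  | cons x R ih =>
    simp only [List.map_cons, List.mem_cons, not_or] at hk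
    simp [runVec, ih hk.2, hk.1]

lemma runVec_append_apply {r a τ : ℝ} {k : ℤ} {R R' : List (ℤ × ℝ)}
    (hk : k ∉ R.map Prod.fst) : runVec r a τ (R ++ R') k = runVec r a τ R' k := by
  induction R with
  | nil => simp
  | cons x R ih =>
    simp only [List.map_cons, List.mem_cons, not_or] at hk
    simp [runVec, ih hk.2, hk.1]

lemma IsCovered.of_append {a τ h : ℝ} {R R' : List (ℤ × ℝ)} (hR : IsCovered a τ h (R ++ R')) :
    IsCovered a τ h R' := by
  induction R with
  | nil => exact hR
  | cons x R ih => exact ih hR.2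

/-- Lower bound for the truncated length when the length of the last run has increased. -/
lemma le_truncLen_of_active {a τ h z z₀ : ℝ} {m : ℤ} {x : ℤ × ℝ} {R : List (ℤ × ℝ)}
    (hτ0 : 0 < τ) (hh0 : 0 < h) (hh1 : h ≤ 1 - τ) (hz₀ : 0 ≤ z₀) (hz : z₀ ≤ z)
    (hD : 0 ≤ x.2 + tot R)
    (hc : h * (x.2 + tot (R ++ [(m, z₀)])) ≤ a * x.2 + truncLen τ x.2 (R ++ [(m, z₀)]))
    (hact : τ * (x.2 + tot R) ≤ (1 - τ) * z) :
    h * (1 - τ) * (x.2 + tot R + z) ≤ a * x.2 + truncLen τ x.2 (R ++ [(m, z)]) := by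
  rw [truncLen_append_singleton] at hc ⊢
  simp only [tot_append, tot_cons, tot_nil, add_zero] at hc
  rw [max_eq_left (by linarith)]
  set D := x.2 + tot R
  set A := a * x.2 + truncLen τ x.2 R
  rw [← add_assoc] at hc ⊢
  rw [← add_assoc] at hc
  change h * (D + z₀) ≤ A + _ at hc
  change _ ≤ A + _
  rcases le_total (z₀ - τ * (D + z₀)) 0 with h1 | h1
  · rw [max_eq_right h1, add_zero] at hc
    nlinarith [mul_nonneg hh0.le hz₀, mul_nonneg (by linarith : 0 ≤ 1 - h) (sub_nonneg.2 hact)]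
  · rw [max_eq_left h1] at hc
    nlinarith [mul_nonneg (sub_nonneg.2 hh1) (sub_nonneg.2 hz),
      mul_nonneg (mul_nonneg hh0.le hτ0.le) (by linarith : 0 ≤ D + z)]

lemma abs_deriv_term_rpow {r b s t : ℝ} (hr : 2 ≤ r) (hb : 0 ≤ b) (hs : 0 < s) (ht : 0 ≤ t) :
    |b ^ (1 / r) * (t * (1 - 1 / r) * s ^ (1 - 1 / r - 1))| ^ r =
      b * ((1 - 1 / r) ^ r * t ^ r) / s := by
  have hr0 : r ≠ 0 := by linarith
  have hq : 0 ≤ 1 - 1 / r := by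
    rw [sub_nonneg, div_le_one (by linarith)]; linarith
  rw [abs_of_nonneg (by positivity), Real.mul_rpow (by positivity) (by positivity),
    Real.mul_rpow (by positivity) (by positivity), Real.mul_rpow ht hq, ← Real.rpow_mul hb,
    ← Real.rpow_mul hs.le, one_div_mul_cancel hr0, Real.rpow_one,
    show (1 - 1 / r - 1) * r = -1 by field_simp; ring, Real.rpow_neg_one]
  ring

lemma powSum_runVecDeriv_le {r a τ h z z₀ : ℝ} {m : ℤ} {R : List (ℤ × ℝ)}
    (hr : 2 ≤ r) (ha : 0 < a) (hτ0 : 0 < τ) (hτ1 : τ < 1) (hh0 : 0 < h) (hh1 : h ≤ 1 - τ)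
    (hz₀ : 0 ≤ z₀) (hz : z₀ ≤ z) (hR : ∀ x ∈ R, 0 < x.2)
    (hc : IsCovered a τ h (R ++ [(m, z₀)])) (hnd : ((R ++ [(m, z₀)]).map Prod.fst).Nodup) :
    powSum r (runVecDeriv r a τ m z R) ≤
      a ^ (r - 1) + (1 - 1 / r) ^ r / h * min (Real.log ((tot R + z) / z)) (Real.log (1 / τ)) := by
  have hr0 : r ≠ 0 := by linarith
  have hq : 0 ≤ 1 - 1 / r := by
    rw [sub_nonneg, div_le_one (by linarith)]; linarith
  have hτl : 0 ≤ Real.log (1 / τ) := Real.log_nonneg (by rw [le_div_iff₀ hτ0]; linarith)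
  induction R with
  | nil =>
    rw [runVecDeriv, powSum_single hr0, abs_of_nonneg (by positivity), ← Real.rpow_mul ha.le,
      show (1 - 1 / r) * r = r - 1 by field_simp, tot_nil, zero_add]
    have h1 : Real.log (z / z) = 0 := by
      rcases (hz₀.trans hz).eq_or_lt with h0 | h0
      · simp [← h0]
      · simp [div_self h0.ne']
    rw [h1, min_eq_left hτl, mul_zero, add_zero]
  | cons x R ih =>
    have hx := hR x (by simp)
    have hR' : ∀ y ∈ R, 0 < y.2 := fun y hy => hR y (by simp [hy])
    have ht : 0 ≤ tot R := tot_nonneg fun y hy => (hR' y hy).le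
    simp only [List.cons_append, List.map_cons, List.nodup_cons] at hnd
    have ih := ih hR' hc.2 hnd.2
    have hk : runVecDeriv r a τ m z R x.1 = 0 :=
      runVecDeriv_apply_of_notMem (by simpa using hnd.1)
    have hs : 0 < a * x.2 + truncLen τ x.2 (R ++ [(m, z)]) :=
      add_pos_of_pos_of_nonneg (mul_pos ha hx) (truncLen_nonneg _ _ _)
    rw [runVecDeriv, powSum_single_add hr0 _ hk,
      abs_deriv_term_rpow hr hx.le hs (by split_ifs <;> linarith), tot_cons]
    have hQ : 0 ≤ (1 - 1 / r) ^ r / h := by positivity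
    split_ifs with hact
    · have hle := le_truncLen_of_active hτ0 hh0 hh1 hz₀ hz (by linarith) hc.1 hact
      have hz0 : 0 < z := by
        rcases (hz₀.trans hz).eq_or_lt with h0 | h0
        · rw [← h0, mul_zero] at hact
          nlinarith
        · exact h0
      have hD : 0 < x.2 + tot R + z := by positivity
      have e1 : x.2 * ((1 - 1 / r) ^ r * (1 - τ) ^ r) / (a * x.2 + truncLen τ x.2 (R ++ [(m, z)]))
          ≤ (1 - 1 / r) ^ r / h * (x.2 / (x.2 + tot R + z)) := by
        have h1 : (1 - τ) ^ r ≤ 1 - τ := by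
          calc (1 - τ) ^ r ≤ (1 - τ) ^ (1 : ℝ) :=
                Real.rpow_le_rpow_of_exponent_ge (by linarith) (by linarith) (by linarith)
            _ = 1 - τ := Real.rpow_one _
        have h1τ : 0 < 1 - τ := by linarith
        calc _ ≤ x.2 * ((1 - 1 / r) ^ r * (1 - τ)) / (h * (1 - τ) * (x.2 + tot R + z)) := by
              gcongr
          _ = _ := by field_simp
      have e2 : x.2 / (x.2 + tot R + z) + Real.log ((tot R + z) / z) ≤
          Real.log ((x.2 + tot R + z) / z) := by
        have h1 := Real.log_le_sub_one_of_pos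
          (show 0 < (tot R + z) / (x.2 + tot R + z) by positivity)
        rw [Real.log_div (by positivity) (by positivity)] at h1 ⊢
        rw [Real.log_div (by positivity) (by positivity)]
        have : (tot R + z) / (x.2 + tot R + z) - 1 = - (x.2 / (x.2 + tot R + z)) := by
          field_simp; ring
        linarith
      have e3 : Real.log ((x.2 + tot R + z) / z) ≤ Real.log (1 / τ) := by
        apply Real.log_le_log (by positivity)
        rw [div_le_div_iff₀ hz0 hτ0]; nlinarith
      have e4 : min (Real.log ((tot R + z) / z)) (Real.log (1 / τ)) ≤ Real.log ((tot R + z) / z) :=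
        min_le_left _ _
      rw [min_eq_left e3]
      nlinarith [mul_le_mul_of_nonneg_left e2 hQ, mul_le_mul_of_nonneg_left e4 hQ]
    · rw [Real.zero_rpow hr0, mul_zero, mul_zero, zero_div, zero_add]
      refine ih.trans ?_
      refine add_le_add le_rfl (mul_le_mul_of_nonneg_left (min_le_min_right _ ?_) hQ)
      rcases (hz₀.trans hz).eq_or_lt with h0 | h0
      · simp [← h0]
      · apply Real.log_le_log (by positivity)
        gcongr
        linarith

lemma rpow_sub_rpow_le {r b D : ℝ} (hr : 2 ≤ r) (hb : 0 ≤ b) (hD : 0 ≤ D) :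
    (b + D) ^ r - D ^ r ≤ r * (b * (b + D) ^ (r - 1)) := by
  rcases hb.eq_or_lt with h0 | h0
  · simp [← h0]
  · have hp : 0 < b + D := by linarith
    have h1 := one_add_mul_self_le_rpow_one_add (s := -b / (b + D)) (p := r)
      (by rw [le_div_iff₀ hp]; linarith) (by linarith)
    rw [show 1 + -b / (b + D) = D / (b + D) by field_simp; ring, Real.div_rpow hD hp.le,
      le_div_iff₀ (by positivity)] at h1
    have h2 : (b + D) ^ r = (b + D) * (b + D) ^ (r - 1) := by
      rw [mul_comm, Real.rpow_sub_one hp.ne']; field_simp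
    have h3 : (1 + r * (-b / (b + D))) * (b + D) ^ r =
        (b + D) ^ r - r * (b * (b + D) ^ (r - 1)) := by
      rw [h2]; field_simp; ring
    linarith

lemma le_sum_runVec {r a τ h : ℝ} {R f : List (ℤ × ℝ)}
    (hr : 2 ≤ r) (ha : 0 < a) (hh : 0 < h) (hf : ∀ x ∈ f, 0 < x.2)
    (hc : IsCovered a τ h f) (hnd : ((R ++ f).map Prod.fst).Nodup) :
    h ^ (r - 1) / r * tot f ^ r ≤
      ∑ k ∈ (f.map Prod.fst).toFinset, |runVec r a τ (R ++ f) k| ^ r := by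
  have hr0 : 0 < r := by linarith
  have hd : ∀ k ∈ (f.map Prod.fst).toFinset, k ∉ R.map Prod.fst := fun k hk h => by
    rw [List.map_append] at hnd
    exact List.disjoint_of_nodup_append hnd h (List.mem_toFinset.1 hk)
  rw [Finset.sum_congr rfl fun k hk => by rw [runVec_append_apply (hd k hk)]]
  have hnd' : (f.map Prod.fst).Nodup := by
    rw [List.map_append] at hnd; exact hnd.of_append_right
  clear hnd hd
  induction f with
  | nil => simp [hr0.ne']
  | cons x f ih =>
    have hx := hf x (by simp)
    have hf' : ∀ y ∈ f, 0 < y.2 := fun y hy => hf y (by simp [hy])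
    have ht : 0 ≤ tot f := tot_nonneg fun y hy => (hf' y hy).le
    rw [List.map_cons, List.nodup_cons] at hnd'
    have ih := ih hf' hc.2 hnd'.2
    have hs : 0 < a * x.2 + truncLen τ x.2 f :=
      add_pos_of_pos_of_nonneg (mul_pos ha hx) (truncLen_nonneg _ _ _)
    rw [List.map_cons, List.toFinset_cons, Finset.sum_insert (by simpa using hnd'.1)]
    have h1 : ∀ k ∈ (f.map Prod.fst).toFinset, runVec r a τ (x :: f) k = runVec r a τ f k :=
      fun k hk => by
        have : k ≠ x.1 := fun h => hnd'.1 (h ▸ List.mem_toFinset.1 hk)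
        simp [runVec, this]
    rw [Finset.sum_congr rfl fun k hk => by rw [h1 k hk]]
    have h2 : |runVec r a τ (x :: f) x.1| ^ r = x.2 * (a * x.2 + truncLen τ x.2 f) ^ (r - 1) := by
      rw [runVec, Finsupp.add_apply, runVec_apply_of_notMem hnd'.1, Finsupp.single_eq_same,
        add_zero, abs_of_nonneg (by positivity), Real.mul_rpow (by positivity) (by positivity),
        ← Real.rpow_mul hx.le, ← Real.rpow_mul hs.le, one_div_mul_cancel hr0.ne', Real.rpow_one,
        show (1 - 1 / r) * r = r - 1 by field_simp]
    have h3 : h ^ (r - 1) * (x.2 + tot f) ^ (r - 1) ≤ (a * x.2 + truncLen τ x.2 f) ^ (r - 1) := by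
      rw [← Real.mul_rpow hh.le (by positivity)]
      exact Real.rpow_le_rpow (by positivity) hc.1 (by linarith)
    have h4 := rpow_sub_rpow_le hr hx.le ht
    rw [h2, tot_cons]
    have h5 : h ^ (r - 1) / r * ((x.2 + tot f) ^ r - tot f ^ r) ≤
        x.2 * (h ^ (r - 1) * (x.2 + tot f) ^ (r - 1)) := by
      calc _ ≤ h ^ (r - 1) / r * (r * (x.2 * (x.2 + tot f) ^ (r - 1))) := by gcongr
        _ = _ := by field_simp
    nlinarith [mul_le_mul_of_nonneg_left h3 hx.le]

open Classical in
/-- The runs of length at least `M`. -/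
noncomputable def longRuns (M : ℝ) (R : List (ℤ × ℝ)) : List (ℤ × ℝ) :=
  R.filter fun x => decide (M ≤ x.2)

/-- Half of the total length is covered by runs whose length is a `δ`-fraction of the total. -/
def IsHalfCovered (δ : ℝ) (R : List (ℤ × ℝ)) : Prop := tot R / 2 ≤ tot (longRuns (δ * tot R) R)

/-- The total length after shortening all runs by `σ`. -/
noncomputable def shortLen (σ : ℝ) (R : List (ℤ × ℝ)) : ℝ := (R.map fun x => max (x.2 - σ) 0).sum

lemma shortLen_nonneg (σ : ℝ) (R : List (ℤ × ℝ)) : 0 ≤ shortLen σ R :=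
  List.sum_nonneg (by simp only [List.mem_map]; rintro _ ⟨x, _, rfl⟩; exact le_max_right _ _)

lemma shortLen_le_truncLen {τ c σ : ℝ} {R : List (ℤ × ℝ)} (hτ : 0 ≤ τ) (hR : ∀ x ∈ R, 0 ≤ x.2)
    (hσ : τ * (c + tot R) ≤ σ) : shortLen σ R ≤ truncLen τ c R := by
  induction R generalizing c with
  | nil => simp [shortLen, truncLen]
  | cons x R ih =>
    have hR' : ∀ y ∈ R, 0 ≤ y.2 := fun y hy => hR y (by simp [hy])
    have ht := tot_nonneg hR'
    rw [tot_cons, ← add_assoc] at hσ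
    have h1 := ih hR' hσ
    simp only [shortLen, truncLen, List.map_cons, List.sum_cons] at h1 ⊢
    refine add_le_add (max_le_max_right _ ?_) h1
    nlinarith

lemma le_shortLen_base {δ σ : ℝ} {R : List (ℤ × ℝ)} (hδ : 0 < δ) (hσ : 0 ≤ σ)
    (hR : ∀ x ∈ R, 0 < x.2) (hh : IsHalfCovered δ R) :
    1 / 2 * tot R - 1 / (2 * δ) * σ ≤ shortLen σ R := by
  have ht := tot_nonneg fun x hx => (hR x hx).le
  rcases le_or_gt (δ * tot R) σ with h0 | h0
  · have h1 : 1 / 2 * tot R - 1 / (2 * δ) * σ = (δ * tot R - σ) / (2 * δ) := by field_simp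
    rw [h1]
    exact (div_nonpos_of_nonpos_of_nonneg (by linarith) (by positivity)).trans
      (shortLen_nonneg _ _)
  · have hM : 0 < δ * tot R := hσ.trans_lt h0
    have h1 : ∀ f : List (ℤ × ℝ), (∀ x ∈ f, 0 < x.2) →
        (1 - σ / (δ * tot R)) * tot (longRuns (δ * tot R) f) ≤ shortLen σ f := by
      intro f hf
      induction f with
      | nil => simp [shortLen, longRuns]
      | cons x f ih =>
        have ih := ih fun y hy => hf y (by simp [hy])
        simp only [shortLen, longRuns, List.map_cons, List.sum_cons, List.filter_cons] at ih ⊢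
        by_cases hx : δ * tot R ≤ x.2
        · simp only [hx, decide_true, if_true, tot_cons]
          have h2 : σ ≤ σ / (δ * tot R) * x.2 := by
            rw [div_mul_eq_mul_div, le_div_iff₀ hM]; gcongr
          have := le_max_left (x.2 - σ) 0
          linarith
        · simp only [hx, decide_false, Bool.false_eq_true, if_false]
          have := le_max_right (x.2 - σ) 0
          linarith
    refine le_trans ?_ (h1 R hR)
    have h2 : 1 / 2 * tot R - 1 / (2 * δ) * σ = (1 - σ / (δ * tot R)) * (tot R / 2) := by
      have : 0 < tot R := pos_of_mul_pos_right hM hδ.le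
      field_simp
    rw [h2]
    exact mul_le_mul_of_nonneg_left hh (by rw [sub_nonneg, div_le_one hM]; exact h0.le)

lemma mul_length_longRuns_le (M : ℝ) (R : List (ℤ × ℝ)) :
    M * (longRuns M R).length ≤ tot (longRuns M R) := by
  induction R with
  | nil => simp [longRuns]
  | cons x R ih =>
    simp only [longRuns, List.filter_cons] at ih ⊢
    split_ifs with hx
    · rw [decide_eq_true_eq] at hx
      rw [List.length_cons, tot_cons]
      push_cast
      linarith
    · exact ih

lemma tot_longRuns_le (M : ℝ) {R : List (ℤ × ℝ)} (hR : ∀ x ∈ R, 0 < x.2) :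
    tot (longRuns M R) ≤ tot R := by
  induction R with
  | nil => simp [longRuns]
  | cons x R ih =>
    have ih := ih fun y hy => hR y (by simp [hy])
    have hx := hR x (by simp)
    simp only [longRuns, List.filter_cons] at ih ⊢
    split_ifs <;> simp <;> linarith

lemma longRuns_append (M : ℝ) (R R' : List (ℤ × ℝ)) :
    longRuns M (R ++ R') = longRuns M R ++ longRuns M R' := List.filter_append ..

lemma shortLen_append (σ : ℝ) (R R' : List (ℤ × ℝ)) :
    shortLen σ (R ++ R') = shortLen σ R + shortLen σ R' := by simp [shortLen]

lemma le_shortLen_of_longRuns {M σ α β : ℝ} {R : List (ℤ × ℝ)}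
    (hα : ∀ g, g <:+: R → α * tot g - β * σ ≤ shortLen σ g) (f : List (ℤ × ℝ)) (hf : f <:+: R) :
    α * tot f + (1 - α) * tot (longRuns M f) - (longRuns M f).length * σ -
      ((longRuns M f).length + 1) * (β * σ) ≤ shortLen σ f := by
  induction hn : f.length using Nat.strong_induction_on generalizing f with
  | _ n ih =>
    by_cases hx : ∃ x ∈ f, M ≤ x.2
    · obtain ⟨x, hx, hMx⟩ := hx
      obtain ⟨A, B, rfl⟩ := List.append_of_mem hx
      have hA := ih A.length (by rw [← hn]; simp) A
        ((List.prefix_append A _).isInfix.trans hf) rfl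
      have hB := ih B.length (by rw [← hn]; simp; omega) B
        (((List.suffix_cons x B).trans (List.suffix_append A _)).isInfix.trans hf) rfl
      have h1 : longRuns M (x :: B) = x :: longRuns M B := by
        simp [longRuns, hMx]
      have h2 : shortLen σ (x :: B) = max (x.2 - σ) 0 + shortLen σ B := by simp [shortLen]
      rw [longRuns_append, shortLen_append, h1, h2]
      simp only [tot_append, tot_cons, List.length_append, List.length_cons]
      push_cast
      have := le_max_left (x.2 - σ) 0
      linarith
    · push Not at hx
      have h1 : longRuns M f = [] := by
        simp only [longRuns, List.filter_eq_nil_iff, decide_eq_true_eq, not_le]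
        exact hx
      have := hα f hf
      simpa [h1] using this

lemma le_shortLen_step {δ σ α β : ℝ} {R : List (ℤ × ℝ)} (hδ : 0 < δ) (hσ : 0 ≤ σ) (hα1 : α ≤ 1)
    (hβ : 0 ≤ β) (hR : ∀ x ∈ R, 0 < x.2) (hh : IsHalfCovered δ R)
    (hα : ∀ g, g <:+: R → α * tot g - β * σ ≤ shortLen σ g) :
    (1 + α) / 2 * tot R - (1 / δ + (1 / δ + 1) * β) * σ ≤ shortLen σ R := by
  have ht := tot_nonneg fun x hx => (hR x hx).le
  rcases ht.eq_or_lt with h0 | h0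
  · rw [← h0, mul_zero, zero_sub]
    exact (neg_nonpos.2 (by positivity)).trans (shortLen_nonneg _ _)
  · have h1 := le_shortLen_of_longRuns (M := δ * tot R) hα R List.infix_rfl
    set n := ((longRuns (δ * tot R) R).length : ℝ) with hn
    have h2 : n ≤ 1 / δ := by
      rw [le_div_iff₀ hδ]
      have := (mul_length_longRuns_le (δ * tot R) R).trans (tot_longRuns_le _ hR)
      rw [← hn] at this
      by_contra hc
      push Not at hc
      nlinarith
    have h3 : n * σ ≤ 1 / δ * σ := by gcongr
    have h4 : (n + 1) * (β * σ) ≤ (1 / δ + 1) * (β * σ) := by gcongr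
    have h5 := mul_le_mul_of_nonneg_left hh (sub_nonneg.2 hα1)
    linarith

lemma isCovered_of_isHalfCovered {δ : ℝ} {R : List (ℤ × ℝ)} (hδ : 0 < δ) (hδ8 : δ ≤ 1 / 8)
    (hR : ∀ x ∈ R, 0 < x.2) (hh : ∀ g, g <:+: R → IsHalfCovered δ g) :
    IsCovered (7 / 8) (δ ^ 3 / 32) (17 / 20) R := by
  have key : ∀ g, g <:+: R → ∀ σ, 0 ≤ σ →
      7 / 8 * tot g - (1 / δ + (1 / δ + 1) * (1 / δ + (1 / δ + 1) * (1 / (2 * δ)))) * σ ≤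
        shortLen σ g := by
    intro g hg σ hσ
    have hpos : ∀ g, g <:+: R → ∀ x ∈ g, 0 < x.2 := fun g hg x hx => hR x (hg.subset hx)
    have h1 : ∀ g, g <:+: R → 1 / 2 * tot g - 1 / (2 * δ) * σ ≤ shortLen σ g :=
      fun g hg => le_shortLen_base hδ hσ (hpos g hg) (hh g hg)
    have h2 : ∀ g, g <:+: R → (1 + 1 / 2) / 2 * tot g -
        (1 / δ + (1 / δ + 1) * (1 / (2 * δ))) * σ ≤ shortLen σ g := fun g hg =>
      le_shortLen_step hδ hσ (by norm_num) (by positivity) (hpos g hg) (hh g hg)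
        fun g' hg' => h1 g' (hg'.trans hg)
    have h3 := le_shortLen_step hδ hσ (by norm_num) (by positivity) (hpos g hg) (hh g hg)
        fun g' hg' => h2 g' (hg'.trans hg)
    refine le_trans (le_of_eq ?_) h3
    norm_num
  have hτ : (1 / δ + (1 / δ + 1) * (1 / δ + (1 / δ + 1) * (1 / (2 * δ)))) * (δ ^ 3 / 32) ≤
      1 / 40 := by
    have : (1 / δ + (1 / δ + 1) * (1 / δ + (1 / δ + 1) * (1 / (2 * δ)))) * (δ ^ 3 / 32) =
      (δ ^ 2 + (1 + δ) * (δ + (1 + δ) / 2)) / 32 := by field_simp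
    rw [this]
    nlinarith
  clear hh
  induction R with
  | nil => trivial
  | cons x R ih =>
    have hx := hR x (by simp)
    have hR' : ∀ y ∈ R, 0 < y.2 := fun y hy => hR y (by simp [hy])
    have ht := tot_nonneg fun x hx => (hR' x hx).le
    refine ⟨?_, ih hR' fun g hg => key g (hg.trans (List.suffix_cons x R).isInfix)⟩
    have h1 := key R (List.suffix_cons x R).isInfix (δ ^ 3 / 32 * (x.2 + tot R)) (by positivity)
    have h2 := shortLen_le_truncLen (c := x.2) (by positivity : 0 ≤ δ ^ 3 / 32)
      (fun y hy => (hR' y hy).le) le_rfl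
    have h3 := mul_le_mul_of_nonneg_right hτ (by linarith : 0 ≤ x.2 + tot R)
    linarith

lemma le_rpow_of_le_pow {n : ℕ} {g r : ℝ} (hn : 2 ≤ n) (hr : (n : ℝ) ≤ r) (hg : 0 ≤ g)
    (h : (n : ℝ) ≤ g ^ (n - 1)) : r ≤ g ^ (r - 1) := by
  have hn' : (2 : ℝ) ≤ n := by exact_mod_cast hn
  have h1 : (g ^ (n - 1)) ^ ((r - 1) / (n - 1)) = g ^ (r - 1) := by
    rw [← Real.rpow_natCast g, ← Real.rpow_mul hg, Nat.cast_sub (by omega), Nat.cast_one,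
      mul_div_cancel₀ _ (by linarith)]
  rw [← h1]
  have h2 := one_add_mul_self_le_rpow_one_add (s := (n : ℝ) - 1) (p := (r - 1) / (n - 1))
    (by linarith) (by rw [le_div_iff₀ (by linarith)]; linarith)
  rw [div_mul_cancel₀ _ (by linarith)] at h2
  calc r = 1 + (r - 1) := by ring
    _ ≤ _ := h2
    _ ≤ _ := Real.rpow_le_rpow (by linarith) (by linarith)
      (div_nonneg (by linarith) (by linarith))

lemma one_sub_inv_rpow_le {n : ℕ} {r : ℝ} (hr : 2 ≤ r) (hn : r ≤ n) :
    (1 - 1 / r) ^ r ≤ (1 - 1 / (n : ℝ)) ^ n := by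
  have hn0 : (0 : ℝ) < n := by linarith
  have h1 : 1 / r ≤ 1 := by rw [div_le_one (by linarith)]; linarith
  have h2 := rpow_one_add_le_one_add_mul_self (s := -(1 / r)) (p := r / n)
    (by linarith) (by positivity) (by rw [div_le_one hn0]; exact hn)
  have h3 : 1 + r / n * -(1 / r) = 1 - 1 / (n : ℝ) := by field_simp; ring
  rw [h3, ← sub_eq_add_neg] at h2
  have h4 : (1 - 1 / r) ^ r = ((1 - 1 / r) ^ (r / n)) ^ n := by
    rw [← Real.rpow_natCast, ← Real.rpow_mul (by linarith), div_mul_cancel₀ _ hn0.ne']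
  rw [h4]
  exact pow_le_pow_left₀ (Real.rpow_nonneg (by linarith) _) h2 _

lemma numeric_piece {m n : ℕ} {K r : ℝ} (hm2 : 2 ≤ m) (hm : (m : ℝ) ≤ r) (hn : r ≤ n)
    (hK : 4 ≤ K)
    (h : (K / 4) ^ (n - 1) * (((7 / 8) ^ (m - 1) + 1) / 2.7724 +
      70 / 17 * (1 - 1 / (n : ℝ)) ^ n) ≤ 4) :
    (K / 4) ^ (r - 1) * (((7 / 8 : ℝ) ^ (r - 1) + 1) / 2.7724 +
      70 / 17 * (1 - 1 / r) ^ r) ≤ 4 := by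
  have hm2' : (2 : ℝ) ≤ m := by exact_mod_cast hm2
  have hn2 : 2 ≤ n := by
    have : (2 : ℝ) ≤ n := by linarith
    exact_mod_cast this
  have h1 : (K / 4) ^ (r - 1) ≤ (K / 4) ^ (n - 1) := by
    rw [← Real.rpow_natCast, Nat.cast_sub (by omega), Nat.cast_one]
    exact Real.rpow_le_rpow_of_exponent_le (by linarith) (by linarith)
  have h2 : (7 / 8 : ℝ) ^ (r - 1) ≤ (7 / 8) ^ (m - 1) := by
    rw [← Real.rpow_natCast, Nat.cast_sub (by omega), Nat.cast_one]
    exact Real.rpow_le_rpow_of_exponent_ge (by norm_num) (by norm_num) (by linarith)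
  have h3 := one_sub_inv_rpow_le (hm2'.trans hm) hn
  have h4 : 0 ≤ 1 - 1 / r := by
    rw [sub_nonneg, div_le_one (by linarith)]; linarith
  refine le_trans ?_ h
  gcongr

lemma exists_numeric_constant {r : ℝ} (hr : 2 ≤ r) : ∃ g : ℝ, 0 < g ∧ r ≤ g ^ (r - 1) ∧
    ((2 * g / (17 / 20) + 1) / 4) ^ (r - 1) * (((7 / 8 : ℝ) ^ (r - 1) + 1) / 2.7724 +
      70 / 17 * (1 - 1 / r) ^ r) ≤ 4 := by
  have key : ∀ (m n : ℕ) (g : ℝ), 2 ≤ m → (m : ℝ) ≤ r → r ≤ n → 0 < g → (m : ℝ) ≤ g ^ (m - 1) →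
      4 ≤ 2 * g / (17 / 20) + 1 →
      ((2 * g / (17 / 20) + 1) / 4) ^ (n - 1) * (((7 / 8) ^ (m - 1) + 1) / 2.7724 +
        70 / 17 * (1 - 1 / (n : ℝ)) ^ n) ≤ 4 → ∃ g : ℝ, 0 < g ∧ r ≤ g ^ (r - 1) ∧
    ((2 * g / (17 / 20) + 1) / 4) ^ (r - 1) * (((7 / 8 : ℝ) ^ (r - 1) + 1) / 2.7724 +
      70 / 17 * (1 - 1 / r) ^ r) ≤ 4 := fun m n g h1 h2 h3 h4 h5 h6 h7 =>
    ⟨g, h4, le_rpow_of_le_pow h1 h2 h4.le h5, numeric_piece h1 h2 h3 h6 h7⟩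
  rcases le_total r 3 with h | h
  · exact key 2 3 2 (by norm_num) (by exact_mod_cast hr) (by exact_mod_cast h) (by norm_num)
      (by norm_num) (by norm_num) (by norm_num)
  rcases le_total r 4 with h' | h'
  · exact key 3 4 1.7321 (by norm_num) (by exact_mod_cast h) (by exact_mod_cast h') (by norm_num)
      (by norm_num) (by norm_num) (by norm_num)
  rcases le_total r 5 with h | h
  · exact key 4 5 1.5875 (by norm_num) (by exact_mod_cast h') (by exact_mod_cast h) (by norm_num)
      (by norm_num) (by norm_num) (by norm_num)
  rcases le_total r 6 with h' | h'
  · exact key 5 6 1.4954 (by norm_num) (by exact_mod_cast h) (by exact_mod_cast h') (by norm_num)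
      (by norm_num) (by norm_num) (by norm_num)
  rcases le_total r 8 with h | h
  · exact key 6 8 1.4311 (by norm_num) (by exact_mod_cast h') (by exact_mod_cast h) (by norm_num)
      (by norm_num) (by norm_num) (by norm_num)
  rcases le_total r 12 with h' | h'
  · exact key 8 12 1.346 (by norm_num) (by exact_mod_cast h) (by exact_mod_cast h') (by norm_num)
      (by norm_num) (by norm_num) (by norm_num)
  refine ⟨1.2536, by norm_num, le_rpow_of_le_pow (n := 12) (by norm_num) (by exact_mod_cast h')
    (by norm_num) (by norm_num), ?_⟩
  have h1 : ((2 * 1.2536 / (17 / 20) + 1) / 4 : ℝ) ^ (r - 1) ≤ 1 :=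
    Real.rpow_le_one (by norm_num) (by norm_num) (by linarith)
  have h2 : (7 / 8 : ℝ) ^ (r - 1) ≤ 1 := Real.rpow_le_one (by norm_num) (by norm_num) (by linarith)
  have h4 : 0 ≤ 1 - 1 / r := by
    rw [sub_nonneg, div_le_one (by linarith)]; linarith
  have h3 : (1 - 1 / r) ^ r ≤ 1 / 2 := by
    calc (1 - 1 / r) ^ r ≤ (Real.exp (-(1 / r))) ^ r := by
          refine Real.rpow_le_rpow h4 ?_ (by linarith)
          have := Real.add_one_le_exp (-(1 / r))
          linarith
      _ = Real.exp (-1) := by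
          rw [← Real.exp_mul]; congr 1; field_simp
      _ ≤ 1 / 2 := by
          rw [Real.exp_neg, one_div]
          have := Real.add_one_le_exp (1 : ℝ)
          exact inv_anti₀ (by norm_num) (by linarith)
  calc _ ≤ (1 : ℝ) * ((1 + 1) / 2.7724 + 70 / 17 * (1 / 2)) := by gcongr
    _ ≤ 4 := by norm_num

lemma exists_constant_le {r δ : ℝ} (hr : 2 ≤ r) (hδ : 0 < δ) (hδ8 : δ ≤ 1 / 8) :
    ∃ g : ℝ, 0 < g ∧ r ≤ g ^ (r - 1) ∧
    (2 * g / (17 / 20) + 1) ^ (r - 1) * ((7 / 8 : ℝ) ^ (r - 1) +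
      (1 - 1 / r) ^ r / (17 / 20) * Real.log (1 / (δ ^ 3 / 32)) + 1) ≤
      4 ^ r * Real.log (2 / δ) := by
  obtain ⟨g, hg, h1, h2⟩ := exists_numeric_constant hr
  refine ⟨g, hg, h1, ?_⟩
  set L := Real.log (2 / δ) with hL
  have hlog : Real.log (1 / (δ ^ 3 / 32)) = 3 * L + 2 * Real.log 2 := by
    rw [hL, Real.log_div two_ne_zero hδ.ne', one_div_div,
      Real.log_div (by norm_num) (by positivity), Real.log_pow,
      show (32 : ℝ) = 2 ^ 5 by norm_num, Real.log_pow]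
    push_cast; ring
  have hL4 : 4 * Real.log 2 ≤ L := by
    rw [hL, show 4 * Real.log 2 = Real.log (2 ^ 4) by rw [Real.log_pow]; norm_num]
    apply Real.log_le_log (by norm_num)
    rw [le_div_iff₀ hδ]; linarith
  have hl2 := Real.log_two_gt_d9
  have hL' : 2.7724 ≤ L := by linarith
  have hq : 0 ≤ 1 - 1 / r := by
    rw [sub_nonneg, div_le_one (by linarith)]; linarith
  have hC : (7 / 8 : ℝ) ^ (r - 1) +
      (1 - 1 / r) ^ r / (17 / 20) * Real.log (1 / (δ ^ 3 / 32)) + 1 ≤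
      L * (((7 / 8 : ℝ) ^ (r - 1) + 1) / 2.7724 + 70 / 17 * (1 - 1 / r) ^ r) := by
    have e1 : (7 / 8 : ℝ) ^ (r - 1) + 1 ≤ L * (((7 / 8 : ℝ) ^ (r - 1) + 1) / 2.7724) := by
      rw [mul_div_left_comm]
      refine le_mul_of_one_le_right (by positivity) ?_
      rw [one_le_div (by norm_num)]; exact hL'
    have e2 : (1 - 1 / r) ^ r / (17 / 20) * Real.log (1 / (δ ^ 3 / 32)) ≤
        (1 - 1 / r) ^ r / (17 / 20) * (7 / 2 * L) := by
      gcongr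
      rw [hlog]; linarith
    linarith
  have hK : 0 < 2 * g / (17 / 20) + 1 := by positivity
  have h4 : (4 : ℝ) ^ r = 4 * 4 ^ (r - 1) := by
    rw [Real.rpow_sub_one (by norm_num)]; field_simp
  rw [Real.div_rpow hK.le (by norm_num), div_mul_eq_mul_div, div_le_iff₀ (by positivity)] at h2
  calc _ ≤ (2 * g / (17 / 20) + 1) ^ (r - 1) *
        (L * (((7 / 8 : ℝ) ^ (r - 1) + 1) / 2.7724 + 70 / 17 * (1 - 1 / r) ^ r)) := by gcongr
    _ = L * ((2 * g / (17 / 20) + 1) ^ (r - 1) *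
        (((7 / 8 : ℝ) ^ (r - 1) + 1) / 2.7724 + 70 / 17 * (1 - 1 / r) ^ r)) := by ring
    _ ≤ L * (4 * 4 ^ (r - 1)) := by gcongr
    _ = _ := by rw [h4]; ring

lemma add_add_rpow_le {r g h A B t : ℝ} (hr : 2 ≤ r) (hg : 0 < g) (hh : 0 < h)
    (hgr : r ≤ g ^ (r - 1)) (hA : 0 ≤ A) (hB : 0 ≤ B) (ht : 0 ≤ t) :
    (A + B + t) ^ r ≤ (2 * g / h + 1) ^ (r - 1) *
      (h ^ (r - 1) / r * A ^ r + h ^ (r - 1) / r * B ^ r + t ^ r) := by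
  set K := 2 * g / h + 1 with hK
  have hK0 : 0 < K := by positivity
  have h1 := Real.rpow_arith_mean_le_arith_mean_rpow (Finset.univ : Finset (Fin 3))
    ![g / h / K, g / h / K, 1 / K] ![A * (K * h / g), B * (K * h / g), t * K]
    (by intro i _; fin_cases i <;> simp <;> positivity)
    (by simp [Fin.sum_univ_three]; field_simp; rw [hK]; field_simp; ring)
    (by intro i _; fin_cases i <;> simp <;> positivity) (by linarith : 1 ≤ r)
  simp only [Fin.sum_univ_three, Matrix.cons_val_zero, Matrix.cons_val_one, Matrix.cons_val] at h1
  have e1 : g / h / K * (A * (K * h / g)) + g / h / K * (B * (K * h / g)) + 1 / K * (t * K) =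
      A + B + t := by field_simp
  have e2 : ∀ x : ℝ, 0 ≤ x → g / h / K * (x * (K * h / g)) ^ r ≤
      K ^ (r - 1) * (h ^ (r - 1) / r * x ^ r) := fun x hx => by
    have : (K * h / g) ^ r = (K * h / g) * (K ^ (r - 1) * h ^ (r - 1) / g ^ (r - 1)) := by
      rw [← Real.mul_rpow hK0.le hh.le, ← Real.div_rpow (by positivity) hg.le,
        Real.rpow_sub_one (by positivity)]
      field_simp
    rw [Real.mul_rpow hx (by positivity), this]
    calc _ = K ^ (r - 1) * (h ^ (r - 1) / g ^ (r - 1) * x ^ r) := by field_simp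
      _ ≤ _ := by gcongr
  have e3 : 1 / K * (t * K) ^ r = K ^ (r - 1) * t ^ r := by
    rw [Real.mul_rpow ht hK0.le, Real.rpow_sub_one hK0.ne']; ring
  rw [e1, e3] at h1
  linarith [e2 A hA, e2 B hB]

section Trees

open SimpleGraph

variable {T : MetricTree}

lemma MetricTree.isPath_path (T : MetricTree) (u v : T.V) : (T.path u v).IsPath :=
  (T.isTree.existsUnique_path u v).exists.choose_spec

lemma MetricTree.eq_path {u v : T.V} {p : T.G.Walk u v} (hp : p.IsPath) : p = T.path u v :=
  (T.isTree.existsUnique_path u v).unique hp (T.isPath_path u v)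

/-- The edges of the path from the root `r` to `x`. -/
noncomputable def rootEdges (T : MetricTree) (r x : T.V) : List (Sym2 T.V) := (T.path r x).edges

lemma nodup_rootEdges (r x : T.V) : (rootEdges T r x).Nodup :=
  (T.isPath_path r x).isTrail.edges_nodup

lemma mem_edgeSet_of_mem_rootEdges {r x : T.V} {e : Sym2 T.V} (he : e ∈ rootEdges T r x) :
    e ∈ T.G.edgeSet := Walk.edges_subset_edgeSet _ he

lemma exists_rootEdges_eq_of_append {r x : T.V} {X Y : List (Sym2 T.V)}
    (h : rootEdges T r x = X ++ Y) : ∃ y, rootEdges T r y = X := by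
  refine ⟨(T.path r x).getVert X.length, ?_⟩
  rw [rootEdges, ← T.eq_path ((T.isPath_path r x).take X.length), Walk.edges_take]
  rw [rootEdges] at h
  rw [h, List.take_left]

lemma eq_of_edges_eq {G : SimpleGraph T.V} {u x y : T.V} (p : G.Walk u x) (q : G.Walk u y)
    (h : p.edges = q.edges) : x = y := by
  induction p with
  | nil =>
    cases q with
    | nil => rfl
    | cons _ _ => simp at h
  | cons ha p ih =>
    cases q with
    | nil => simp at h
    | cons hb q =>
      rw [Walk.edges_cons, Walk.edges_cons, List.cons.injEq] at h
      obtain rfl := Sym2.congr_right.1 h.1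
      exact ih q h.2

lemma exists_eq_append_common {α : Type*} (L L' : List α) : ∃ P U W, L = P ++ U ∧ L' = P ++ W ∧
    ∀ a ∈ U.head?, ∀ b ∈ W.head?, a ≠ b := by
  induction L generalizing L' with
  | nil => exact ⟨[], [], L', rfl, rfl, by simp⟩
  | cons a L ih =>
    cases L' with
    | nil => exact ⟨[], a :: L, [], rfl, rfl, by simp⟩
    | cons b L' =>
      by_cases hab : a = b
      · subst hab
        obtain ⟨P, U, W, rfl, rfl, h⟩ := ih L'
        exact ⟨a :: P, U, W, rfl, rfl, h⟩
      · exact ⟨[], a :: L, b :: L', rfl, rfl, by simpa using hab⟩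

lemma exists_path_edges_eq (r u v : T.V) : ∃ P U W, rootEdges T r u = P ++ U ∧
    rootEdges T r v = P ++ W ∧ (T.path u v).edges = U.reverse ++ W ∧ U.Disjoint W := by
  obtain ⟨P, U, W, hU, hW, h⟩ := exists_eq_append_common (rootEdges T r u) (rootEdges T r v)
  refine ⟨P, U, W, hU, hW, ?_⟩
  have hnU := nodup_rootEdges r u
  have hnW := nodup_rootEdges r v
  rw [hU] at hnU
  rw [hW] at hnW
  have hz : (T.path r u).getVert P.length = (T.path r v).getVert P.length := by
    apply eq_of_edges_eq ((T.path r u).take P.length) ((T.path r v).take P.length)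
    rw [rootEdges] at hU hW
    rw [Walk.edges_take, Walk.edges_take, hU, hW, List.take_left, List.take_left]
  set p := ((T.path r u).drop P.length).reverse.append
    (((T.path r v).drop P.length).copy hz.symm rfl) with hp
  have hpe : p.edges = U.reverse ++ W := by
    rw [rootEdges] at hU hW
    rw [hp, Walk.edges_append, Walk.edges_reverse, Walk.edges_copy, Walk.edges_drop,
      Walk.edges_drop, hU, hW, List.drop_left, List.drop_left]
  have hpp : p.IsPath := by
    rw [T.isTree.isAcyclic.isPath_iff_isChain, hpe, List.isChain_append]
    refine ⟨(List.nodup_reverse.2 hnU.of_append_right).isChain, hnW.of_append_right.isChain, ?_⟩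
    rw [List.getLast?_reverse]
    exact h
  rw [← T.eq_path hpp, hpe]
  refine ⟨rfl, ?_⟩
  have hn : (U.reverse ++ W).Nodup := hpe ▸ hpp.isTrail.edges_nodup
  intro a ha hb
  exact List.disjoint_of_nodup_append hn (List.mem_reverse.2 ha) hb

lemma eq_of_rootEdges_concat {r y y' : T.V} {X X' : List (Sym2 T.V)} {e : Sym2 T.V}
    (h : rootEdges T r y = X ++ [e]) (h' : rootEdges T r y' = X' ++ [e]) : X = X' := by
  obtain ⟨P, U, W, hU, hW, -, hd⟩ := exists_path_edges_eq r y y'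
  have hn := nodup_rootEdges r y
  have hn' := nodup_rootEdges r y'
  rcases List.eq_nil_or_concat' U with rfl | ⟨U, a, rfl⟩ <;>
  rcases List.eq_nil_or_concat' W with rfl | ⟨W, b, rfl⟩
  · rw [List.append_nil] at hU hW
    rw [h] at hU
    rw [h', ← hU] at hW
    exact (List.append_inj' hW rfl).1.symm
  · rw [List.append_nil, h] at hU
    rw [h', ← List.append_assoc] at hW
    obtain ⟨h1, h2⟩ := List.append_inj' hW rfl
    rw [h', h1, ← hU] at hn'
    simp [List.nodup_append] at hn'
  · rw [List.append_nil, h'] at hW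
    rw [h, ← List.append_assoc] at hU
    obtain ⟨h1, h2⟩ := List.append_inj' hU rfl
    rw [h, h1, ← hW] at hn
    simp [List.nodup_append] at hn
  · rw [h, ← List.append_assoc] at hU
    rw [h', ← List.append_assoc] at hW
    obtain ⟨-, h2⟩ := List.append_inj' hU rfl
    obtain ⟨-, h3⟩ := List.append_inj' hW rfl
    simp only [List.cons.injEq, and_true] at h2 h3
    subst h2
    subst h3
    exact absurd (hd (a := e) (by simp) (by simp)) id

lemma rootEdges_of_adj {r x y : T.V} (h : T.G.Adj x y) :
    rootEdges T r y = rootEdges T r x ++ [s(x, y)] ∨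
      rootEdges T r x = rootEdges T r y ++ [s(x, y)] := by
  obtain ⟨P, U, W, hU, hW, he, -⟩ := exists_path_edges_eq r x y
  rw [← T.eq_path (Walk.IsPath.of_adj h)] at he
  have he : [s(x, y)] = U.reverse ++ W := by simpa using he
  cases W with
  | nil =>
    right
    rw [List.append_nil] at hW he
    rw [hU, hW, ← List.reverse_reverse U, ← he, List.reverse_singleton]
  | cons b W =>
    left
    have hl := congrArg List.length he
    simp only [List.length_append, List.length_reverse, List.length_cons, List.length_nil] at hl
    have h1 : U = [] := List.length_eq_zero_iff.1 (by omega)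
    subst h1
    rw [List.append_nil] at hU
    rw [hW, hU, he, List.reverse_nil, List.nil_append]

lemma exists_path_edges_eq_of_append {r x : T.V} {X Y Z : List (Sym2 T.V)}
    (h : rootEdges T r x = X ++ Y ++ Z) : ∃ y z, (T.path y z).edges = Y := by
  obtain ⟨z, hz⟩ := exists_rootEdges_eq_of_append h
  obtain ⟨y, hy⟩ := exists_rootEdges_eq_of_append hz
  refine ⟨y, z, ?_⟩
  obtain ⟨P, U, W, hU, hW, he, hd⟩ := exists_path_edges_eq r y z
  rw [hz, ← hy, hU, List.append_assoc, List.append_cancel_left_eq] at hW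
  cases U with
  | nil => rw [he, ← hW]; rfl
  | cons a U => exact absurd (hd (a := a) (by simp) (by rw [← hW]; simp)) id

lemma IsMonotoneColoring.exists_class {r : T.V} {χ : Sym2 T.V → ℤ} (hχ : IsMonotoneColoring T r χ)
    (m : ℤ) : ∃ b A M, rootEdges T r b = A ++ M ∧ ∀ e ∈ T.G.edgeSet, (χ e = m ↔ e ∈ M) := by
  classical
  obtain ⟨a, b, hab, h⟩ := hχ m
  have h1 : rootEdges T r b = rootEdges T r a ++ (T.path a b).edges := by
    rw [rootEdges, rootEdges, ← T.eq_path ((T.isPath_path r b).takeUntil hab),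
      ← T.eq_path ((T.isPath_path r b).dropUntil hab), ← Walk.edges_append, Walk.take_spec]
  exact ⟨b, _, _, h1, h⟩

/-- Edges of the same color are comparable in the tree order. -/
lemma IsMonotoneColoring.comparable {r u v : T.V} {χ : Sym2 T.V → ℤ}
    (hχ : IsMonotoneColoring T r χ) {X Y X' Y' : List (Sym2 T.V)} {e e' : Sym2 T.V}
    (hu : rootEdges T r u = X ++ e :: Y) (hv : rootEdges T r v = X' ++ e' :: Y')
    (he : χ e = χ e') : (∃ Z, X' ++ [e'] = X ++ e :: Z ∧ ∀ a ∈ Z, χ a = χ e) ∨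
      ∃ Z, X ++ [e] = X' ++ e' :: Z ∧ ∀ a ∈ Z, χ a = χ e := by
  obtain ⟨b, A, M, hb, hM⟩ := hχ.exists_class (χ e)
  have hMe : e ∈ M :=
    (hM e (mem_edgeSet_of_mem_rootEdges (r := r) (x := u) (by rw [hu]; simp))).1 rfl
  have hMe' : e' ∈ M :=
    (hM e' (mem_edgeSet_of_mem_rootEdges (r := r) (x := v) (by rw [hv]; simp))).1 he.symm
  have hMc : ∀ a ∈ M, χ a = χ e := fun a ha =>
    (hM a (mem_edgeSet_of_mem_rootEdges (r := r) (x := b) (by rw [hb]; simp [ha]))).2 ha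
  obtain ⟨u', hu'⟩ := exists_rootEdges_eq_of_append (X := X ++ [e]) (Y := Y) (by simpa using hu)
  obtain ⟨v', hv'⟩ := exists_rootEdges_eq_of_append (X := X' ++ [e']) (Y := Y') (by simpa using hv)
  have key : ∀ (e e' : Sym2 T.V) (X X' M₁ M₂ : List (Sym2 T.V)) (u' v' : T.V),
      rootEdges T r u' = X ++ [e] → rootEdges T r v' = X' ++ [e'] → M = M₁ ++ e :: M₂ →
      e' ∈ M₂ → ∃ Z, X' ++ [e'] = X ++ e :: Z ∧ ∀ a ∈ Z, a ∈ M := by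
    intro e e' X X' M₁ M₂ u' v' hu' hv' hM' he'
    obtain ⟨M₃, M₄, rfl⟩ := List.append_of_mem he'
    obtain ⟨b₁, hb₁⟩ := exists_rootEdges_eq_of_append (X := (A ++ M₁ ++ e :: M₃) ++ [e']) (Y := M₄)
      (by rw [hb, hM']; simp)
    obtain ⟨b₂, hb₂⟩ := exists_rootEdges_eq_of_append (X := (A ++ M₁) ++ [e])
      (Y := M₃ ++ e' :: M₄) (by rw [hb, hM']; simp)
    have h1 := eq_of_rootEdges_concat hv' hb₁
    have h2 := eq_of_rootEdges_concat hu' hb₂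
    refine ⟨M₃ ++ [e'], by rw [h1, h2]; simp, ?_⟩
    intro a ha
    rw [hM']
    simp only [List.mem_append, List.mem_cons, List.not_mem_nil, or_false] at ha ⊢
    tauto
  obtain ⟨M₁, M₂, hM₁⟩ := List.append_of_mem hMe
  have h3 : e' ∈ M₁ ∨ e' = e ∨ e' ∈ M₂ := by simpa [hM₁] using hMe'
  rcases h3 with h3 | h3 | h3
  · right
    obtain ⟨M₃, M₄, rfl⟩ := List.append_of_mem h3
    obtain ⟨Z, hZ, hZ'⟩ := key e' e X' X M₃ (M₄ ++ e :: M₂) v' u' hv' hu' (by rw [hM₁]; simp)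
      (by simp)
    exact ⟨Z, hZ, fun a ha => hMc a (hZ' a ha)⟩
  · left
    subst h3
    exact ⟨[], by rw [eq_of_rootEdges_concat hu' hv'], by simp⟩
  · left
    obtain ⟨Z, hZ, hZ'⟩ := key e e' X X' M₁ M₂ u' v' hu' hv' hM₁ h3
    exact ⟨Z, hZ, fun a ha => hMc a (hZ' a ha)⟩

/-- Edges of equal colors in the list are only separated by edges of the same color. -/
def IsContiguous {α : Type*} (χ : α → ℤ) (E : List α) : Prop :=
  ∀ X e Y e' Z, E = X ++ e :: Y ++ e' :: Z → χ e = χ e' → ∀ a ∈ Y, χ a = χ e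

lemma IsMonotoneColoring.isContiguous {r : T.V} {χ : Sym2 T.V → ℤ}
    (hχ : IsMonotoneColoring T r χ) (x : T.V) : IsContiguous χ (rootEdges T r x) := by
  intro X e Y e' Z h he a ha
  have hu : rootEdges T r x = X ++ e :: (Y ++ e' :: Z) := by simpa using h
  rcases hχ.comparable hu h he with ⟨Z', hZ, hZ'⟩ | ⟨Z', hZ, -⟩
  · have : Y ++ [e'] = Z' := by simpa using hZ
    exact hZ' a (by rw [← this]; simp [ha])
  · have h1 := congrArg List.length hZ
    simp at h1

lemma IsMonotoneColoring.color_ne {r u v : T.V} {χ : Sym2 T.V → ℤ}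
    (hχ : IsMonotoneColoring T r χ) {P U W : List (Sym2 T.V)}
    (hu : rootEdges T r u = P ++ U) (hv : rootEdges T r v = P ++ W) (hd : U.Disjoint W)
    {e e' : Sym2 T.V} (he : e ∈ U) (he' : e' ∈ W) : χ e ≠ χ e' := by
  intro hc
  have hnu := nodup_rootEdges r u
  have hnv := nodup_rootEdges r v
  rw [hu] at hnu
  rw [hv] at hnv
  have hdu := List.disjoint_of_nodup_append hnu
  have hdv := List.disjoint_of_nodup_append hnv
  obtain ⟨U₁, U₂, rfl⟩ := List.append_of_mem he
  obtain ⟨W₁, W₂, rfl⟩ := List.append_of_mem he'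
  rcases hχ.comparable (X := P ++ U₁) (Y := U₂) (X' := P ++ W₁) (Y' := W₂) (by simpa using hu)
    (by simpa using hv) hc with ⟨Z, hZ, -⟩ | ⟨Z, hZ, -⟩
  · have h1 : e ∈ P ++ W₁ ++ [e'] := by rw [hZ]; simp
    simp only [List.mem_append, List.mem_singleton] at h1
    rcases h1 with (h1 | h1) | h1
    · exact hdu h1 he
    · exact hd he (by simp [h1])
    · exact hd he (by simp [h1])
  · have h1 : e' ∈ P ++ U₁ ++ [e] := by rw [hZ]; simp
    simp only [List.mem_append, List.mem_singleton] at h1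
    rcases h1 with (h1 | h1) | h1
    · exact hdv h1 he'
    · exact hd (by simp [h1]) he'
    · exact hd (by simp [h1]) he'

section Runs

variable {α : Type*} {χ : α → ℤ}

lemma IsContiguous.of_append {X Y Z : List α} (h : IsContiguous χ (X ++ Y ++ Z)) :
    IsContiguous χ Y := by
  intro X' e Y' e' Z' hE
  exact h (X ++ X') e Y' e' (Z' ++ Z) (by rw [hE]; simp)

lemma IsContiguous.exists_append {E : List α} {e : α} (h : IsContiguous χ (E ++ [e])) :
    ∃ E₀ M, E = E₀ ++ M ∧ (∀ a ∈ E₀, χ a ≠ χ e) ∧ ∀ a ∈ M, χ a = χ e := by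
  refine ⟨E.takeWhile (fun a => χ a ≠ χ e), E.dropWhile (fun a => χ a ≠ χ e),
    List.takeWhile_append_dropWhile.symm, fun a ha => by simpa using List.mem_takeWhile_imp ha, ?_⟩
  cases hM : E.dropWhile (fun a => χ a ≠ χ e) with
  | nil => simp
  | cons b M =>
    have hb : χ b = χ e := by
      have h1 := List.head_dropWhile_not (fun a => decide (χ a ≠ χ e)) (l := E) (by rw [hM]; simp)
      simp only [hM, List.head_cons] at h1
      simpa using h1
    have h2 := h (E.takeWhile (fun a => χ a ≠ χ e)) b M e []
      (by rw [List.append_assoc, List.cons_append, ← List.cons_append, ← hM, ← List.append_assoc,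
        List.takeWhile_append_dropWhile]) hb
    intro a ha
    rcases List.mem_cons.1 ha with rfl | ha
    · exact hb
    · rw [h2 a ha, hb]

lemma IsContiguous.exists_split {P U : List α} {p : α} (h : IsContiguous χ (P ++ [p] ++ U)) :
    ∃ U₁ U₂, U = U₁ ++ U₂ ∧ (∀ a ∈ U₁, χ a = χ p) ∧
      ∀ a ∈ P ++ [p] ++ U₁, ∀ b ∈ U₂, χ a ≠ χ b := by
  refine ⟨U.takeWhile (fun a => χ a = χ p), U.dropWhile (fun a => χ a = χ p),
    List.takeWhile_append_dropWhile.symm, fun a ha => by simpa using List.mem_takeWhile_imp ha, ?_⟩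
  set U₁ := U.takeWhile (fun a => χ a = χ p) with hU₁
  cases hU₂ : U.dropWhile (fun a => χ a = χ p) with
  | nil => simp
  | cons b₀ U₂ =>
    have hb : χ b₀ ≠ χ p := by
      have h1 := List.head_dropWhile_not (fun a => decide (χ a = χ p)) (l := U) (by rw [hU₂]; simp)
      simpa [hU₂] using h1
    have hU : U = U₁ ++ b₀ :: U₂ := by rw [← hU₂, List.takeWhile_append_dropWhile]
    intro a ha b hb' hab
    have key : χ a = χ p := by
      simp only [List.mem_append, List.mem_singleton] at ha
      rcases ha with (ha | rfl) | ha
      · obtain ⟨P₁, P₂, rfl⟩ := List.append_of_mem ha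
        obtain ⟨V₁, V₂, hV⟩ := List.append_of_mem hb'
        refine (h P₁ a (P₂ ++ p :: (U₁ ++ V₁)) b V₂ ?_ hab p (by simp)).symm
        rw [hU, hV]; simp
      · rfl
      · simpa using List.mem_takeWhile_imp ha
    rcases List.mem_cons.1 hb' with rfl | hb'
    · exact hb (hab.symm.trans key)
    · obtain ⟨V₁, V₂, rfl⟩ := List.append_of_mem hb'
      exact hb (h P p (U₁ ++ b₀ :: V₁) b V₂ (by rw [hU]; simp) (key.symm.trans hab) b₀ (by simp))

/-- The list of the colors in `E`, with the total weight of each color. -/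
noncomputable def runs (χ : α → ℤ) (w : α → ℝ) (E : List α) : List (ℤ × ℝ) :=
  (E.map χ).dedup.map fun k => (k, ((E.filter fun e => χ e = k).map w).sum)

variable {w : α → ℝ}

lemma map_fst_runs (E : List α) : (runs χ w E).map Prod.fst = (E.map χ).dedup := by
  simp [runs, Function.comp_def]

lemma nodup_runs (E : List α) : ((runs χ w E).map Prod.fst).Nodup := by
  rw [map_fst_runs]; exact List.nodup_dedup _

lemma mem_map_fst_runs {E : List α} {k : ℤ} :
    k ∈ (runs χ w E).map Prod.fst ↔ ∃ e ∈ E, χ e = k := by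
  rw [map_fst_runs, List.mem_dedup, List.mem_map]

lemma sum_map_pos {E : List α} (hw : ∀ e ∈ E, 0 < w e) (hE : E ≠ []) : 0 < (E.map w).sum :=
  List.sum_pos _ (by simpa using hw) (by simpa using hE)

lemma sum_map_nonneg {E : List α} (hw : ∀ e ∈ E, 0 < w e) : 0 ≤ (E.map w).sum :=
  List.sum_nonneg (by simpa using fun e he => (hw e he).le)

lemma runs_pos {E : List α} (hw : ∀ e ∈ E, 0 < w e) : ∀ x ∈ runs χ w E, 0 < x.2 := by
  intro x hx
  obtain ⟨k, hk, rfl⟩ := List.mem_map.1 hx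
  rw [List.mem_dedup, List.mem_map] at hk
  obtain ⟨e, he, hek⟩ := hk
  refine sum_map_pos (fun a ha => hw a (List.mem_of_mem_filter ha)) ?_
  exact List.ne_nil_of_mem (a := e) (List.mem_filter.2 ⟨he, by simpa using hek⟩)

lemma runs_append {X Y : List α} (h : ∀ a ∈ X, ∀ b ∈ Y, χ a ≠ χ b) :
    runs χ w (X ++ Y) = runs χ w X ++ runs χ w Y := by
  have hd : List.Disjoint (X.map χ) (Y.map χ) := by
    intro k hk hk'
    obtain ⟨a, ha, rfl⟩ := List.mem_map.1 hk
    obtain ⟨b, hb, hab⟩ := List.mem_map.1 hk'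
    exact h a ha b hb hab.symm
  rw [runs, List.map_append, hd.dedup_append, List.map_append, runs, runs]
  congr 1
  · refine List.map_congr_left fun k hk => ?_
    have : Y.filter (fun e => χ e = k) = [] := by
      rw [List.filter_eq_nil_iff]
      intro b hb hbk
      obtain ⟨a, ha, hak⟩ := List.mem_map.1 (List.mem_dedup.1 hk)
      exact h a ha b hb (by simp at hbk; rw [hak, hbk])
    rw [List.filter_append, this, List.append_nil]
  · refine List.map_congr_left fun k hk => ?_
    have : X.filter (fun e => χ e = k) = [] := by
      rw [List.filter_eq_nil_iff]
      intro a ha hak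
      obtain ⟨b, hb, hbk⟩ := List.mem_map.1 (List.mem_dedup.1 hk)
      exact h a ha b hb (by simp at hak; rw [hak, hbk])
    rw [List.filter_append, this, List.nil_append]

lemma runs_of_forall_eq {E : List α} {m : ℤ} (hE : E ≠ []) (h : ∀ a ∈ E, χ a = m) :
    runs χ w E = [(m, (E.map w).sum)] := by
  have h1 : E.map χ = List.replicate E.length m :=
    List.eq_replicate_iff.2 ⟨by simp, by simpa using h⟩
  rw [runs, h1, List.replicate_dedup (by simpa using hE), List.map_singleton,
    List.filter_eq_self.2 (by simpa using h)]

lemma IsContiguous.exists_blocks {E : List α} (h : IsContiguous χ E) :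
    ∃ B : List (ℤ × List α), E = (B.map Prod.snd).flatten ∧
      (∀ b ∈ B, b.2 ≠ [] ∧ ∀ e ∈ b.2, χ e = b.1) ∧ (B.map Prod.fst).Nodup := by
  induction hn : E.length using Nat.strong_induction_on generalizing E with
  | _ n ih =>
    rcases List.eq_nil_or_concat' E with rfl | ⟨E, e, rfl⟩
    · exact ⟨[], by simp⟩
    · obtain ⟨E₀, M, rfl, h0, hM⟩ := h.exists_append
      obtain ⟨B, rfl, hB, hBn⟩ := ih E₀.length (by rw [← hn]; simp)
        (IsContiguous.of_append (X := []) (Z := M ++ [e]) (by simpa using h)) rfl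
      refine ⟨B ++ [(χ e, M ++ [e])], by simp, ?_, ?_⟩
      · intro b hb
        rcases List.mem_append.1 hb with hb | hb
        · exact hB b hb
        · rw [List.mem_singleton] at hb
          subst hb
          refine ⟨by simp, fun a ha => ?_⟩
          rcases List.mem_append.1 ha with ha | ha
          · exact hM a ha
          · rw [List.mem_singleton.1 ha]
      · rw [List.map_append, List.nodup_append]
        refine ⟨hBn, by simp, ?_⟩
        intro k hk k' hk' hkk
        simp only [List.map_cons, List.map_nil, List.mem_singleton] at hk'
        obtain ⟨b, hb, rfl⟩ := List.mem_map.1 hk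
        obtain ⟨a, ha⟩ := List.exists_mem_of_ne_nil _ (hB b hb).1
        exact h0 a (List.mem_flatten.2 ⟨b.2, List.mem_map_of_mem hb, ha⟩)
          (by rw [(hB b hb).2 a ha, hkk, hk'])

lemma runs_flatten {B : List (ℤ × List α)} (hB : ∀ b ∈ B, b.2 ≠ [] ∧ ∀ e ∈ b.2, χ e = b.1)
    (hn : (B.map Prod.fst).Nodup) :
    runs χ w (B.map Prod.snd).flatten = B.map fun b => (b.1, (b.2.map w).sum) := by
  induction B with
  | nil => simp [runs]
  | cons b B ih =>
    rw [List.map_cons, List.nodup_cons] at hn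
    have hb := hB b (by simp)
    have hB' : ∀ b ∈ B, b.2 ≠ [] ∧ ∀ e ∈ b.2, χ e = b.1 := fun c hc => hB c (by simp [hc])
    rw [List.map_cons, List.flatten_cons, runs_append, runs_of_forall_eq hb.1 hb.2, ih hB' hn.2]
    · rfl
    · intro a ha a' ha' haa
      obtain ⟨l, hl, hal⟩ := List.mem_flatten.1 ha'
      obtain ⟨c, hc, rfl⟩ := List.mem_map.1 hl
      rw [hb.2 a ha, (hB' c hc).2 a' hal] at haa
      exact hn.1 (haa ▸ List.mem_map_of_mem hc)

lemma IsContiguous.tot_runs {E : List α} (h : IsContiguous χ E) :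
    tot (runs χ w E) = (E.map w).sum := by
  obtain ⟨B, rfl, hB, hn⟩ := h.exists_blocks
  rw [runs_flatten hB hn]
  clear hB hn h
  induction B with
  | nil => simp
  | cons b B ih => simp [ih]

lemma IsContiguous.exists_of_infix_runs {E : List α} (h : IsContiguous χ E)
    {g : List (ℤ × ℝ)} (hg : g <:+: runs χ w E) : ∃ X Y Z, E = X ++ Y ++ Z ∧ runs χ w Y = g := by
  obtain ⟨B, rfl, hB, hn⟩ := h.exists_blocks
  rw [runs_flatten hB hn, List.infix_map_iff] at hg
  obtain ⟨B', ⟨B₁, B₂, rfl⟩, rfl⟩ := hg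
  refine ⟨(B₁.map Prod.snd).flatten, (B'.map Prod.snd).flatten, (B₂.map Prod.snd).flatten,
    by simp, ?_⟩
  refine runs_flatten (fun b hb => hB b (by simp [hb])) ?_
  simp only [List.map_append] at hn
  exact hn.of_append_left.of_append_right

lemma tot_longRuns (M : ℝ) (R : List (ℤ × ℝ)) :
    tot (longRuns M R) = (R.map fun x => if M ≤ x.2 then x.2 else 0).sum := by
  induction R with
  | nil => rfl
  | cons x R ih =>
    simp only [longRuns, List.filter_cons] at ih ⊢
    by_cases hx : M ≤ x.2 <;> simp [hx, ih]

/-- The vector of the total weights of the colors. -/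
noncomputable def colorVec (χ : α → ℤ) (w : α → ℝ) (E : List α) : ℤ →₀ ℝ :=
  (E.map fun e => Finsupp.single (χ e) (w e)).sum

lemma colorVec_append (X Y : List α) :
    colorVec χ w (X ++ Y) = colorVec χ w X + colorVec χ w Y := by simp [colorVec]

lemma colorVec_apply (E : List α) (k : ℤ) :
    colorVec χ w E k = ((E.filter fun e => χ e = k).map w).sum := by
  induction E with
  | nil => simp [colorVec]
  | cons e E ih =>
    have h1 : colorVec χ w (e :: E) = Finsupp.single (χ e) (w e) + colorVec χ w E := by
      simp [colorVec]
    rw [h1, Finsupp.add_apply, ih, List.filter_cons, Finsupp.single_apply]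
    by_cases h : χ e = k <;> simp [h]

lemma colorVec_apply_of_forall_ne {E : List α} {k : ℤ} (h : ∀ e ∈ E, χ e ≠ k) :
    colorVec χ w E k = 0 := by
  rw [colorVec_apply, List.filter_eq_nil_iff.2 (by simpa using h)]; simp

lemma colorVec_apply_of_forall_eq {E : List α} {k : ℤ} (h : ∀ e ∈ E, χ e = k) :
    colorVec χ w E k = (E.map w).sum := by
  rw [colorVec_apply, List.filter_eq_self.2 (by simpa using h)]

end Runs

lemma IsStrongColoring.isHalfCovered {r : T.V} {δ : ℝ} {χ : Sym2 T.V → ℤ}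
    (hχ : IsStrongColoring T r δ χ) {x : T.V} {X Y Z : List (Sym2 T.V)}
    (h : rootEdges T r x = X ++ Y ++ Z) : IsHalfCovered δ (runs χ T.w Y) := by
  obtain ⟨y, z, rfl⟩ := exists_path_edges_eq_of_append h
  have hc := (h ▸ hχ.1.isContiguous x : IsContiguous χ _).of_append
  rw [IsHalfCovered, hc.tot_runs, tot_longRuns]
  refine (hχ.2 y z).trans (le_of_eq ?_)
  have hf : ((T.path y z).edges.map χ).toFinset = ((T.path y z).edges.map χ).dedup.toFinset := by
    ext; simp
  rw [coveredLen, hf, List.sum_toFinset _ (List.nodup_dedup _), runs, List.map_map]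
  rfl

lemma IsStrongColoring.isCovered {r : T.V} {δ : ℝ} {χ : Sym2 T.V → ℤ} (hδ : 0 < δ)
    (hδ8 : δ ≤ 1 / 8) (hχ : IsStrongColoring T r δ χ) (x : T.V) :
    IsCovered (7 / 8) (δ ^ 3 / 32) (17 / 20) (runs χ T.w (rootEdges T r x)) := by
  refine isCovered_of_isHalfCovered hδ hδ8
    (runs_pos fun e he => T.w_pos e (mem_edgeSet_of_mem_rootEdges he)) fun g hg => ?_
  obtain ⟨X, Y, Z, hE, rfl⟩ := (hχ.1.isContiguous x).exists_of_infix_runs hg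
  exact hχ.isHalfCovered hE

section Embedding

lemma sum_le_powSum {ι : Type*} {r : ℝ} (hr : r ≠ 0) (c : ι →₀ ℝ) (s : Finset ι) :
    ∑ k ∈ s, |c k| ^ r ≤ powSum r c := by
  classical
  rw [powSum, Finsupp.sum_of_support_subset c (Finset.subset_union_right (s₁ := s)) _
    (by simp [hr])]
  exact Finset.sum_le_sum_of_subset_of_nonneg Finset.subset_union_left fun _ _ _ => by positivity

lemma powSum_nonneg {ι : Type*} (r : ℝ) (c : ι →₀ ℝ) : 0 ≤ powSum r c :=
  Finset.sum_nonneg fun _ _ => by positivity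

lemma powSum_neg {ι : Type*} (r : ℝ) (c : ι →₀ ℝ) : powSum r (-c) = powSum r c := by
  simp [powSum, Finsupp.sum]

lemma exists_linearMap_prod_Lp {p r : ℝ} (hp : 1 ≤ p) (hr : r = max p 2) :
    ∃ J : (ℤ →₀ ℝ) × (ℤ →₀ ℝ) →ₗ[ℝ]
        MeasureTheory.Lp ℝ (ENNReal.ofReal p) (MeasureTheory.volume : MeasureTheory.Measure ℝ),
      ∃ κ : ℝ, 0 < κ ∧ ∀ c, ‖J c‖ = κ * (powSum r c.1 + powSum r c.2) ^ (1 / r) := by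
  have key : ∃ J : (ℤ ⊕ ℤ →₀ ℝ) →ₗ[ℝ]
        MeasureTheory.Lp ℝ (ENNReal.ofReal p) (MeasureTheory.volume : MeasureTheory.Measure ℝ),
      ∃ κ : ℝ, 0 < κ ∧ ∀ c, ‖J c‖ = κ * powSum r c ^ (1 / r) := by
    rcases le_total 2 p with h | h
    · rw [hr, max_eq_left h]; exact exists_linearMap_Lp_of_powSum hp
    · rw [hr, max_eq_right h]; exact exists_linearMap_Lp_of_powSum_two hp
  obtain ⟨J, κ, hκ, hJ⟩ := key
  refine ⟨J ∘ₗ (Finsupp.sumFinsuppLEquivProdFinsupp ℝ).symm.toLinearMap, κ, hκ, fun c => ?_⟩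
  rw [LinearMap.comp_apply, hJ]
  have : (Finsupp.sumFinsuppLEquivProdFinsupp ℝ).symm.toLinearMap c = Finsupp.sumElim c.1 c.2 := rfl
  rw [this, powSum, Finsupp.sum_sumElim]
  rfl

lemma MetricTree.dist_nonneg (T : MetricTree) (u v : T.V) : 0 ≤ T.dist u v :=
  sum_map_nonneg fun e he => T.w_pos e (Walk.edges_subset_edgeSet _ he)

lemma norm_sub_le_of_walk {E : Type*} [SeminormedAddCommGroup E] {Φ : T.V → E} {D : ℝ}
    (h : ∀ x y, T.G.Adj x y → ‖Φ x - Φ y‖ ≤ D * T.w s(x, y)) {u v : T.V} (p : T.G.Walk u v) :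
    ‖Φ u - Φ v‖ ≤ D * (p.edges.map T.w).sum := by
  induction p with
  | nil => simp
  | @cons x y z hxy p ih =>
    rw [Walk.edges_cons, List.map_cons, List.sum_cons, mul_add]
    calc ‖Φ x - Φ z‖ = ‖(Φ x - Φ y) + (Φ y - Φ z)‖ := by rw [sub_add_sub_cancel]
      _ ≤ _ := (norm_add_le _ _).trans (add_le_add (h x y hxy) ih)

/-- A map of a rooted tree into `L_p` that increases the lengths of the edges boundedly and does
not decrease distances is an embedding of bounded distortion. -/
lemma hasEmbedding_of_edges {r : T.V} {p : ℝ} [Fact (1 ≤ ENNReal.ofReal p)] {s D : ℝ} (hs : 0 < s)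
    (Φ : T.V → MeasureTheory.Lp ℝ (ENNReal.ofReal p)
      (MeasureTheory.volume : MeasureTheory.Measure ℝ))
    (hD : ∀ x y e, rootEdges T r y = rootEdges T r x ++ [e] → ‖Φ y - Φ x‖ ≤ s * D * T.w e)
    (hlo : ∀ u v, s * T.dist u v ≤ ‖Φ u - Φ v‖) :
    HasEmbedding T.dist (fun g h : LpSpace p => dist g h) D := by
  refine ⟨Φ, s, hs, fun u v => ?_⟩
  have hd : dist (α := LpSpace p) (Φ u) (Φ v) = ‖Φ u - Φ v‖ := dist_eq_norm (Φ u) (Φ v)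
  refine ⟨(hlo u v).trans_eq hd.symm, hd.trans_le ?_⟩
  refine norm_sub_le_of_walk (fun x y hxy => ?_) (T.path u v)
  rcases rootEdges_of_adj (r := r) hxy with h | h
  · rw [norm_sub_rev]; exact hD x y _ h
  · exact hD y x _ h

lemma continuous_runVec {E : Type*} [NormedAddCommGroup E] [NormedSpace ℝ E]
    (J : (ℤ →₀ ℝ) →ₗ[ℝ] E) {r a τ : ℝ} (hr : 1 ≤ r) (m : ℤ) (R : List (ℤ × ℝ)) :
    Continuous fun y => J (runVec r a τ (R ++ [(m, y)])) := by
  have hJ : ∀ k x, J (Finsupp.single k x) = x • J (Finsupp.single k 1) := fun k x => by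
    rw [← map_smul, Finsupp.smul_single, smul_eq_mul, mul_one]
  have hr0 : 0 ≤ 1 / r := by positivity
  have hr1 : 0 ≤ 1 - 1 / r := by rw [sub_nonneg, div_le_one (by linarith)]; exact hr
  induction R with
  | nil =>
    simp only [List.nil_append, runVec, truncLen, add_zero, hJ m (_ * _)]
    exact ((Real.continuous_rpow_const hr0).mul
      ((Real.continuous_rpow_const hr1).comp (by fun_prop))).smul continuous_const
  | cons x R ih =>
    simp only [List.cons_append, runVec, map_add, hJ x.1 (_ * _), truncLen_append_singleton]
    exact ((continuous_const.mul ((Real.continuous_rpow_const hr1).comp (by fun_prop))).smul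
      continuous_const).add ih

lemma runVec_append_zero {r a τ : ℝ} (hr : r ≠ 0) (hτ : 0 ≤ τ) (m : ℤ) {R : List (ℤ × ℝ)}
    (hR : ∀ x ∈ R, 0 < x.2) : runVec r a τ (R ++ [(m, 0)]) = runVec r a τ R := by
  induction R with
  | nil => simp [runVec, truncLen, hr]
  | cons x R ih =>
    have h1 : 0 ≤ tot R := tot_nonneg fun y hy => (hR y (by simp [hy])).le
    have h2 : 0 ≤ τ * (x.2 + tot R) := mul_nonneg hτ (add_nonneg (hR x (by simp)).le h1)
    rw [List.cons_append, runVec, truncLen_append_singleton, ih fun y hy => hR y (by simp [hy]),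
      runVec]
    simp [h2]

lemma isCovered_append_zero {a τ h : ℝ} (m : ℤ) {R : List (ℤ × ℝ)}
    (hR : ∀ x ∈ R, 0 < x.2) (hc : IsCovered a τ h R) : IsCovered a τ h (R ++ [(m, 0)]) := by
  induction R with
  | nil => simp [IsCovered, truncLen]
  | cons x R ih =>
    refine ⟨?_, ih (fun y hy => hR y (by simp [hy])) hc.2⟩
    rw [List.append_eq, truncLen_append_singleton]
    have := hc.1
    have h3 := le_max_right (0 - τ * (x.2 + tot R + 0)) 0
    simp only [tot_append, tot_cons, tot_nil, add_zero] at h3 ⊢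
    linarith

variable {α : Type*} {χ : α → ℤ} {w : α → ℝ}

/-- The vector assigned to the list of edges of a root-vertex path. -/
noncomputable def pathVec (r a τ : ℝ) (χ : α → ℤ) (w : α → ℝ) (E : List α) :
    (ℤ →₀ ℝ) × (ℤ →₀ ℝ) := (runVec r a τ (runs χ w E), colorVec χ w E)

lemma norm_pathVec_sub_le {F : Type*} [NormedAddCommGroup F] [NormedSpace ℝ F]
    {r a τ h κ : ℝ} (hr : 2 ≤ r) (ha : 0 < a) (hτ0 : 0 < τ) (hτ1 : τ < 1) (hh0 : 0 < h)
    (hh1 : h ≤ 1 - τ) (hκ : 0 ≤ κ) (J : (ℤ →₀ ℝ) × (ℤ →₀ ℝ) →ₗ[ℝ] F)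
    (hJ : ∀ c, ‖J c‖ = κ * (powSum r c.1 + powSum r c.2) ^ (1 / r)) {E : List α} {e : α}
    (hE : IsContiguous χ (E ++ [e])) (hw : ∀ a ∈ E ++ [e], 0 < w a)
    (hc : IsCovered a τ h (runs χ w E)) :
    ‖J (pathVec r a τ χ w (E ++ [e])) - J (pathVec r a τ χ w E)‖ ≤
      κ * (a ^ (r - 1) + (1 - 1 / r) ^ r / h * Real.log (1 / τ) + 1) ^ (1 / r) * w e := by
  have hr0 : r ≠ 0 := by linarith
  obtain ⟨E₀, M, rfl, h0, hM⟩ := hE.exists_append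
  set z₀ := (M.map w).sum with hz
  have hz₀ : 0 ≤ z₀ := sum_map_nonneg fun b hb => hw b (by simp [hb])
  have hpos : ∀ x ∈ runs χ w E₀, 0 < x.2 := runs_pos fun b hb => hw b (by simp [hb])
  have hMe : ∀ b ∈ M ++ [e], χ b = χ e := by
    intro b hb
    rcases List.mem_append.1 hb with hb | hb
    · exact hM b hb
    · rw [List.mem_singleton.1 hb]
  have h1 : runs χ w (E₀ ++ M ++ [e]) = runs χ w E₀ ++ [(χ e, z₀ + w e)] := by
    rw [List.append_assoc, runs_append fun b hb b' hb' => by rw [hMe b' hb']; exact h0 b hb,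
      runs_of_forall_eq (by simp) hMe]
    simp [hz]
  have h2 : runVec r a τ (runs χ w (E₀ ++ M)) = runVec r a τ (runs χ w E₀ ++ [(χ e, z₀)]) ∧
      IsCovered a τ h (runs χ w E₀ ++ [(χ e, z₀)]) := by
    by_cases hM0 : M = []
    · subst hM0
      rw [List.append_nil] at hc ⊢
      simp only [List.map_nil, List.sum_nil] at hz
      rw [hz, runVec_append_zero hr0 hτ0.le _ hpos]
      exact ⟨rfl, isCovered_append_zero _ hpos hc⟩
    · have : runs χ w (E₀ ++ M) = runs χ w E₀ ++ [(χ e, z₀)] := by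
        rw [runs_append fun b hb b' hb' => by rw [hM b' hb']; exact h0 b hb,
          runs_of_forall_eq hM0 hM]
      rw [this] at hc ⊢
      exact ⟨rfl, hc⟩
  have hnd : ((runs χ w E₀ ++ [(χ e, z₀)]).map Prod.fst).Nodup := by
    have := nodup_runs (χ := χ) (w := w) (E₀ ++ M ++ [e])
    rw [h1] at this
    simpa using this
  have hv : ∀ x : ℝ, J (0, Finsupp.single (χ e) x) = x • J (0, Finsupp.single (χ e) 1) := by
    intro x
    rw [← map_smul]; simp
  have hce : colorVec χ w [e] = Finsupp.single (χ e) (w e) := by simp [colorVec]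
  set J₁ := J ∘ₗ LinearMap.inl ℝ _ _ with hJ₁
  have hsplit : ∀ c d, J (c, d) = J₁ c + J (0, d) := fun c d => by
    rw [hJ₁, LinearMap.comp_apply, LinearMap.inl_apply, ← map_add]; simp
  set f : ℝ → F := fun y => J₁ (runVec r a τ (runs χ w E₀ ++ [(χ e, y)])) +
    y • J (0, Finsupp.single (χ e) 1) with hf
  have key := norm_image_sub_le_of_norm_deriv_right_le_segment (f := f)
    (f' := fun y => J₁ (runVecDeriv r a τ (χ e) y (runs χ w E₀)) +
      (1 : ℝ) • J (0, Finsupp.single (χ e) 1)) (a := z₀) (b := z₀ + w e)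
    (C := κ * (a ^ (r - 1) + (1 - 1 / r) ^ r / h * Real.log (1 / τ) + 1) ^ (1 / r))
    ((continuous_runVec J₁ (by linarith) _ _).add (by fun_prop)).continuousOn
    (fun y hy => (hasDerivWithinAt_runVec J₁ ha hτ1 _ (hz₀.trans hy.1) hpos).add
      ((hasDerivWithinAt_id y _).smul_const _))
    (fun y hy => by
      rw [one_smul, ← hsplit, hJ]
      have hq : 0 ≤ 1 - 1 / r := by
        rw [sub_nonneg, div_le_one (by linarith)]; linarith
      refine mul_le_mul_of_nonneg_left (Real.rpow_le_rpow
        (add_nonneg (powSum_nonneg _ _) (powSum_nonneg _ _)) ?_ (by positivity)) hκ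
      rw [powSum_single hr0, abs_one, Real.one_rpow, add_le_add_iff_right]
      refine (powSum_runVecDeriv_le hr ha hτ0 hτ1 hh0 hh1 hz₀ hy.1 hpos h2.2 hnd).trans ?_
      gcongr
      exact min_le_right _ _)
    (z₀ + w e) (Set.right_mem_Icc.2 (by linarith [hw e (by simp)]))
  have hdiff : J (pathVec r a τ χ w (E₀ ++ M ++ [e])) - J (pathVec r a τ χ w (E₀ ++ M)) =
      f (z₀ + w e) - f z₀ := by
    rw [pathVec, pathVec, h1, h2.1, colorVec_append (E₀ ++ M), hce, hsplit,
      hsplit (runVec r a τ (runs χ w E₀ ++ [(χ e, z₀)])), hf]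
    have h3 : J (0, colorVec χ w (E₀ ++ M) + Finsupp.single (χ e) (w e)) =
        J (0, colorVec χ w (E₀ ++ M)) + w e • J (0, Finsupp.single (χ e) 1) := by
      rw [← hv, ← map_add]; simp
    rw [h3]
    simp only [add_smul]
    abel
  rw [hdiff]
  simpa using key

lemma le_powSum_pathVec_sub {r a τ h : ℝ} (hr : 2 ≤ r) (ha : 0 < a) (hh : 0 < h)
    {P U₁ U₂ W : List α} (hu : IsContiguous χ (P ++ U₁ ++ U₂)) (hv : IsContiguous χ (P ++ W))
    (hwu : ∀ b ∈ P ++ U₁ ++ U₂, 0 < w b) (hwv : ∀ b ∈ P ++ W, 0 < w b)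
    (h₁ : ∀ b ∈ P ++ U₁, ∀ b' ∈ U₂, χ b ≠ χ b') (h₂ : ∀ b ∈ P, ∀ b' ∈ W, χ b ≠ χ b')
    (h₃ : ∀ b ∈ U₁ ++ U₂, ∀ b' ∈ W, χ b ≠ χ b') {m : ℤ} (hm : ∀ b ∈ U₁, χ b = m)
    (hcu : IsCovered a τ h (runs χ w (P ++ U₁ ++ U₂))) (hcv : IsCovered a τ h (runs χ w (P ++ W))) :
    h ^ (r - 1) / r * (U₂.map w).sum ^ r + h ^ (r - 1) / r * (W.map w).sum ^ r +
        (U₁.map w).sum ^ r ≤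
      powSum r (pathVec r a τ χ w (P ++ U₁ ++ U₂) - pathVec r a τ χ w (P ++ W)).1 +
      powSum r (pathVec r a τ χ w (P ++ U₁ ++ U₂) - pathVec r a τ χ w (P ++ W)).2 := by
  classical
  have hr0 : r ≠ 0 := by linarith
  have eu : runs χ w (P ++ U₁ ++ U₂) = runs χ w (P ++ U₁) ++ runs χ w U₂ := runs_append h₁
  have ev : runs χ w (P ++ W) = runs χ w P ++ runs χ w W := runs_append h₂
  have hndu := nodup_runs (χ := χ) (w := w) (P ++ U₁ ++ U₂)
  have hndv := nodup_runs (χ := χ) (w := w) (P ++ W)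
  have hd : ∀ k, (∃ b ∈ U₂, χ b = k) → ¬ ∃ b ∈ P ++ W, χ b = k := by
    rintro k ⟨b, hb, rfl⟩ ⟨b', hb', hbb⟩
    rcases List.mem_append.1 hb' with hb' | hb'
    · exact h₁ b' (by simp [hb']) b hb hbb
    · exact h₃ b (by simp [hb]) b' hb' hbb.symm
  have hd' : ∀ k, (∃ b ∈ W, χ b = k) → ¬ ∃ b ∈ P ++ U₁ ++ U₂, χ b = k := by
    rintro k ⟨b, hb, rfl⟩ ⟨b', hb', hbb⟩
    rw [List.append_assoc] at hb'
    rcases List.mem_append.1 hb' with hb' | hb'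
    · exact h₂ b' hb' b hb hbb
    · exact h₃ b' hb' b hb hbb
  refine add_le_add ?_ ?_
  · have hU := le_sum_runVec (R := runs χ w (P ++ U₁)) (f := runs χ w U₂) hr ha hh
      (runs_pos fun b hb => hwu b (by simp [hb])) (eu ▸ hcu).of_append (eu ▸ hndu)
    have hW := le_sum_runVec (R := runs χ w P) (f := runs χ w W) hr ha hh
      (runs_pos fun b hb => hwv b (by simp [hb])) (ev ▸ hcv).of_append (ev ▸ hndv)
    rw [IsContiguous.tot_runs (IsContiguous.of_append (X := P ++ U₁) (Z := []) (by simpa using hu)),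
      ← eu] at hU
    rw [IsContiguous.tot_runs (IsContiguous.of_append (X := P) (Z := []) (by simpa using hv)),
      ← ev] at hW
    refine (add_le_add hU hW).trans (le_trans ?_ (sum_le_powSum hr0 _
      (((runs χ w U₂).map Prod.fst).toFinset ∪ ((runs χ w W).map Prod.fst).toFinset)))
    rw [Finset.sum_union]
    · refine le_of_eq (congrArg₂ _ (Finset.sum_congr rfl fun k hk => ?_)
        (Finset.sum_congr rfl fun k hk => ?_))
      · have := hd k (mem_map_fst_runs.1 (List.mem_toFinset.1 hk))
        rw [← mem_map_fst_runs (w := w)] at this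
        simp [pathVec, runVec_apply_of_notMem this]
      · have := hd' k (mem_map_fst_runs.1 (List.mem_toFinset.1 hk))
        rw [← mem_map_fst_runs (w := w)] at this
        simp only [pathVec, Prod.fst_sub, Finsupp.sub_apply, runVec_apply_of_notMem this, zero_sub,
          abs_neg]
    · rw [Finset.disjoint_left]
      intro k hk hk'
      obtain ⟨b, hb, hbk⟩ := mem_map_fst_runs.1 (List.mem_toFinset.1 hk')
      exact hd k (mem_map_fst_runs.1 (List.mem_toFinset.1 hk)) ⟨b, by simp [hb], hbk⟩
  · by_cases h0 : U₁ = []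
    · subst h0
      simpa [hr0] using powSum_nonneg r _
    · obtain ⟨b, hb⟩ := List.exists_mem_of_ne_nil _ h0
      refine le_trans (le_of_eq ?_) (sum_le_powSum hr0 _ {m})
      rw [Finset.sum_singleton]
      have e1 : colorVec χ w U₂ m = 0 := colorVec_apply_of_forall_ne fun b' hb' => by
        rw [← hm b hb]; exact (h₁ b (by simp [hb]) b' hb').symm
      have e2 : colorVec χ w W m = 0 := colorVec_apply_of_forall_ne fun b' hb' => by
        rw [← hm b hb]; exact (h₃ b (by simp [hb]) b' hb').symm
      simp only [pathVec, Prod.snd_sub, Finsupp.sub_apply, colorVec_append, Finsupp.add_apply, e1,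
        e2, colorVec_apply_of_forall_eq hm, add_zero, add_sub_cancel_left]
      rw [abs_of_nonneg (sum_map_nonneg fun b hb => hwu b (by simp [hb]))]

end Embedding

section StrongColoring

variable {r : T.V} {δ p : ℝ} {χ : Sym2 T.V → ℤ}

lemma IsStrongColoring.powSum_pathVec_sub_ge {q g : ℝ} (hq : 2 ≤ q) (hδ : 0 < δ) (hδ8 : δ ≤ 1 / 8)
    (hg : 0 < g) (hgq : q ≤ g ^ (q - 1)) (hχ : IsStrongColoring T r δ χ) (u v : T.V) :
    T.dist u v ^ q ≤ (2 * g / (17 / 20) + 1) ^ (q - 1) *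
      (powSum q (pathVec q (7 / 8) (δ ^ 3 / 32) χ T.w (rootEdges T r u) -
          pathVec q (7 / 8) (δ ^ 3 / 32) χ T.w (rootEdges T r v)).1 +
        powSum q (pathVec q (7 / 8) (δ ^ 3 / 32) χ T.w (rootEdges T r u) -
          pathVec q (7 / 8) (δ ^ 3 / 32) χ T.w (rootEdges T r v)).2) := by
  have aux : ∀ {x y : T.V} {P U₁ U₂ W : List (Sym2 T.V)} {m : ℤ},
      rootEdges T r x = P ++ U₁ ++ U₂ → rootEdges T r y = P ++ W →
      (∀ b ∈ P ++ U₁, ∀ b' ∈ U₂, χ b ≠ χ b') → (∀ b ∈ P, ∀ b' ∈ W, χ b ≠ χ b') →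
      (∀ b ∈ U₁ ++ U₂, ∀ b' ∈ W, χ b ≠ χ b') → (∀ b ∈ U₁, χ b = m) →
      ((U₂.map T.w).sum + (W.map T.w).sum + (U₁.map T.w).sum) ^ q ≤
        (2 * g / (17 / 20) + 1) ^ (q - 1) *
        (powSum q (pathVec q (7 / 8) (δ ^ 3 / 32) χ T.w (rootEdges T r x) -
            pathVec q (7 / 8) (δ ^ 3 / 32) χ T.w (rootEdges T r y)).1 +
          powSum q (pathVec q (7 / 8) (δ ^ 3 / 32) χ T.w (rootEdges T r x) -
            pathVec q (7 / 8) (δ ^ 3 / 32) χ T.w (rootEdges T r y)).2) := by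
    intro x y P U₁ U₂ W m hx hy h₁ h₂ h₃ hm
    have hcx := hχ.1.isContiguous x
    have hcy := hχ.1.isContiguous y
    have hwx : ∀ e ∈ rootEdges T r x, 0 < T.w e :=
      fun e he => T.w_pos e (mem_edgeSet_of_mem_rootEdges he)
    have hwy : ∀ e ∈ rootEdges T r y, 0 < T.w e :=
      fun e he => T.w_pos e (mem_edgeSet_of_mem_rootEdges he)
    have hvx := hχ.isCovered hδ hδ8 x
    have hvy := hχ.isCovered hδ hδ8 y
    rw [hx] at hcx hwx hvx ⊢
    rw [hy] at hcy hwy hvy ⊢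
    refine (add_add_rpow_le (h := 17 / 20) hq hg (by norm_num) hgq
      (sum_map_nonneg fun b hb => hwx b (by simp [hb]))
      (sum_map_nonneg fun b hb => hwy b (by simp [hb]))
      (sum_map_nonneg fun b hb => hwx b (by simp [hb]))).trans ?_
    exact mul_le_mul_of_nonneg_left (le_powSum_pathVec_sub hq (by norm_num) (by norm_num) hcx hcy
      hwx hwy h₁ h₂ h₃ hm hvx hvy) (by positivity)
  obtain ⟨P, U, W, hU, hW, he, hd⟩ := exists_path_edges_eq r u v
  have hdist : T.dist u v = (U.map T.w).sum + (W.map T.w).sum := by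
    simp [MetricTree.dist, he, List.sum_reverse]
  have hne : ∀ b ∈ U, ∀ b' ∈ W, χ b ≠ χ b' := fun b hb b' hb' => hχ.1.color_ne hU hW hd hb hb'
  rw [hdist]
  rcases List.eq_nil_or_concat' P with rfl | ⟨P, e, rfl⟩
  · simpa using aux (x := u) (y := v) (P := []) (U₁ := []) (U₂ := U) (W := W) (m := 0)
      (by simpa using hU) hW (by simp) (by simp) (by simpa using hne) (by simp)
  · obtain ⟨U₁, U₂, rfl, hU₁, hU₂⟩ := (hU ▸ hχ.1.isContiguous u).exists_split
    obtain ⟨W₁, W₂, rfl, hW₁, hW₂⟩ := (hW ▸ hχ.1.isContiguous v).exists_split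
    rcases W₁ with _ | ⟨b, W₁⟩
    · have := aux (x := u) (y := v) (P := P ++ [e]) (U₁ := U₁) (U₂ := U₂) (W := W₂)
        (by simpa using hU) (by simpa using hW) hU₂ (by simpa using hW₂) (by simpa using hne) hU₁
      refine le_trans (le_of_eq ?_) this
      simp only [List.map_append, List.sum_append, List.nil_append]
      congr 1
      ring
    · have hU₁' : U₁ = [] := by
        rw [List.eq_nil_iff_forall_not_mem]
        intro c hc
        exact hne c (by simp [hc]) b (by simp) ((hU₁ c hc).trans (hW₁ b (by simp)).symm)
      subst hU₁'
      have := aux (x := v) (y := u) (P := P ++ [e]) (U₁ := b :: W₁) (U₂ := W₂) (W := U₂)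
        (by simpa using hW) (by simpa using hU) hW₂ (by simpa using hU₂)
        (fun c hc c' hc' => (hne c' (by simpa using hc') c hc).symm) hW₁
      rw [← neg_sub (pathVec q (7 / 8) (δ ^ 3 / 32) χ T.w (rootEdges T r v)), Prod.fst_neg,
        Prod.snd_neg, powSum_neg, powSum_neg]
      refine le_trans (le_of_eq ?_) this
      simp only [List.map_append, List.sum_append, List.nil_append]
      congr 1
      ring

lemma IsStrongColoring.hasEmbedding_of_le (hp : 1 ≤ p) (hδ : 0 < δ) (hδ8 : δ ≤ 1 / 8)
    (hχ : IsStrongColoring T r δ χ) :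
    HasEmbedding T.dist (fun g h : LpSpace p => dist g h)
      (4 * Real.log (2 / δ) ^ min (1 / p) (1 / 2 : ℝ)) := by
  have : Fact (1 ≤ ENNReal.ofReal p) := ⟨by simpa using hp⟩
  obtain ⟨q, hqp⟩ : ∃ q, q = max p 2 := ⟨_, rfl⟩
  have hq : 2 ≤ q := hqp ▸ le_max_right _ _
  have hq0 : q ≠ 0 := by linarith
  have hmin : min (1 / p) (1 / 2 : ℝ) = 1 / q := by
    rcases le_total 2 p with h | h
    · rw [hqp, max_eq_left h, min_eq_left (one_div_le_one_div_of_le two_pos h)]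
    · rw [hqp, max_eq_right h, min_eq_right (one_div_le_one_div_of_le (by linarith) h)]
  rw [hmin]
  obtain ⟨g, hg, hgq, hconst⟩ := exists_constant_le hq hδ hδ8
  obtain ⟨J, κ, hκ, hJ⟩ := exists_linearMap_prod_Lp hp hqp
  have hτ : δ ^ 3 / 32 ≤ 1 / 16384 := by
    have := pow_le_pow_left₀ hδ.le hδ8 3
    norm_num at this ⊢
    linarith
  have hL : 0 ≤ Real.log (2 / δ) := Real.log_nonneg (by rw [le_div_iff₀ hδ]; linarith)
  set K : ℝ := (2 * g / (17 / 20) + 1) ^ (q - 1) with hK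
  have hK0 : 0 < K := by positivity
  set C := (7 / 8 : ℝ) ^ (q - 1) + (1 - 1 / q) ^ q / (17 / 20) * Real.log (1 / (δ ^ 3 / 32)) + 1
    with hC
  have hC0 : 0 ≤ C := by
    have h1 : 0 ≤ 1 - 1 / q := by rw [sub_nonneg, div_le_one (by linarith)]; linarith
    have h2 : 0 ≤ Real.log (1 / (δ ^ 3 / 32)) := Real.log_nonneg (by
      rw [le_div_iff₀ (by positivity)]; linarith)
    positivity
  have hD : C ^ (1 / q) ≤ (1 / K) ^ (1 / q) * (4 * Real.log (2 / δ) ^ (1 / q)) := by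
    have h4 : (4 : ℝ) = (4 ^ q) ^ (1 / q) := by
      rw [← Real.rpow_mul (by norm_num), mul_one_div_cancel hq0, Real.rpow_one]
    rw [h4, ← Real.mul_rpow (by positivity) hL, ← Real.mul_rpow (by positivity) (by positivity)]
    refine Real.rpow_le_rpow hC0 ?_ (by positivity)
    rw [one_div_mul_eq_div, le_div_iff₀ hK0, mul_comm]
    exact hconst
  refine hasEmbedding_of_edges (r := r) (s := κ * (1 / K) ^ (1 / q)) (by positivity)
    (fun x => J (pathVec q (7 / 8) (δ ^ 3 / 32) χ T.w (rootEdges T r x))) ?_ ?_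
  · intro x y e hxy
    have hy := hχ.1.isContiguous y
    have hwy : ∀ e ∈ rootEdges T r y, 0 < T.w e :=
      fun e he => T.w_pos e (mem_edgeSet_of_mem_rootEdges he)
    rw [hxy] at hy hwy
    simp only [hxy]
    refine (norm_pathVec_sub_le (h := 17 / 20) hq (by norm_num) (by positivity) (by linarith)
      (by norm_num) (by linarith) hκ.le J hJ hy hwy (hχ.isCovered hδ hδ8 x)).trans ?_
    rw [mul_assoc κ ((1 / K) ^ (1 / q))]
    exact mul_le_mul_of_nonneg_right (mul_le_mul_of_nonneg_left hD hκ.le) (hwy e (by simp)).le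
  · intro u v
    have hS := hχ.powSum_pathVec_sub_ge hq hδ hδ8 hg hgq u v
    rw [← map_sub, hJ, mul_assoc]
    refine mul_le_mul_of_nonneg_left ?_ hκ.le
    have hd : T.dist u v = (T.dist u v ^ q) ^ (1 / q) := by
      rw [← Real.rpow_mul (T.dist_nonneg u v), mul_one_div_cancel hq0, Real.rpow_one]
    have hdn := T.dist_nonneg u v
    rw [hd, ← Real.mul_rpow (by positivity) (by positivity)]
    refine Real.rpow_le_rpow (by positivity) ?_ (by positivity)
    rw [one_div_mul_eq_div, div_le_iff₀ hK0, mul_comm]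
    exact hS

lemma IsStrongColoring.powSum_colorVec_sub_ge (hδ : 0 < δ) (hχ : IsStrongColoring T r δ χ)
    (u v : T.V) : δ / 2 * T.dist u v ^ 2 ≤
      powSum 2 (colorVec χ T.w (rootEdges T r u) - colorVec χ T.w (rootEdges T r v)) := by
  obtain ⟨P, U, W, hU, hW, he, hd⟩ := exists_path_edges_eq r u v
  have hc : ∀ k, colorLen T χ k u v = colorVec χ T.w U k + colorVec χ T.w W k := fun k => by
    rw [colorLen, he, colorVec_apply, colorVec_apply, List.filter_append, List.map_append,
      List.sum_append, List.filter_reverse, List.map_reverse, List.sum_reverse]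
  have habs : ∀ k, |(colorVec χ T.w (rootEdges T r u) - colorVec χ T.w (rootEdges T r v)) k| =
      |colorLen T χ k u v| := fun k => by
    rw [hc, hU, hW, colorVec_append, colorVec_append, add_sub_add_left_eq_sub, Finsupp.sub_apply]
    by_cases hk : ∃ b ∈ U, χ b = k
    · obtain ⟨b, hb, rfl⟩ := hk
      rw [colorVec_apply_of_forall_ne fun b' hb' => (hχ.1.color_ne hU hW hd hb hb').symm]
      simp
    · push Not at hk
      rw [colorVec_apply_of_forall_ne hk]
      simp
  refine le_trans ?_ (sum_le_powSum two_ne_zero _ ((T.path u v).edges.map χ).toFinset)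
  have h1 := mul_le_mul_of_nonneg_left (hχ.2 u v) (mul_nonneg hδ.le (T.dist_nonneg u v))
  rw [coveredLen, Finset.mul_sum] at h1
  refine le_trans (le_of_eq (by ring)) (h1.trans (Finset.sum_le_sum fun k _ => ?_))
  rw [habs, Real.rpow_two, sq_abs]
  split_ifs with h
  · rw [sq]
    exact mul_le_mul_of_nonneg_right h
      ((mul_nonneg hδ.le (T.dist_nonneg u v)).trans h)
  · rw [mul_zero]; positivity

lemma sqrt_le_four_mul_log_rpow {x e : ℝ} (hx : 2 ≤ x) (hx' : x ≤ 16) (he0 : 0 ≤ e) (he : e ≤ 1) :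
    √x ≤ 4 * Real.log x ^ e := by
  have hlog := Real.log_le_log two_pos hx
  have h2 := Real.log_two_gt_d9
  rcases le_total 1 (Real.log x) with h | h
  · have h1 : √x ≤ 4 := Real.sqrt_le_iff.2 ⟨by norm_num, by linarith⟩
    linarith [Real.one_le_rpow h he0]
  · have hx3 : x ≤ 2.7182818286 := by
      rw [Real.log_le_iff_le_exp (by linarith)] at h
      linarith [Real.exp_one_lt_d9]
    have h1 : √x ≤ 2 := Real.sqrt_le_iff.2 ⟨by norm_num, by linarith⟩
    have h3 : Real.log x ^ (1 : ℝ) ≤ Real.log x ^ e :=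
      Real.rpow_le_rpow_of_exponent_ge (by linarith) h he
    rw [Real.rpow_one] at h3
    linarith

lemma IsStrongColoring.hasEmbedding_of_ge (hp : 1 ≤ p) (hδ8 : 1 / 8 ≤ δ) (hδ1 : δ < 1)
    (hχ : IsStrongColoring T r δ χ) :
    HasEmbedding T.dist (fun g h : LpSpace p => dist g h)
      (4 * Real.log (2 / δ) ^ min (1 / p) (1 / 2 : ℝ)) := by
  have : Fact (1 ≤ ENNReal.ofReal p) := ⟨by simpa using hp⟩
  have hδ : 0 < δ := by linarith
  obtain ⟨J, κ, hκ, hJ⟩ := exists_linearMap_Lp_of_powSum_two (ι := ℤ) hp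
  have hsqrt := sqrt_le_four_mul_log_rpow (x := 2 / δ) (e := min (1 / p) (1 / 2 : ℝ))
    (by rw [le_div_iff₀ hδ]; linarith) (by rw [div_le_iff₀ hδ]; linarith)
    (le_min (by positivity) (by norm_num)) ((min_le_right _ _).trans (by norm_num))
  have hs : 1 ≤ √(δ / 2) * (4 * Real.log (2 / δ) ^ min (1 / p) (1 / 2 : ℝ)) := by
    refine le_trans (le_of_eq ?_) (mul_le_mul_of_nonneg_left hsqrt (Real.sqrt_nonneg _))
    rw [← Real.sqrt_mul (by positivity), div_mul_div_cancel₀ two_ne_zero, div_self hδ.ne',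
      Real.sqrt_one]
  refine hasEmbedding_of_edges (r := r) (s := κ * √(δ / 2)) (by positivity)
    (fun x => J (colorVec χ T.w (rootEdges T r x))) ?_ ?_
  · intro x y e hxy
    have hw : 0 < T.w e :=
      T.w_pos e (mem_edgeSet_of_mem_rootEdges (r := r) (x := y) (by simp [hxy]))
    have h1 : colorVec χ T.w [e] = Finsupp.single (χ e) (T.w e) := by simp [colorVec]
    rw [← map_sub, hJ, hxy, colorVec_append, add_sub_cancel_left, h1, powSum_single two_ne_zero,
      ← Real.rpow_mul (abs_nonneg _), mul_one_div_cancel two_ne_zero, Real.rpow_one,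
      abs_of_pos hw, mul_assoc κ]
    refine mul_le_mul_of_nonneg_right ?_ hw.le
    exact le_mul_of_one_le_right hκ.le hs
  · intro u v
    rw [← map_sub, hJ, mul_assoc]
    refine mul_le_mul_of_nonneg_left ?_ hκ.le
    rw [← Real.sqrt_eq_rpow, ← Real.sqrt_sq (T.dist_nonneg u v), ← Real.sqrt_mul (by positivity)]
    exact Real.sqrt_le_sqrt (hχ.powSum_colorVec_sub_ge hδ u v)

lemma IsStrongColoring.cLp_le (hp : 1 ≤ p) (hδ : 0 < δ) (hδ1 : δ < 1)
    (hχ : IsStrongColoring T r δ χ) :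
    cLp p T.dist ≤ ENNReal.ofReal (4 * Real.log (2 / δ) ^ min (1 / p) (1 / 2 : ℝ)) := by
  have hemb : HasEmbedding T.dist (fun g h : LpSpace p => dist g h)
      (4 * Real.log (2 / δ) ^ min (1 / p) (1 / 2 : ℝ)) := by
    rcases le_total δ (1 / 8) with h | h
    · exact hχ.hasEmbedding_of_le hp hδ h
    · exact hχ.hasEmbedding_of_ge hp h hδ1
  refine max_le ?_ (sInf_le ⟨_, rfl, hemb⟩)
  have he0 : 0 ≤ min (1 / p) (1 / 2 : ℝ) := le_min (by positivity) (by norm_num)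
  have he : min (1 / p) (1 / 2 : ℝ) ≤ 1 := (min_le_right _ _).trans (by norm_num)
  have h1 := sqrt_le_four_mul_log_rpow le_rfl (by norm_num) he0 he
  have h2 : Real.log 2 ≤ Real.log (2 / δ) :=
    Real.log_le_log two_pos (by rw [le_div_iff₀ hδ]; linarith)
  have h3 := Real.rpow_le_rpow (Real.log_nonneg one_le_two) h2 he0
  have h4 : 1 ≤ √2 := Real.one_le_sqrt.2 one_le_two
  rw [← ENNReal.ofReal_one]
  exact ENNReal.ofReal_le_ofReal (by linarith)

end StrongColoring

end Trees

/-- For every rooted weighted tree `T` and every `p ≥ 1`,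
`c_p(T) ≤ 4 [log(2/δ*(T))]^{min(1/p, 1/2)}` (the right-hand side being `∞` if `δ*(T) = 0`). -/
theorem strong_coloring_embedding (T : MetricTree) (r : T.V) (p : ℝ) (hp : 1 ≤ p) :
    cLp p T.dist ≤ ENNReal.ofReal 4 *
      (if deltaStar T r ≤ 0 then (⊤ : ℝ≥0∞)
       else ENNReal.ofReal (Real.log (2 / deltaStar T r) ^ min (1 / p) (1 / 2 : ℝ))) := by
  split_ifs with hpos
  · rw [ENNReal.mul_top (by simp)]
    exact le_top
  push Not at hpos
  rw [← ENNReal.ofReal_mul (by norm_num)]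
  have hne : {δ : ℝ | 0 < δ ∧ δ < 1 ∧ ∃ χ : Sym2 T.V → ℤ, IsStrongColoring T r δ χ}.Nonempty := by
    by_contra h
    rw [Set.not_nonempty_iff_eq_empty] at h
    rw [deltaStar, h, Real.sSup_empty] at hpos
    exact lt_irrefl _ hpos
  obtain ⟨s, -, hs, hmem⟩ := exists_seq_tendsto_sSup hne ⟨1, fun δ hδ => hδ.2.1.le⟩
  have he0 : 0 ≤ min (1 / p) (1 / 2 : ℝ) := le_min (by positivity) (by norm_num)
  have hcont : ContinuousAt (fun δ : ℝ =>
      ENNReal.ofReal (4 * Real.log (2 / δ) ^ min (1 / p) (1 / 2 : ℝ))) (deltaStar T r) :=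
    ENNReal.continuous_ofReal.continuousAt.comp <| continuousAt_const.mul <|
      ((continuousAt_const.div continuousAt_id hpos.ne').log
        (div_pos two_pos hpos).ne').rpow_const (Or.inr he0)
  refine ge_of_tendsto' (hcont.tendsto.comp hs) fun n => ?_
  obtain ⟨h0, h1, χ, hχ⟩ := hmem n
  exact hχ.cLp_le hp h0 h1

end TreePaper
end

section
/- A tree metric T embeds bi-Lipschitzly into a finite-dimensional Euclidean space if and only if λ(T) < ∞. Moreover, every doubling tree T admits a D-embedding into ℝ^k where D and k depend only on the doubling constant λ(T). -/
open scoped ENNReal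

namespace TreePaper

/-- A bi-Lipschitz map of `(X, dX)` into a (pseudo)metric space, with distortion ≤ `D`. -/
def BiLipWith {X E : Type*} [PseudoMetricSpace E] (dX : X → X → ℝ) (f : X → E) (D : ℝ) : Prop :=
  ∃ s : ℝ, 0 < s ∧ ∀ x y : X,
    s * dX x y ≤ dist (f x) (f y) ∧ dist (f x) (f y) ≤ s * D * dX x y

/-- The distance space `(X, dX)` is doubling with constant `lam`: every ball can be covered
by at most `lam` balls of half the radius. -/
def DoublingWith {X : Type*} (dX : X → X → ℝ) (lam : ℕ) : Prop :=
  ∀ (x : X) (R : ℝ), 0 < R → ∃ S : Finset X, S.card ≤ lam ∧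
    ∀ y, dX x y ≤ R → ∃ z ∈ S, dX z y ≤ R / 2

/-- A rooted tree, presented by its parent map, with a height function that is strictly
increasing away from the root. -/
structure RootedTree (V : Type*) where
  parent : V → V
  root : V
  height : V → ℝ
  parent_root : parent root = root
  height_parent_lt : ∀ v, v ≠ root → height (parent v) < height v
  reach : ∀ v, ∃ n, parent^[n] v = root

namespace RootedTree

variable {V : Type*} (T : RootedTree V)

/-- `T.Anc u v`: the vertex `u` is an ancestor of `v` (possibly `v` itself). -/
def Anc (u v : V) : Prop := ∃ n, T.parent^[n] v = u

theorem induction {P : V → Prop} (root : P T.root)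
    (step : ∀ v, v ≠ T.root → P (T.parent v) → P v) (v : V) : P v := by
  obtain ⟨n, hn⟩ := T.reach v
  induction n generalizing v with
  | zero => rwa [show v = T.root from hn]
  | succ n ih =>
    by_cases hv : v = T.root
    · exact hv ▸ root
    · exact step v hv (ih _ (by rwa [Function.iterate_succ_apply] at hn))

theorem exists_rec {β : Type*} (b : β) (Φ : V → β → β) :
    ∃ F : V → β, F T.root = b ∧ ∀ v, v ≠ T.root → F v = Φ v (F (T.parent v)) := by
  classical
  let G : ℕ → V → β := fun n => Nat.rec (fun _ => b) (fun _ g v => Φ v (g (T.parent v))) n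
  refine ⟨fun v => G (Nat.find (T.reach v)) v, ?_, fun v hv => ?_⟩
  · have : Nat.find (T.reach T.root) = 0 := by simp
    simp only [this]; rfl
  · have h : Nat.find (T.reach v) = Nat.find (T.reach (T.parent v)) + 1 :=
      Nat.find_comp_succ (p := fun n => T.parent^[n] v = T.root) (T.reach v)
        (T.reach (T.parent v)) (by simpa using hv)
    simp only [h]; rfl

theorem anc_refl (v : V) : T.Anc v v := ⟨0, rfl⟩

theorem anc_parent (v : V) : T.Anc (T.parent v) v := ⟨1, rfl⟩

theorem root_anc (v : V) : T.Anc T.root v := T.reach v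

variable {T}

theorem Anc.trans {u v w : V} (h : T.Anc u v) (h' : T.Anc v w) : T.Anc u w := by
  obtain ⟨n, rfl⟩ := h
  obtain ⟨m, rfl⟩ := h'
  exact ⟨n + m, Function.iterate_add_apply _ _ _ _⟩

theorem Anc.of_parent {u v : V} (h : T.Anc u (T.parent v)) : T.Anc u v :=
  h.trans (T.anc_parent v)

theorem anc_root {u : V} (h : T.Anc u T.root) : u = T.root := by
  obtain ⟨n, rfl⟩ := h
  exact Function.iterate_fixed T.parent_root n

theorem Anc.eq_or {u v : V} (h : T.Anc u v) :
    u = v ∨ (v ≠ T.root ∧ T.Anc u (T.parent v)) := by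
  by_cases hv : v = T.root
  · subst hv; exact Or.inl (anc_root h)
  · obtain ⟨n, hn⟩ := h
    cases n with
    | zero => exact Or.inl hn.symm
    | succ n => exact Or.inr ⟨hv, n, hn⟩

theorem height_parent_le (v : V) : T.height (T.parent v) ≤ T.height v := by
  by_cases hv : v = T.root
  · rw [hv, T.parent_root]
  · exact (T.height_parent_lt v hv).le

theorem Anc.height_le {u v : V} (h : T.Anc u v) : T.height u ≤ T.height v := by
  induction v using T.induction with
  | root => rw [anc_root h]
  | step v hv ih =>
    rcases h.eq_or with rfl | ⟨-, h⟩
    · exact le_rfl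
    · exact (ih h).trans (height_parent_le v)

theorem Anc.anc_parent {u v : V} (h : T.Anc u v) (hne : u ≠ v) : T.Anc u (T.parent v) :=
  (h.eq_or.resolve_left hne).2

theorem Anc.height_lt {u v : V} (h : T.Anc u v) (hne : u ≠ v) : T.height u < T.height v := by
  obtain ⟨hv, h'⟩ := h.eq_or.resolve_left hne
  exact h'.height_le.trans_lt (T.height_parent_lt v hv)

theorem Anc.eq_of_height_le {u v : V} (h : T.Anc u v) (hle : T.height v ≤ T.height u) :
    u = v := by
  by_contra hne
  exact (h.height_lt hne).not_ge hle

theorem Anc.total {u v x : V} (hu : T.Anc u x) (hv : T.Anc v x) : T.Anc u v ∨ T.Anc v u := by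
  induction x using T.induction with
  | root => rw [anc_root hu, anc_root hv]; exact Or.inl (T.anc_refl _)
  | step x hx ih =>
    rcases hu.eq_or with rfl | ⟨-, hu'⟩
    · exact Or.inr hv
    · rcases hv.eq_or with rfl | ⟨-, hv'⟩
      · exact Or.inl hu
      · exact ih hu' hv'

theorem Anc.of_height_le {u v x : V} (hu : T.Anc u x) (hv : T.Anc v x)
    (h : T.height u ≤ T.height v) : T.Anc u v := by
  rcases hu.total hv with h' | h'
  · exact h'
  · rw [h'.eq_of_height_le h]; exact T.anc_refl _

theorem Anc.of_height_parent_lt {u v x : V} (hu : T.Anc u x) (hv : T.Anc v x)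
    (h : T.height (T.parent u) < T.height v) : T.Anc u v := by
  rcases hu.total hv with h' | h'
  · exact h'
  · by_cases hne : v = u
    · rw [hne]; exact T.anc_refl _
    · exact absurd (h'.anc_parent hne).height_le h.not_ge

theorem Anc.antisymm {u v : V} (h : T.Anc u v) (h' : T.Anc v u) : u = v :=
  h.eq_of_height_le h'.height_le

theorem not_anc_parent {v : V} (hv : v ≠ T.root) : ¬ T.Anc v (T.parent v) := fun h =>
  (T.height_parent_lt v hv).not_ge h.height_le

theorem ne_root_of_height_lt {u v : V} (h : T.height u < T.height v) : v ≠ T.root := by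
  rintro rfl
  exact h.not_ge (T.root_anc u).height_le

/-- Two children of a vertex lying above a common vertex coincide. -/
theorem child_unique {b q y : V} (hb : b ≠ T.root) (hq : q ≠ T.root)
    (hp : T.parent b = T.parent q) (hby : T.Anc b y) (hqy : T.Anc q y) : b = q := by
  refine Anc.antisymm (hby.of_height_parent_lt hqy ?_) (hqy.of_height_parent_lt hby ?_)
  · rw [hp]; exact T.height_parent_lt q hq
  · rw [← hp]; exact T.height_parent_lt b hb

/-- On the way from `z` down to `x` there is a first vertex satisfying `P`. -/
theorem exists_first {P : V → Prop} {z x : V} (hzx : T.Anc z x) (hx : P x) (hz : ¬ P z) :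
    ∃ v, v ≠ T.root ∧ T.Anc z (T.parent v) ∧ T.Anc v x ∧ P v ∧ ¬ P (T.parent v) := by
  induction x using T.induction with
  | root => exact absurd (anc_root hzx ▸ hx) hz
  | step x hxr ih =>
    rcases hzx.eq_or with rfl | ⟨-, h⟩
    · exact absurd hx hz
    · by_cases hp : P (T.parent x)
      · obtain ⟨v, h1, h2, h3, h4⟩ := ih h hp
        exact ⟨v, h1, h2, h3.of_parent, h4⟩
      · exact ⟨x, hxr, h, T.anc_refl x, hx, hp⟩

variable (T) in
theorem exists_anc_common (x y : V) : ∃ n, T.Anc (T.parent^[n] x) y := by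
  obtain ⟨n, hn⟩ := T.reach x
  exact ⟨n, hn ▸ T.root_anc y⟩

variable (T) in
open Classical in
/-- The lowest common ancestor of two vertices. -/
noncomputable def lca (x y : V) : V := T.parent^[Nat.find (T.exists_anc_common x y)] x

variable (T) in
theorem lca_anc_left (x y : V) : T.Anc (T.lca x y) x := ⟨_, rfl⟩

variable (T) in
theorem lca_anc_right (x y : V) : T.Anc (T.lca x y) y := by
  classical exact Nat.find_spec (T.exists_anc_common x y)

theorem Anc.anc_lca {u x y : V} (hx : T.Anc u x) (hy : T.Anc u y) : T.Anc u (T.lca x y) := by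
  classical
  obtain ⟨n, rfl⟩ := hx
  have hn := Nat.find_min' (T.exists_anc_common x y) hy
  refine ⟨n - Nat.find (T.exists_anc_common x y), ?_⟩
  rw [lca, ← Function.iterate_add_apply, Nat.sub_add_cancel hn]

variable (T) in
/-- The distance between two vertices, measured along the path through their lowest common
ancestor. -/
noncomputable def dist (x y : V) : ℝ :=
  T.height x + T.height y - 2 * T.height (T.lca x y)

theorem dist_le {u x y : V} (hx : T.Anc u x) (hy : T.Anc u y) :
    T.dist x y ≤ T.height x + T.height y - 2 * T.height u := by
  have := (hx.anc_lca hy).height_le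
  rw [dist]; linarith

variable (T) in
theorem dist_eq {u x y : V} (hx : T.Anc u x) (hy : T.Anc u y)
    (hu : ∀ v, T.Anc v x → T.Anc v y → T.Anc v u) :
    T.dist x y = T.height x + T.height y - 2 * T.height u := by
  rw [dist, (hx.anc_lca hy).antisymm (hu _ (T.lca_anc_left x y) (T.lca_anc_right x y))]

variable (T) in
theorem dist_comm (x y : V) : T.dist x y = T.dist y x := by
  rw [dist, T.dist_eq (T.lca_anc_right x y) (T.lca_anc_left x y) fun v h h' => h'.anc_lca h,
    ← dist, T.dist_eq (T.lca_anc_left x y) (T.lca_anc_right x y) fun v h h' => h.anc_lca h']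
  ring

variable (T) in
theorem dist_nonneg (x y : V) : 0 ≤ T.dist x y := by
  have h1 := (T.lca_anc_left x y).height_le
  have h2 := (T.lca_anc_right x y).height_le
  rw [dist]; linarith

variable (T) in
theorem dist_triangle (x y w : V) : T.dist x w ≤ T.dist x y + T.dist y w := by
  have a1 := T.lca_anc_left x y
  have a2 := T.lca_anc_right x y
  have b1 := T.lca_anc_left y w
  have b2 := T.lca_anc_right y w
  have ha := a2.height_le
  have hb := b1.height_le
  rcases a2.total b1 with h | h
  · have := dist_le a1 (h.trans b2)
    simp only [dist] at *; linarith
  · have := dist_le (h.trans a1) b2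
    simp only [dist] at *; linarith

end RootedTree

namespace RootedTree

section Pieces

variable {V : Type*} (T : RootedTree V)

/-- The vertices strictly below `z` on the way from `z` down to `x`. -/
def Seg (z x v : V) : Prop := T.Anc v x ∧ T.Anc z v ∧ z ≠ v

/-- The length of the edge joining a vertex to its parent. -/
def edge (v : V) : ℝ := T.height v - T.height (T.parent v)

/-- A decomposition of the edges of a rooted tree into descending paths, the edge above `v` being
identified with `v`. Every vertex prefers one child, through which the tree extends deepest.
A piece follows preferred children, and stops before an edge longer than twice its length. -/
structure Pieces where
  child : V → V
  top : V → V
  deep : ∀ q x, q ≠ T.root → T.Anc q x → ∃ y, T.parent (child (T.parent q)) = T.parent q ∧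
    child (T.parent q) ≠ T.root ∧ T.Anc (child (T.parent q)) y ∧ T.height x ≤ T.height y
  top_root : top T.root = T.root
  top_of_start : ∀ v, v ≠ T.root → (v ≠ child (T.parent v) ∨
    2 * (T.height (T.parent v) - T.height (T.parent (top (T.parent v)))) < T.edge v) → top v = v
  top_of_not_start : ∀ v, v ≠ T.root → ¬ (v ≠ child (T.parent v) ∨
    2 * (T.height (T.parent v) - T.height (T.parent (top (T.parent v)))) < T.edge v) →
    top v = top (T.parent v)

theorem exists_pieces [Fintype V] : Nonempty T.Pieces := by
  classical
  have hdeep : ∀ v, ∃ y, T.Anc v y ∧ ∀ x, T.Anc v x → T.height x ≤ T.height y := by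
    intro v
    obtain ⟨y, hy, hmax⟩ := Finset.exists_max_image (Finset.univ.filter (T.Anc v)) T.height
      ⟨v, by simpa using T.anc_refl v⟩
    exact ⟨y, by simpa using hy, fun x hx => hmax x (by simpa using hx)⟩
  choose d hd hdmax using hdeep
  have hchild : ∀ u, ∃ c, ∀ q, q ≠ T.root → T.parent q = u →
      T.parent c = u ∧ c ≠ T.root ∧ T.height (d q) ≤ T.height (d c) := by
    intro u
    by_cases hne : (Finset.univ.filter fun q => q ≠ T.root ∧ T.parent q = u).Nonempty
    · obtain ⟨c, hc, hmax⟩ := Finset.exists_max_image _ (fun q => T.height (d q)) hne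
      simp only [Finset.mem_filter, Finset.mem_univ, true_and] at hc hmax
      exact ⟨c, fun q h1 h2 => ⟨hc.2, hc.1, hmax q ⟨h1, h2⟩⟩⟩
    · refine ⟨u, fun q h1 h2 => absurd ⟨q, ?_⟩ hne⟩
      simpa using ⟨h1, h2⟩
  choose c hc using hchild
  obtain ⟨top, hroot, htop⟩ := T.exists_rec T.root fun v t =>
    if v ≠ c (T.parent v) ∨
      2 * (T.height (T.parent v) - T.height (T.parent t)) < T.edge v then v else t
  refine ⟨c, top, fun q x hq hx => ?_, hroot, fun v hv h => ?_, fun v hv h => ?_⟩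
  · obtain ⟨h1, h2, h3⟩ := hc _ q hq rfl
    exact ⟨d (c (T.parent q)), h1, h2, hd _, (hdmax q x hx).trans h3⟩
  · rw [htop v hv, if_pos h]
  · rw [htop v hv, if_neg h]

end Pieces

namespace Pieces

variable {V : Type*} {T : RootedTree V} (P : T.Pieces)

/-- The length of the part above `v` of the piece containing the edge above `v`. -/
def own (v : V) : ℝ := T.height v - T.height (T.parent (P.top v))

theorem top_cases {v : V} (hv : v ≠ T.root) : P.top v = v ∨
    (P.top v = P.top (T.parent v) ∧ v = P.child (T.parent v) ∧
      T.edge v ≤ 2 * P.own (T.parent v)) := by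
  by_cases h : v ≠ P.child (T.parent v) ∨
    2 * (T.height (T.parent v) - T.height (T.parent (P.top (T.parent v)))) < T.edge v
  · exact Or.inl (P.top_of_start v hv h)
  · refine Or.inr ⟨P.top_of_not_start v hv h, ?_⟩
    push Not at h
    exact h

theorem top_anc (v : V) : T.Anc (P.top v) v := by
  induction v using T.induction with
  | root => rw [P.top_root]; exact T.anc_refl _
  | step v hv ih =>
    rcases P.top_cases hv with h | ⟨h, -⟩
    · rw [h]; exact T.anc_refl v
    · rw [h]; exact ih.of_parent

theorem edge_le_own (v : V) : T.edge v ≤ P.own v := by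
  by_cases hv : v = T.root
  · simp [edge, own, hv, P.top_root]
  · rcases P.top_cases hv with h | ⟨h, -⟩
    · rw [own, h, edge]
    · have := (P.top_anc (T.parent v)).height_le
      have h' := height_parent_le (T := T) (P.top (T.parent v))
      rw [own, h, edge]; linarith

theorem own_root : P.own T.root = 0 := by
  simp [own, P.top_root, T.parent_root]

theorem top_top (v : V) : P.top (P.top v) = P.top v := by
  induction v using T.induction with
  | root => rw [P.top_root, P.top_root]
  | step v hv ih =>
    rcases P.top_cases hv with h | ⟨h, -⟩
    · rw [h, h]
    · rw [h, ih]

theorem top_eq_of_anc {u v : V} (h : T.Anc (P.top v) u) (h' : T.Anc u v) :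
    P.top u = P.top v := by
  induction v using T.induction with
  | root => rw [anc_root h']
  | step v hv ih =>
    rcases h'.eq_or with rfl | ⟨-, h''⟩
    · rfl
    · rcases P.top_cases hv with ht | ⟨ht, -⟩
      · rw [ht] at h
        exact absurd (h.trans h'') (not_anc_parent hv)
      · rw [ht] at h ⊢
        exact ih h h''

theorem top_eq_root {v : V} (h : P.top v = T.root) : v = T.root := by
  induction v using T.induction with
  | root => rfl
  | step v hv ih =>
    rcases P.top_cases hv with ht | ⟨ht, -, hle⟩
    · rw [← h, ht]
    · have hp : T.parent v = T.root := ih (ht ▸ h)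
      rw [hp, own_root, edge, hp] at hle
      have := T.height_parent_lt v hv
      rw [hp] at this
      linarith

/-- The vertices of a piece form a chain. -/
theorem total_of_top_eq {q q' : V} (h : P.top q = P.top q') : T.Anc q q' ∨ T.Anc q' q := by
  induction q using T.induction with
  | root => exact Or.inl (T.root_anc _)
  | step q hq ih =>
    rcases P.top_cases hq with ht | ⟨ht, hc, -⟩
    · left; rw [← ht, h]; exact P.top_anc q'
    · rcases ih (ht ▸ h) with h' | h'
      · by_cases hne : T.parent q = q'
        · rw [← hne]; exact Or.inr (T.anc_parent q)
        · left
          obtain ⟨e, her, h1, h2, h3, h4⟩ := exists_first (P := fun v => ¬ T.Anc v (T.parent q)) h'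
            (fun h'' => hne (h'.antisymm h'')) (not_not.2 (T.anc_refl _))
          have hpe : T.parent e = T.parent q := (not_not.1 h4).antisymm h1
          have hta : T.Anc (P.top q') (T.parent q) := by
            rw [← h, ht]; exact P.top_anc _
          have hte : P.top e = P.top q' := P.top_eq_of_anc (hta.trans h1).of_parent h2
          rcases P.top_cases her with h5 | ⟨-, h5, -⟩
          · rw [← hte, h5] at hta
            exact absurd hta h3
          · rw [hpe, ← hc] at h5
            rwa [← h5]
      · exact Or.inr h'.of_parent

/-- Vertices owning a length `s` of two different pieces are at distance at least `s`. -/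
theorem le_dist_of_top_ne {s : ℝ} {x y : V} (hx : s ≤ P.own x) (hy : s ≤ P.own y)
    (hne : P.top x ≠ P.top y) : s ≤ T.dist x y := by
  by_contra! hlt
  have key : ∀ w, s ≤ P.own w → T.Anc (T.lca x y) w → T.height w - T.height (T.lca x y) < s →
      P.top (T.lca x y) = P.top w := by
    intro w hw ha hs
    refine P.top_eq_of_anc ?_ ha
    refine (P.top_anc w).of_height_parent_lt ha ?_
    rw [own] at hw; linarith
  have h1 := T.lca_anc_left x y
  have h2 := T.lca_anc_right x y
  have h1' := h1.height_le
  have h2' := h2.height_le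
  rw [dist] at hlt
  exact hne ((key x hx h1 (by linarith)).symm.trans (key y hy h2 (by linarith)))

theorem exists_seg_of_le_own {z q : V} {l : ℝ} (hzq : T.Anc z q)
    (h1 : l ≤ P.own q) (h2 : l ≤ T.height q - T.height z) :
    ∃ a, T.Anc z a ∧ T.Anc a q ∧ l ≤ T.height q - T.height a ∧
      ∀ v, T.Seg a q v → P.top v = P.top q := by
  have hq := P.top_anc q
  have hpq : T.Anc (T.parent (P.top q)) q := (T.anc_parent _).trans hq
  have key : ∀ a, T.height (T.parent (P.top q)) ≤ T.height a →
      ∀ v, T.Seg a q v → P.top v = P.top q := by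
    rintro a ha v ⟨h3, h4, h5⟩
    exact P.top_eq_of_anc (hq.of_height_parent_lt h3 (ha.trans_lt (h4.height_lt h5))) h3
  rcases hzq.total hpq with h | h
  · exact ⟨_, h, hpq, h1, key _ le_rfl⟩
  · exact ⟨z, T.anc_refl z, hzq, h2, key _ h.height_le⟩

end Pieces

end RootedTree

/-- A quantitative packing bound: `N n` bounds the size of every `s`-separated set in a ball of
radius `n * s`. -/
def Packed {X : Type*} (dX : X → X → ℝ) (N : ℕ → ℕ) : Prop :=
  ∀ (n : ℕ) (x : X) (s : ℝ), 0 < s → ∀ S : Finset X, (∀ y ∈ S, dX x y ≤ n * s) →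
    (∀ y ∈ S, ∀ y' ∈ S, y ≠ y' → s ≤ dX y y') → S.card ≤ N n

/-- Greedy colouring in the order of decreasing rank. -/
theorem exists_coloring_of_rank {α : Type*} [Fintype α] (r : α → α → Prop)
    (hr : ∀ a b, r a b → r b a) (rank : α → ℝ) (N : ℕ)
    (hN : ∀ a, ∀ S : Finset α, (∀ b ∈ S, b ≠ a ∧ r a b ∧ rank a ≤ rank b) → S.card ≤ N) :
    ∃ χ : α → Fin (N + 1), ∀ a b, a ≠ b → r a b → χ a ≠ χ b := by
  classical
  suffices h : ∀ s : Finset α, ∃ χ : α → Fin (N + 1),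
      ∀ a ∈ s, ∀ b ∈ s, a ≠ b → r a b → χ a ≠ χ b by
    obtain ⟨χ, hχ⟩ := h Finset.univ
    exact ⟨χ, fun a b => hχ a (Finset.mem_univ a) b (Finset.mem_univ b)⟩
  intro s
  induction s using Finset.strongInduction with
  | H s ih =>
    rcases s.eq_empty_or_nonempty with rfl | hne
    · exact ⟨fun _ => 0, by simp⟩
    obtain ⟨a, ha, hmin⟩ := Finset.exists_min_image s rank hne
    obtain ⟨χ, hχ⟩ := ih (s.erase a) (Finset.erase_ssubset ha)
    have hcard : (((s.erase a).filter (r a)).image χ).card <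
        (Finset.univ : Finset (Fin (N + 1))).card := by
      rw [Finset.card_univ, Fintype.card_fin]
      refine Nat.lt_succ_of_le (Finset.card_image_le.trans (hN a _ fun b hb => ?_))
      simp only [Finset.mem_filter, Finset.mem_erase] at hb
      exact ⟨hb.1.1, hb.2, hmin b hb.1.2⟩
    obtain ⟨c, -, hc⟩ := Finset.exists_mem_notMem_of_card_lt_card hcard
    have hc' : ∀ b ∈ s, b ≠ a → r a b → χ b ≠ c := fun b hb hba hab h =>
      hc (Finset.mem_image.2 ⟨b, by simp [hb, hba, hab], h⟩)
    refine ⟨Function.update χ a c, fun b hb b' hb' hbb' hrb => ?_⟩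
    by_cases h1 : b = a
    · subst h1
      rw [Function.update_self, Function.update_of_ne hbb'.symm]
      exact (hc' b' hb' hbb'.symm hrb).symm
    · by_cases h2 : b' = a
      · subst h2
        rw [Function.update_self, Function.update_of_ne h1]
        exact hc' b hb h1 (hr _ _ hrb)
      · rw [Function.update_of_ne h1, Function.update_of_ne h2]
        exact hχ b (by simp [h1, hb]) b' (by simp [h2, hb']) hbb' hrb

namespace RootedTree.Pieces

variable {V : Type*} {T : RootedTree V} (P : T.Pieces)

/-- Two pieces conflict if they come close to each other, relative to the lengths they own. -/
def Conflict (A : ℕ) (a b : V) : Prop :=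
  ∃ x y, P.top x = a ∧ P.top y = b ∧ 0 < P.own x ∧ 0 < P.own y ∧
    T.dist x y ≤ A * P.own x ∧ T.dist x y ≤ A * P.own y

theorem exists_own_ge {l : ℝ} {y w : V} (hw : P.top w = P.top y) (hl : l ≤ P.own w)
    (hy : P.own y < l) :
    ∃ y', P.top y' = P.top y ∧ l ≤ P.own y' ∧ P.own y' ≤ 3 * l := by
  have hown : P.own (P.top y) ≤ P.own y := by
    have := (P.top_anc y).height_le
    rw [own, own, P.top_top]; linarith
  obtain ⟨v, hv, h1, h2, h3, h4⟩ := exists_first (P := fun v => l ≤ P.own v) (z := P.top y)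
    (hw ▸ P.top_anc w) hl (by linarith)
  have htv : P.top v = P.top y := by
    rw [← hw]; exact P.top_eq_of_anc (hw ▸ h1.of_parent) h2
  refine ⟨v, htv, h3, ?_⟩
  rcases P.top_cases hv with h | ⟨h, -, hle⟩
  · rw [← htv, h] at h1
    exact absurd h1 (not_anc_parent hv)
  · have : P.own v = P.own (T.parent v) + T.edge v := by
      rw [own, own, edge, h]; ring
    push Not at h4
    linarith

theorem dist_le_own_add_own {x y : V} (h : P.top x = P.top y) :
    T.dist x y ≤ P.own x + P.own y := by
  have := dist_le (P.top_anc x) (h ▸ P.top_anc y)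
  have h' := height_parent_le (T := T) (P.top y)
  rw [h] at this
  rw [own, own, h]; linarith

theorem exists_coloring [Fintype V] {N : ℕ → ℕ} (hN : Packed T.dist N) (A : ℕ) :
    ∃ χ : V → Fin (N (A + 6) + 1), ∀ a b, a ≠ b → P.Conflict A a b → χ a ≠ χ b := by
  classical
  have hbot : ∀ a, ∃ w, ∀ x, P.top x = a → P.top w = a ∧ P.own x ≤ P.own w := by
    intro a
    by_cases hne : (Finset.univ.filter fun x => P.top x = a).Nonempty
    · obtain ⟨w, hw, hmax⟩ := Finset.exists_max_image _ P.own hne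
      simp only [Finset.mem_filter, Finset.mem_univ, true_and] at hw hmax
      exact ⟨w, fun x hx => ⟨hw, hmax x hx⟩⟩
    · exact ⟨a, fun x hx => absurd ⟨x, by simpa using hx⟩ hne⟩
  choose bot hbot using hbot
  refine exists_coloring_of_rank (P.Conflict A) ?_ (fun a => P.own (bot a)) _ fun a S hS => ?_
  · rintro a b ⟨x, y, h1, h2, h3, h4, h5, h6⟩
    rw [T.dist_comm] at h5 h6
    exact ⟨y, x, h2, h1, h4, h3, h6, h5⟩
  rcases S.eq_empty_or_nonempty with rfl | ⟨b₀, hb₀⟩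
  · simp
  have hpos : 0 < P.own (bot a) := by
    obtain ⟨-, ⟨x, y, h1, -, h3, -⟩, -⟩ := hS b₀ hb₀
    exact h3.trans_le (hbot a x h1).2
  have hy : ∀ b, ∃ y, b ∈ S → P.top y = b ∧ P.own (bot a) ≤ P.own y ∧
      T.dist (bot a) y ≤ ((A + 6 : ℕ) : ℝ) * P.own (bot a) := by
    intro b
    by_cases hb : b ∈ S
    swap
    · exact ⟨b, fun h => absurd h hb⟩
    obtain ⟨-, ⟨x, y, rfl, rfl, hx0, hy0, hxA, hyA⟩, hrank⟩ := hS b hb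
    have hxa := hbot _ x rfl
    have hAx : (A : ℝ) * P.own x ≤ A * P.own (bot (P.top x)) := by gcongr; exact hxa.2
    have h1 := P.dist_le_own_add_own hxa.1
    have h2 := T.dist_triangle (bot (P.top x)) x y
    push_cast
    by_cases hown : P.own (bot (P.top x)) ≤ P.own y
    · exact ⟨y, fun _ => ⟨rfl, hown, by linarith⟩⟩
    · push Not at hown
      obtain ⟨y', h3, h4, h5⟩ := P.exists_own_ge (hbot _ y rfl).1 hrank hown
      have h6 := P.dist_le_own_add_own h3.symm
      have h7 := T.dist_triangle (bot (P.top x)) y y'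
      exact ⟨y', fun _ => ⟨h3, h4, by linarith⟩⟩
  choose y hy using hy
  have hinj : Set.InjOn y S := fun b hb b' hb' h => by
    rw [← (hy b hb).1, ← (hy b' hb').1, h]
  rw [← Finset.card_image_of_injOn hinj]
  refine hN _ (bot a) _ hpos _ ?_ ?_
  · simp only [Finset.mem_image]
    rintro _ ⟨b, hb, rfl⟩
    exact (hy b hb).2.2
  · simp only [Finset.mem_image]
    rintro _ ⟨b, hb, rfl⟩ _ ⟨b', hb', rfl⟩ hne
    refine P.le_dist_of_top_ne (hy b hb).2.1 (hy b' hb').2.1 ?_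
    rw [(hy b hb).1, (hy b' hb').1]
    exact fun h => hne (h ▸ rfl)

end RootedTree.Pieces

namespace RootedTree

/-- Long edges start only just below heights that are multiples of a large power of two. -/
def Spread {V : Type*} (T : RootedTree V) : Prop :=
  ∀ v, T.parent v ≠ T.root → ∀ i : ℤ, 6 * (2 : ℝ) ^ i ≤ T.edge v →
    ∃ k : ℤ, T.height (T.parent (T.parent v)) < k * (2 : ℝ) ^ i ∧
      k * (2 : ℝ) ^ i ≤ T.height (T.parent v)

namespace Pieces

variable {V : Type*} {T : RootedTree V} (P : T.Pieces)

/-- A long path that does not follow any piece for a while leaves preferred children often. -/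
theorem exists_not_child {z x : V} {ε τ : ℝ} (hzx : T.Anc z x) (hε : 0 < ε)
    (hcon : ∀ q, T.Seg z x q → ε ≤ P.own q → T.height q - T.height z < ε)
    (hzτ : T.height z + ε ≤ τ) (hτx : τ + 2 * ε < T.height x) :
    ∃ q, q ≠ T.root ∧ T.Anc z (T.parent q) ∧ T.Anc q x ∧ q ≠ P.child (T.parent q) ∧
      τ < T.height (T.parent q) ∧ T.height (T.parent q) ≤ τ + 2 * ε := by
  by_contra! hno
  have claim : ∀ v, T.Anc z v → T.Anc v x → τ < T.height v →
      T.height (T.parent v) ≤ τ + 2 * ε → T.height v - τ ≤ 2 * P.own v := by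
    intro v
    induction v using T.induction with
    | root =>
      intro h _ h2
      rw [anc_root h] at hzτ
      linarith
    | step v hv ih =>
      intro hzv hvx hτv hpv
      have he := P.edge_le_own v
      have hzp : T.Anc z (T.parent v) := hzv.anc_parent (by rintro rfl; linarith)
      by_cases hp : T.height (T.parent v) ≤ τ
      · have := T.height_parent_lt v hv
        rw [edge] at he; linarith
      push Not at hp
      have ih' := ih hzp ((T.anc_parent v).trans hvx) hp ((height_parent_le _).trans hpv)
      by_cases hj : 2 * P.own (T.parent v) < T.edge v
      · have := P.top_of_start v hv (Or.inr hj)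
        have h2 : P.own v = T.edge v := by rw [own, this, edge]
        rw [h2]; rw [edge] at *; linarith
      · have hc : v = P.child (T.parent v) := by
          by_contra hc
          exact (hno v hv hzp hvx hc hp).not_ge hpv
        have := P.top_of_not_start v hv (by rintro (h | h); exacts [h hc, hj h])
        have h2 : P.own v = P.own (T.parent v) + T.edge v := by rw [own, own, this, edge]; ring
        have h3 := T.height_parent_lt v hv
        rw [h2]; rw [edge] at *; linarith
  obtain ⟨v, hv, h1, h2, h3, h4⟩ := exists_first (P := fun v => τ + 2 * ε < T.height v) hzx hτx
    (by linarith)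
  push Not at h4
  have := claim v h1.of_parent h2 (by linarith) h4
  have := hcon v ⟨h2, h1.of_parent, by rintro rfl; linarith⟩ (by linarith)
  linarith

/-- Below a vertex strictly between two consecutive multiples of `g = 2 ^ i`, the preferred child
leads to a vertex at distance comparable to `g`. -/
theorem exists_deep_vertex (hT : T.Spread) {i k : ℤ} {q x : V} (hqx : T.Anc q x)
    (hq : q ≠ T.root) (hroot : T.height T.root ≤ k * (2 : ℝ) ^ i)
    (hu : k * (2 : ℝ) ^ i < T.height (T.parent q))
    (hu' : T.height (T.parent q) ≤ k * (2 : ℝ) ^ i + 2 ^ i / 2)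
    (he : T.edge (T.parent q) < T.height (T.parent q) - k * (2 : ℝ) ^ i)
    (hx : k * (2 : ℝ) ^ i + 2 ^ i ≤ T.height x) :
    ∃ y, T.Anc (P.child (T.parent q)) y ∧ k * (2 : ℝ) ^ i + 5 / 8 * 2 ^ i ≤ T.height y ∧
      T.height y ≤ k * (2 : ℝ) ^ i + 7 * 2 ^ i := by
  have hg : (0 : ℝ) < 2 ^ i := by positivity
  obtain ⟨Y, h1, h2, h3, h4⟩ := P.deep q x hq hqx
  obtain ⟨v, hv, h5, h6, h7, h8⟩ := exists_first
    (P := fun v => k * (2 : ℝ) ^ i + 5 / 8 * 2 ^ i ≤ T.height v) (z := T.parent q) (x := Y)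
    ((h1 ▸ T.anc_parent _).trans h3) (by linarith) (by linarith)
  push Not at h8
  have h5' := h5.height_le
  refine ⟨v, h3.of_height_parent_lt h6 ?_, h7, ?_⟩
  · rw [h1]; exact h5'.trans_lt (T.height_parent_lt v hv)
  · by_contra! hlt
    obtain ⟨k', hk1, hk2⟩ := hT v (ne_root_of_height_lt (u := T.root) (by linarith)) i
      (by rw [edge]; linarith)
    have hk : k' ≤ k := by
      have : (k' : ℝ) * 2 ^ i < (k + 1 : ℝ) * 2 ^ i := by linarith
      have := lt_of_mul_lt_mul_right this hg.le
      exact Int.lt_add_one_iff.1 (by exact_mod_cast this)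
    have hk3 : (k' : ℝ) * 2 ^ i ≤ k * 2 ^ i := by gcongr
    by_cases hpv : T.parent q = T.parent v
    · rw [hpv, edge] at he; linarith
    · have := (h5.anc_parent hpv).height_le
      linarith

/-- Every descending path follows one of the pieces for a definite fraction of its length. -/
theorem exists_own_ge_mul {N : ℕ → ℕ} (hN : Packed T.dist N) (hT : T.Spread) {z x : V}
    (hzx : T.Anc z x) (hne : z ≠ x) :
    ∃ q, T.Seg z x q ∧ (T.height x - T.height z) / (32 * (N 96 + 1)) ≤ P.own q ∧
      (T.height x - T.height z) / (32 * (N 96 + 1)) ≤ T.height q - T.height z := by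
  classical
  by_contra! hcon
  have hr : 0 < T.height x - T.height z := sub_pos.2 (hzx.height_lt hne)
  set r := T.height x - T.height z with hrdef
  set ε := r / (32 * (N 96 + 1)) with hεdef
  have hε : 0 < ε := by positivity
  have hMε : 2 * ((N 96 : ℝ) + 1) * ε = r / 16 := by
    rw [hεdef]; field_simp; norm_num
  have hεr : ε ≤ r / 32 := by
    have : 0 ≤ (N 96 : ℝ) * ε := by positivity
    linarith
  set i := Int.log 2 (r / 2) with hi
  have hg : (0 : ℝ) < 2 ^ i := by positivity
  have hg1 : (2 : ℝ) ^ i ≤ r / 2 := by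
    simpa using Int.zpow_log_le_self (b := 2) (r := r / 2) one_lt_two (by positivity)
  have hg2 : r / 2 < (2 : ℝ) ^ i * 2 := by
    have := Int.lt_zpow_succ_log_self (b := 2) one_lt_two (r / 2)
    rwa [← hi, Nat.cast_ofNat, zpow_add_one₀ two_ne_zero] at this
  set k := ⌈T.height z / 2 ^ i⌉ with hk
  have ht1 : T.height z ≤ k * (2 : ℝ) ^ i := (div_le_iff₀ hg).1 (Int.le_ceil _)
  have ht2 : k * (2 : ℝ) ^ i < T.height z + 2 ^ i := by
    have h := Int.ceil_lt_add_one (T.height z / (2 : ℝ) ^ i)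
    have := (lt_div_iff₀ hg).1 (sub_lt_iff_lt_add.2 h)
    linarith
  have hroot := (T.root_anc z).height_le
  have hbr : ∀ j : Fin (N 96 + 1), ∃ q y, q ≠ T.root ∧ T.Anc q x ∧ q ≠ P.child (T.parent q) ∧
      k * (2 : ℝ) ^ i + 2 ^ i / 4 + 2 * j * ε < T.height (T.parent q) ∧
      T.height (T.parent q) ≤ k * (2 : ℝ) ^ i + 2 ^ i / 4 + 2 * (j + 1) * ε ∧
      T.height (T.parent q) ≤ k * (2 : ℝ) ^ i + 2 ^ i / 2 ∧
      T.Anc (P.child (T.parent q)) y ∧ k * (2 : ℝ) ^ i + 5 / 8 * 2 ^ i ≤ T.height y ∧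
      T.height y ≤ k * (2 : ℝ) ^ i + 7 * 2 ^ i := by
    intro j
    have hj : 2 * ((j : ℝ) + 1) * ε ≤ 2 ^ i / 4 := by
      have h1 : (j : ℝ) + 1 ≤ N 96 + 1 := by exact_mod_cast j.2
      have : 2 * ((j : ℝ) + 1) * ε ≤ 2 * ((N 96 : ℝ) + 1) * ε := by gcongr
      linarith
    have hj0 : 0 ≤ 2 * (j : ℝ) * ε := by positivity
    obtain ⟨q, h1, h2, h3, h4, h5, h6⟩ := P.exists_not_child (ε := ε)
      (τ := k * (2 : ℝ) ^ i + 2 ^ i / 4 + 2 * j * ε) hzx hε (fun q => hcon q) (by linarith)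
      (by linarith)
    have h7 : T.edge (T.parent q) < T.height (T.parent q) - k * (2 : ℝ) ^ i := by
      by_contra! h7
      have h8 := P.edge_le_own (T.parent q)
      have := hcon (T.parent q) ⟨(T.anc_parent q).trans h3, h2, fun h => by
        rw [← h] at h5; linarith⟩ (by linarith)
      linarith
    obtain ⟨y, hy⟩ := P.exists_deep_vertex hT (k := k) (i := i) h3 h1 (by linarith) (by linarith)
      (by linarith) h7 (by linarith)
    exact ⟨q, y, h1, h3, h4, h5, by linarith, by linarith, hy⟩
  choose q y hq hqx hqc hq1 hq2 hq3 hcy hy1 hy2 using hbr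
  have hsep : ∀ j j', j < j' → (2 : ℝ) ^ i / 8 ≤ T.dist (y j) (y j') := by
    intro j j' hjj'
    have hlt : T.height (T.parent (q j)) < T.height (T.parent (q j')) := by
      refine (hq2 j).trans_lt (lt_of_le_of_lt ?_ (hq1 j'))
      have : (j : ℝ) + 1 ≤ j' := by exact_mod_cast hjj'
      gcongr
    obtain ⟨-, h1, h2, -⟩ := P.deep (q j) (q j) (hq j) (T.anc_refl _)
    obtain ⟨-, h3, h4, -⟩ := P.deep (q j') (q j') (hq j') (T.anc_refl _)
    have hlca : T.height (T.lca (y j) (y j')) ≤ T.height (T.parent (q j)) := by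
      by_contra! hl
      have h5 := ((hcy j).of_height_parent_lt (T.lca_anc_left (y j) (y j'))
        (h1.symm ▸ hl)).trans (T.lca_anc_right _ _)
      have h6 := (hqx j).of_height_parent_lt ((T.anc_parent _).trans (hqx j')) hlt
      have h7 : T.Anc (T.parent (q j')) (y j') := (h3 ▸ T.anc_parent _).trans (hcy j')
      exact hqc j (child_unique (hq j) h2 h1.symm (h6.trans h7) h5)
    rw [dist]
    linarith [hy1 j, hy1 j', hq3 j]
  have hsep' : ∀ j j', j ≠ j' → (2 : ℝ) ^ i / 8 ≤ T.dist (y j) (y j') := by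
    intro j j' h
    rcases lt_or_gt_of_ne h with h | h
    · exact hsep j j' h
    · rw [T.dist_comm]; exact hsep j' j h
  have hself : ∀ v, T.dist v v = 0 := fun v =>
    le_antisymm ((dist_le (T.anc_refl v) (T.anc_refl v)).trans (by linarith)) (T.dist_nonneg v v)
  have hinj : Function.Injective y := fun j j' h => by
    by_contra hjj'
    have := hsep' j j' hjj'
    rw [h, hself] at this
    linarith
  have hcard := hN 96 x (2 ^ i / 8) (by positivity) (Finset.univ.image y) ?_ ?_
  · rw [Finset.card_image_of_injective _ hinj, Finset.card_univ, Fintype.card_fin] at hcard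
    omega
  · simp only [Finset.mem_image, Finset.mem_univ, true_and]
    rintro _ ⟨j, rfl⟩
    have hzy : T.Anc z (y j) := by
      obtain ⟨-, h1, -⟩ := P.deep (q j) (q j) (hq j) (T.anc_refl _)
      refine Anc.trans (hzx.of_height_le ((T.anc_parent _).trans (hqx j)) ?_)
        ((h1 ▸ T.anc_parent _).trans (hcy j))
      have : 0 ≤ 2 * (j : ℝ) * ε := by positivity
      linarith [hq1 j]
    have := dist_le hzx hzy
    push_cast
    linarith [hy2 j]
  · simp only [Finset.mem_image, Finset.mem_univ, true_and]
    rintro _ ⟨j, rfl⟩ _ ⟨j', rfl⟩ hjj'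
    exact hsep' j j' fun h => hjj' (h ▸ rfl)

end Pieces

end RootedTree

namespace RootedTree

section Segments

variable {V : Type*} {T : RootedTree V}

theorem edge_nonneg (v : V) : 0 ≤ T.edge v := sub_nonneg.2 (height_parent_le v)

theorem seg_parent {z x v : V} (hx : x ≠ T.root) (hzx : T.Anc z x) (hne : z ≠ x) :
    T.Seg z x v ↔ v = x ∨ T.Seg z (T.parent x) v := by
  constructor
  · rintro ⟨h1, h2⟩
    rcases h1.eq_or with rfl | ⟨-, h⟩
    · exact Or.inl rfl
    · exact Or.inr ⟨h, h2⟩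
  · rintro (rfl | ⟨h1, h2⟩)
    · exact ⟨T.anc_refl _, hzx, hne⟩
    · exact ⟨h1.of_parent, h2⟩

theorem seg_iff_or {z a x v : V} (hza : T.Anc z a) (hax : T.Anc a x) :
    T.Seg z x v ↔ T.Seg z a v ∨ T.Seg a x v := by
  constructor
  · rintro ⟨h1, h2, h3⟩
    by_cases h : T.Anc v a
    · exact Or.inl ⟨h, h2, h3⟩
    · refine Or.inr ⟨h1, (h1.total hax).resolve_left h, ?_⟩
      rintro rfl
      exact h (T.anc_refl _)
  · rintro (⟨h1, h2, h3⟩ | ⟨h1, h2, h3⟩)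
    · exact ⟨h1.trans hax, h2, h3⟩
    · refine ⟨h1, hza.trans h2, ?_⟩
      rintro rfl
      exact h3 (h2.antisymm hza)

open Classical in
theorem sum_edge_seg [Fintype V] {z x : V} (hzx : T.Anc z x) :
    ∑ v with T.Seg z x v, T.edge v = T.height x - T.height z := by
  have hself : ∀ x : V, ∑ v with T.Seg x x v, T.edge v = 0 := fun x => by
    rw [Finset.filter_false_of_mem, Finset.sum_empty]
    rintro v - ⟨h1, h2, h3⟩
    exact h3 (h2.antisymm h1)
  induction x using T.induction with
  | root => rw [anc_root hzx, hself, sub_self]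
  | step x hx ih =>
    by_cases hne : z = x
    · rw [hne, hself, sub_self]
    · have hset : (Finset.univ.filter fun v => T.Seg z x v) =
          insert x (Finset.univ.filter fun v => T.Seg z (T.parent x) v) := by
        ext v
        simp [seg_parent hx hzx hne]
      rw [hset, Finset.sum_insert, ih (hzx.anc_parent hne), edge]
      · ring
      · simp only [Finset.mem_filter, Finset.mem_univ, true_and]
        exact fun h => not_anc_parent hx h.1

end Segments

namespace Pieces

variable {V : Type*} [Fintype V] {T : RootedTree V} (P : T.Pieces)

open Classical in
/-- The total length between `z` and `x` of the pieces with top in `A`. -/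
noncomputable def mass (A : Set V) (z x : V) : ℝ :=
  ∑ v with T.Seg z x v ∧ P.top v ∈ A, T.edge v

theorem mass_nonneg (A : Set V) (z x : V) : 0 ≤ P.mass A z x :=
  Finset.sum_nonneg fun v _ => edge_nonneg v

theorem mass_mono {A B : Set V} (h : A ⊆ B) (z x : V) : P.mass A z x ≤ P.mass B z x := by
  classical
  refine Finset.sum_le_sum_of_subset_of_nonneg ?_ fun v _ _ => edge_nonneg v
  intro v
  simp only [Finset.mem_filter, Finset.mem_univ, true_and]
  exact fun h' => ⟨h'.1, h h'.2⟩

theorem mass_eq {A : Set V} {z x : V} (hzx : T.Anc z x) (h : ∀ v, T.Seg z x v → P.top v ∈ A) :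
    P.mass A z x = T.height x - T.height z := by
  classical
  rw [← sum_edge_seg hzx, mass]
  congr 1
  ext v
  simpa using h v

theorem mass_le (A : Set V) {z x : V} (hzx : T.Anc z x) :
    P.mass A z x ≤ T.height x - T.height z := by
  rw [← P.mass_eq (A := Set.univ) hzx fun _ _ => Set.mem_univ _]
  exact P.mass_mono (Set.subset_univ _) z x

theorem mass_add (A : Set V) {z a x : V} (hza : T.Anc z a) (hax : T.Anc a x) :
    P.mass A z x = P.mass A z a + P.mass A a x := by
  classical
  rw [mass, mass, mass, ← Finset.sum_union]
  · congr 1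
    ext v
    simp only [Finset.mem_filter, Finset.mem_univ, true_and, Finset.mem_union,
      seg_iff_or hza hax]
    tauto
  · rw [Finset.disjoint_left]
    simp only [Finset.mem_filter, Finset.mem_univ, true_and]
    rintro v ⟨⟨h1, -⟩, -⟩ ⟨⟨-, h2, h3⟩, -⟩
    exact h3 (h2.antisymm h1)

theorem mass_union_le (A B : Set V) (z x : V) :
    P.mass (A ∪ B) z x ≤ P.mass A z x + P.mass B z x := by
  classical
  rw [mass, mass, mass, ← Finset.sum_union_inter]
  refine le_add_of_le_of_nonneg (le_of_eq ?_) (Finset.sum_nonneg fun v _ => edge_nonneg v)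
  congr 1
  ext v
  simp only [Finset.mem_filter, Finset.mem_univ, true_and, Finset.mem_union, Set.mem_union]
  tauto

theorem mass_finset_le (S : Finset V) (z x : V) :
    P.mass S z x ≤ ∑ b ∈ S, P.mass {b} z x := by
  classical
  induction S using Finset.induction_on with
  | empty => simp [mass]
  | insert b S hb ih =>
    rw [Finset.sum_insert hb, Finset.coe_insert, ← Set.singleton_union]
    exact (P.mass_union_le _ _ z x).trans (by gcongr)

theorem mass_singleton_le (b z y : V) :
    P.mass {b} z y = 0 ∨ ∃ v, T.Seg z y v ∧ P.top v = b ∧ P.mass {b} z y ≤ P.own v := by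
  classical
  by_cases hne : (Finset.univ.filter fun v => T.Seg z y v ∧ P.top v ∈ ({b} : Set V)).Nonempty
  · right
    obtain ⟨w, hw, hmax⟩ := Finset.exists_max_image _ T.height hne
    simp only [Finset.mem_filter, Finset.mem_univ, true_and, Set.mem_singleton_iff] at hw hmax
    refine ⟨w, hw.1, hw.2, ?_⟩
    have hwr : w ≠ T.root := fun h => by
      have := hw.1.2.1
      rw [h] at this
      exact hw.1.2.2 (h ▸ anc_root this)
    have hbr : b ≠ T.root := fun h => hwr (P.top_eq_root (hw.2.trans h))
    have hbw : T.Anc (T.parent b) w := (T.anc_parent b).trans (hw.2 ▸ P.top_anc w)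
    rw [own, hw.2, ← sum_edge_seg hbw]
    refine Finset.sum_le_sum_of_subset_of_nonneg ?_ fun v _ _ => edge_nonneg v
    intro v
    simp only [Finset.mem_filter, Finset.mem_univ, true_and, Set.mem_singleton_iff]
    rintro ⟨h1, h2⟩
    have hbv : T.Anc b v := h2 ▸ P.top_anc v
    refine ⟨h1.1.of_height_le hw.1.1 (hmax v ⟨h1, h2⟩), (T.anc_parent b).trans hbv, ?_⟩
    rintro rfl
    exact not_anc_parent hbr hbv
  · left
    exact Finset.sum_eq_zero fun v hv => absurd ⟨v, by simpa using hv⟩ hne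

/-- If every descending path follows a piece for a fraction `δ` of its length, then boundedly many
pieces cover most of it. -/
theorem exists_cover {δ : ℝ} (hδ1 : δ ≤ 1)
    (hδ : ∀ z x, T.Anc z x → z ≠ x → ∃ q, T.Seg z x q ∧
      δ * (T.height x - T.height z) ≤ P.own q ∧
      δ * (T.height x - T.height z) ≤ T.height q - T.height z) (n : ℕ) :
    ∀ z x, T.Anc z x → ∃ S : Finset V, S.card + 1 ≤ 2 ^ n ∧
      P.mass (↑S)ᶜ z x ≤ (1 - δ) ^ n * (T.height x - T.height z) := by
  classical
  induction n with
  | zero =>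
    intro z x hzx
    exact ⟨∅, by simp, by simpa using P.mass_le _ hzx⟩
  | succ n ih =>
    intro z x hzx
    by_cases hne : z = x
    · subst hne
      refine ⟨∅, by simp [Nat.one_le_two_pow], ?_⟩
      simpa using P.mass_le _ hzx
    obtain ⟨q, ⟨hqx, hzq, hzq'⟩, h1, h2⟩ := hδ z x hzx hne
    obtain ⟨a, hza, haq, hl, htop⟩ := P.exists_seg_of_le_own hzq h1 h2
    obtain ⟨S₁, hc₁, hm₁⟩ := ih z a hza
    obtain ⟨S₂, hc₂, hm₂⟩ := ih q x hqx
    refine ⟨insert (P.top q) (S₁ ∪ S₂), ?_, ?_⟩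
    · have h3 := Finset.card_insert_le (P.top q) (S₁ ∪ S₂)
      have h4 := Finset.card_union_le S₁ S₂
      rw [pow_succ]; omega
    · have hz : P.mass (↑(insert (P.top q) (S₁ ∪ S₂)) : Set V)ᶜ a q = 0 := by
        refine Finset.sum_eq_zero fun v hv => ?_
        simp only [Finset.mem_filter] at hv
        obtain ⟨-, h3, h4⟩ := hv
        rw [htop v h3] at h4
        simp at h4
      rw [P.mass_add _ hza (haq.trans hqx), P.mass_add _ haq hqx, hz, zero_add]
      have h3 : P.mass (↑(insert (P.top q) (S₁ ∪ S₂)) : Set V)ᶜ z a ≤ P.mass (↑S₁)ᶜ z a :=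
        P.mass_mono (Set.compl_subset_compl.2 fun v hv => by simp [Finset.mem_coe.1 hv]) _ _
      have h4 : P.mass (↑(insert (P.top q) (S₁ ∪ S₂)) : Set V)ᶜ q x ≤ P.mass (↑S₂)ᶜ q x :=
        P.mass_mono (Set.compl_subset_compl.2 fun v hv => by simp [Finset.mem_coe.1 hv]) _ _
      have h5 : 0 ≤ (1 - δ) ^ n := pow_nonneg (by linarith) n
      calc _ ≤ (1 - δ) ^ n * ((T.height a - T.height z) + (T.height x - T.height q)) := by
            rw [mul_add]; linarith
        _ ≤ (1 - δ) ^ n * ((1 - δ) * (T.height x - T.height z)) := by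
            gcongr; linarith
        _ = _ := by rw [pow_succ, mul_assoc]

/-- The sum of the lengths of the pieces of a suitable colour separates two vertices. -/
theorem exists_color_le {δ : ℝ} (hδ0 : 0 < δ) (hδ1 : δ ≤ 1)
    (hδ : ∀ z x, T.Anc z x → z ≠ x → ∃ q, T.Seg z x q ∧
      δ * (T.height x - T.height z) ≤ P.own q ∧
      δ * (T.height x - T.height z) ≤ T.height q - T.height z)
    {n A : ℕ} (hn : (1 - δ) ^ n ≤ δ / 4) (hA : 2 * (4 * 2 ^ n) ≤ δ * A) {C : Type*} {χ : V → C}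
    (hχ : ∀ a b, a ≠ b → P.Conflict A a b → χ a ≠ χ b) (x y : V)
    (hxy : T.height y ≤ T.height x) (hne : T.lca x y ≠ x) :
    ∃ c, δ / 4 * T.dist x y ≤
      P.mass {b | χ b = c} T.root x - P.mass {b | χ b = c} T.root y := by
  classical
  set z := T.lca x y with hz
  have hzx : T.Anc z x := T.lca_anc_left x y
  have hzy : T.Anc z y := T.lca_anc_right x y
  have hzy' := hzy.height_le
  set r := T.height x - T.height z with hr
  have hr0 : 0 < r := sub_pos.2 (hzx.height_lt hne)
  obtain ⟨q, ⟨hqx, hzq, hzq'⟩, h1, h2⟩ := hδ z x hzx hne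
  obtain ⟨a, hza, haq, hl, htop⟩ := P.exists_seg_of_le_own hzq h1 h2
  refine ⟨χ (P.top q), ?_⟩
  set B : Set V := {b | χ b = χ (P.top q)} with hB
  have hlow : δ * r ≤ P.mass B z x := by
    have h3 := P.mass_eq (A := B) haq fun v hv => by rw [htop v hv]; rfl
    rw [P.mass_add B hza (haq.trans hqx), P.mass_add B haq hqx, h3]
    linarith [P.mass_nonneg B z a, P.mass_nonneg B q x]
  obtain ⟨S, hS, hSm⟩ := P.exists_cover hδ1 hδ n z y hzy
  have hsingle : ∀ b ∈ S.filter (· ∈ B), P.mass {b} z y ≤ δ / (4 * 2 ^ n) * r := by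
    intro b hb
    have hbB : χ b = χ (P.top q) := (Finset.mem_filter.1 hb).2
    rcases P.mass_singleton_le b z y with h3 | ⟨v, ⟨hvy, hzv, hzv'⟩, rfl, h5⟩
    · rw [h3]; positivity
    refine h5.trans ?_
    by_contra! h6
    refine hχ (P.top q) (P.top v) ?_ ?_ hbB.symm
    · intro h7
      rcases P.total_of_top_eq h7 with h8 | h8
      · exact hzq' (hzq.antisymm ((hqx.anc_lca (h8.trans hvy))))
      · exact hzv' (hzv.antisymm (((h8.trans hqx).anc_lca hvy)))
    · have hd : T.dist q v ≤ 2 * r := by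
        have h7 := dist_le hzq hzv
        have h8 := hqx.height_le
        have h9 := hvy.height_le
        linarith
      have h7 : (0 : ℝ) < 4 * 2 ^ n := by positivity
      have h8 : 0 < δ / (4 * 2 ^ n) * r := by positivity
      have h9 : 2 * r ≤ A * (δ / (4 * 2 ^ n) * r) := by
        rw [← mul_assoc, mul_div_assoc', mul_comm (A : ℝ)]
        gcongr
        rwa [le_div_iff₀ h7]
      have h10 : δ / (4 * 2 ^ n) * r ≤ P.own q := by
        refine le_trans ?_ h1
        gcongr
        exact div_le_self hδ0.le (by have := one_le_pow₀ (n := n) (one_le_two (α := ℝ)); linarith)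
      have hA0 : (0 : ℝ) ≤ A := Nat.cast_nonneg A
      exact ⟨q, v, rfl, rfl, h8.trans_le h10, h8.trans h6,
        hd.trans (h9.trans (by gcongr)), hd.trans (h9.trans (by gcongr))⟩
  have hup : P.mass B z y ≤ δ / 2 * r := by
    have hsub : B ⊆ (↑S)ᶜ ∪ ↑(S.filter (· ∈ B)) := by
      intro b hb
      by_cases hbS : b ∈ S <;> simp [hbS, hb]
    have h3 := (P.mass_mono hsub z y).trans (P.mass_union_le _ _ z y)
    have h4 := (P.mass_finset_le (S.filter (· ∈ B)) z y).trans
      (Finset.sum_le_card_nsmul _ _ _ hsingle)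
    have h5 : ((S.filter (· ∈ B)).card : ℝ) ≤ 2 ^ n := by
      have := Finset.card_filter_le S (· ∈ B)
      exact_mod_cast (by omega : (S.filter (· ∈ B)).card ≤ 2 ^ n)
    have h6 : ((S.filter (· ∈ B)).card : ℝ) * (δ / (4 * 2 ^ n) * r) ≤ δ / 4 * r := by
      calc _ ≤ (2 : ℝ) ^ n * (δ / (4 * 2 ^ n) * r) := by gcongr
        _ = δ / 4 * r := by field_simp
    have h7 : (1 - δ) ^ n * (T.height y - T.height z) ≤ δ / 4 * r := by
      gcongr
      linarith
    rw [nsmul_eq_mul] at h4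
    linarith
  rw [P.mass_add B (T.root_anc z) hzx, P.mass_add B (T.root_anc z) hzy]
  have hd : T.dist x y ≤ 2 * r := by
    rw [dist]; linarith
  have : δ / 4 * T.dist x y ≤ δ / 4 * (2 * r) := by gcongr
  linarith

end Pieces

theorem exists_embedding_of_spread (N : ℕ → ℕ) : ∃ (k : ℕ) (δ : ℝ), 0 < δ ∧
    ∀ (V : Type) [Fintype V] (T : RootedTree V), Packed T.dist N → T.Spread →
      ∃ f : V → Fin k → ℝ, ∀ x y,
        δ * T.dist x y ≤ Dist.dist (f x) (f y) ∧ Dist.dist (f x) (f y) ≤ T.dist x y := by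
  set δ : ℝ := 1 / (32 * (N 96 + 1)) with hδ
  have hδ0 : 0 < δ := by positivity
  have hδ1 : δ ≤ 1 := by
    rw [hδ, div_le_one (by positivity)]
    have : (0 : ℝ) ≤ N 96 := Nat.cast_nonneg _
    linarith
  obtain ⟨n, hn⟩ := exists_pow_lt_of_lt_one (show 0 < δ / 4 by positivity)
    (show 1 - δ < 1 by linarith)
  obtain ⟨A, hA⟩ := exists_nat_ge (2 * (4 * 2 ^ n) / δ)
  rw [div_le_iff₀' hδ0] at hA
  refine ⟨N (A + 6) + 1, δ / 4, by positivity, fun V _ T hN hT => ?_⟩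
  obtain ⟨P⟩ := T.exists_pieces
  obtain ⟨χ, hχ⟩ := P.exists_coloring hN A
  have hheavy : ∀ z x, T.Anc z x → z ≠ x → ∃ q, T.Seg z x q ∧
      δ * (T.height x - T.height z) ≤ P.own q ∧
      δ * (T.height x - T.height z) ≤ T.height q - T.height z := by
    intro z x hzx hne
    simpa only [hδ, one_div_mul_eq_div] using P.exists_own_ge_mul hN hT hzx hne
  refine ⟨fun x c => P.mass {b | χ b = c} T.root x, fun x y => ⟨?_, ?_⟩⟩
  · have key : ∀ x y, T.height y ≤ T.height x → δ / 4 * T.dist x y ≤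
        Dist.dist (fun c => P.mass {b | χ b = c} T.root x)
          (fun c => P.mass {b | χ b = c} T.root y) := by
      intro x y hxy
      by_cases hne : T.lca x y = x
      · have : T.dist x y ≤ 0 := by rw [dist, hne]; linarith
        exact (mul_nonpos_of_nonneg_of_nonpos (by positivity) this).trans _root_.dist_nonneg
      · obtain ⟨c, hc⟩ := P.exists_color_le hδ0 hδ1 hheavy hn.le hA hχ x y hxy hne
        refine hc.trans ((le_abs_self _).trans ?_)
        rw [← Real.dist_eq]
        exact dist_le_pi_dist (fun c => P.mass {b | χ b = c} T.root x)
          (fun c => P.mass {b | χ b = c} T.root y) c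
    rcases le_total (T.height y) (T.height x) with h | h
    · exact key x y h
    · rw [T.dist_comm, _root_.dist_comm]
      exact key y x h
  · refine (dist_pi_le_iff (T.dist_nonneg x y)).2 fun c => ?_
    have hx := T.lca_anc_left x y
    have hy := T.lca_anc_right x y
    have h1 := P.mass_le {b | χ b = c} hx
    have h2 := P.mass_le {b | χ b = c} hy
    have h3 := P.mass_nonneg {b | χ b = c} (T.lca x y) x
    have h4 := P.mass_nonneg {b | χ b = c} (T.lca x y) y
    have h5 := hx.height_le
    have h6 := hy.height_le
    change |P.mass {b | χ b = c} T.root x - P.mass {b | χ b = c} T.root y| ≤ T.dist x y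
    rw [P.mass_add _ (T.root_anc _) hx, P.mass_add _ (T.root_anc _) hy, abs_le, dist]
    constructor <;> linarith

end RootedTree

namespace RootedTree

/-- `T'.Coarser T`: the parents in `T'` are ancestors in `T`, and no edge of `T` is lengthened by
more than half when it is replaced by an edge of `T'`. -/
structure Coarser {V : Type*} (T' T : RootedTree V) : Prop where
  height : T'.height = T.height
  anc : ∀ v, T.Anc (T'.parent v) (T.parent v)
  edge_le : ∀ v, T.height (T.parent v) - T.height (T'.parent v) ≤ T.edge v / 2

section Regularize

variable {V : Type*} {T : RootedTree V}

theorem strong_induction {P : V → Prop} (h : ∀ v, (∀ u, T.Anc u v → u ≠ v → P u) → P v) (v : V) :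
    P v := by
  suffices H : ∀ u, T.Anc u v → P u from H v (T.anc_refl v)
  induction v using T.induction with
  | root =>
    refine fun u hu => h u fun w hw hne => absurd ?_ hne
    rw [anc_root hu] at hw ⊢
    exact anc_root hw
  | step v hv ih =>
    intro u hu
    rcases hu.eq_or with rfl | ⟨-, hu⟩
    · exact h u fun w hw hne => ih w (hw.anc_parent hne)
    · exact ih u hu

theorem exists_anc_multiple (w : V) {s : ℝ} (hs : 0 < s) : ∃ u, T.Anc u w ∧
    T.height w - T.height u ≤ s ∧
    (u = T.root ∨ ∃ k : ℤ, T.height (T.parent u) < k * s ∧ k * s ≤ T.height u) := by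
  have h1 : ⌊T.height w / s⌋ * s ≤ T.height w := (le_div_iff₀ hs).1 (Int.floor_le _)
  have h2 : T.height w < (⌊T.height w / s⌋ + 1) * s := (div_lt_iff₀ hs).1 (Int.lt_floor_add_one _)
  by_cases hr : ⌊T.height w / s⌋ * s ≤ T.height T.root
  · exact ⟨T.root, T.root_anc w, by linarith, Or.inl rfl⟩
  · obtain ⟨u, -, -, h3, h4, h5⟩ := exists_first (P := fun u => ⌊T.height w / s⌋ * s ≤ T.height u)
      (T.root_anc w) h1 hr
    exact ⟨u, h3, by linarith, Or.inr ⟨_, not_le.1 h5, h4⟩⟩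

variable (T) in
/-- The edges of a rooted tree can be lengthened by half to make the tree `Spread`. -/
theorem exists_spread : ∃ T' : RootedTree V, T'.Coarser T ∧ T'.Spread := by
  choose p hp1 hp2 hp3 using fun v => T.exists_anc_multiple (T.parent v)
    (zpow_pos (two_pos (α := ℝ)) (Int.log 2 (T.edge v / 2)))
  have hlt : ∀ v, v ≠ T.root → 0 < T.edge v := fun v hv => sub_pos.2 (T.height_parent_lt v hv)
  have hedge : ∀ v, T.height (T.parent v) - T.height (p v) ≤ T.edge v / 2 := fun v => by
    by_cases hv : v = T.root
    · have h := hp1 v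
      rw [hv, T.parent_root] at h ⊢
      rw [anc_root h, edge, T.parent_root]
      simp
    · exact (hp2 v).trans (by exact_mod_cast Int.zpow_log_le_self one_lt_two (half_pos (hlt v hv)))
  have hroot : p T.root = T.root := anc_root <| by
    simpa only [T.parent_root] using hp1 T.root
  refine ⟨⟨p, T.root, T.height, hroot, fun v hv => (hp1 v).height_le.trans_lt
    (T.height_parent_lt v hv), fun v => ?_⟩, ⟨rfl, hp1, hedge⟩, fun v hv i hi => ?_⟩
  · induction v using T.strong_induction with
    | h v ih =>
      by_cases hv : v = T.root
      · exact ⟨0, hv⟩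
      · obtain ⟨n, hn⟩ := ih (p v) (hp1 v).of_parent fun h => not_anc_parent hv <| by
          simpa only [h] using hp1 v
        exact ⟨n + 1, hn⟩
  · change p v ≠ T.root at hv
    change 6 * 2 ^ i ≤ T.height v - T.height (p v) at hi
    change ∃ k : ℤ, T.height (p (p v)) < k * 2 ^ i ∧ k * 2 ^ i ≤ T.height (p v)
    have hv' : v ≠ T.root := fun h => hv (h ▸ hroot)
    obtain ⟨k, hk1, hk2⟩ := (hp3 v).resolve_left hv
    set j := Int.log 2 (T.edge v / 2) with hj
    have hij : i < j := by
      have h1 : T.edge v / 2 < 2 ^ (j + 1) := by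
        exact_mod_cast Int.lt_zpow_succ_log_self (b := 2) one_lt_two (T.edge v / 2)
      rw [zpow_add_one₀ two_ne_zero] at h1
      have h2 := hedge v
      have h3 : T.edge v = T.height v - T.height (T.parent v) := rfl
      exact (zpow_lt_zpow_iff_right₀ (one_lt_two (α := ℝ))).1 (by linarith)
    obtain ⟨m, hm⟩ := Int.eq_ofNat_of_zero_le (sub_nonneg.2 hij.le)
    have hkm : (k : ℝ) * 2 ^ j = ((k * 2 ^ m : ℤ) : ℝ) * 2 ^ i := by
      rw [show j = m + i by omega, zpow_add₀ two_ne_zero]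
      push_cast
      rw [zpow_natCast, mul_assoc]
    rw [hkm] at hk1 hk2
    exact ⟨_, (hp1 (p v)).height_le.trans_lt hk1, hk2⟩

namespace Coarser

variable {T' : RootedTree V}

theorem anc_of_anc (hT : T'.Coarser T) {u v : V} (h : T'.Anc u v) : T.Anc u v := by
  induction v using T'.induction with
  | root => rw [anc_root h]; exact T.anc_refl _
  | step v hv ih =>
    rcases h.eq_or with rfl | ⟨-, h⟩
    · exact T.anc_refl _
    · exact (ih h).trans (hT.anc v).of_parent


theorem dist_le_dist (hT : T'.Coarser T) (x y : V) : T.dist x y ≤ T'.dist x y := by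
  have h := dist_le (hT.anc_of_anc (T'.lca_anc_left x y)) (hT.anc_of_anc (T'.lca_anc_right x y))
  rwa [← hT.height] at h

theorem exists_anc (hT : T'.Coarser T) {z x : V} (hzx : T.Anc z x) :
    ∃ u, T'.Anc u x ∧ T.Anc u z ∧ T.height z - T.height u ≤ (T.height x - T.height z) / 2 := by
  induction x using T.strong_induction with
  | h x ih =>
    by_cases hne : z = x
    · exact ⟨x, T'.anc_refl x, hne ▸ T.anc_refl _, by simp [hne]⟩
    have hx : x ≠ T.root := by
      rintro rfl
      exact hne (anc_root hzx)
    have hlt := T.height_parent_lt x hx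
    by_cases h : T.Anc z (T'.parent x)
    · obtain ⟨u, h1, h2, h3⟩ := ih _ (hT.anc x).of_parent
        (fun h => not_anc_parent hx <| by simpa only [h] using hT.anc x) h
      exact ⟨u, h1.of_parent, h2, by linarith [(hT.anc x).height_le]⟩
    · refine ⟨T'.parent x, T'.anc_parent x, ((hT.anc x).of_parent.total hzx).resolve_right h, ?_⟩
      have h1 := (hzx.anc_parent hne).height_le
      have h2 := hT.edge_le x
      rw [edge] at h2
      linarith

theorem exists_anc_anc (hT : T'.Coarser T) {z x : V} (hzx : T.Anc z x) :
    ∃ u, T'.Anc u x ∧ T'.Anc u z ∧ T.height z - T.height u ≤ T.height x - T.height z := by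
  induction x using T.strong_induction generalizing z with
  | h x ih =>
    by_cases hne : z = x
    · exact ⟨x, T'.anc_refl x, hne ▸ T'.anc_refl _, by simp [hne]⟩
    obtain ⟨u₁, h1, h2, h3⟩ := hT.exists_anc hzx
    obtain ⟨u, h4, h5, h6⟩ := ih z hzx hne h2
    exact ⟨u, h5.trans h1, h4, by linarith⟩

theorem dist_le_mul_dist (hT : T'.Coarser T) (x y : V) : T'.dist x y ≤ 3 * T.dist x y := by
  have hx := T.lca_anc_left x y
  have hy := T.lca_anc_right x y
  obtain ⟨u, h1, h2, h3⟩ := hT.exists_anc_anc hx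
  obtain ⟨v, h4, h5, h6⟩ := hT.exists_anc_anc hy
  have h7 := hx.height_le
  have h8 := hy.height_le
  have h9 : T.dist x y = T.height x + T.height y - 2 * T.height (T.lca x y) := rfl
  rcases h2.total h5 with h | h
  · have := dist_le h1 (h.trans h4)
    rw [hT.height] at this
    linarith
  · have := dist_le (h.trans h1) h4
    rw [hT.height] at this
    linarith

end Coarser

end Regularize

theorem exists_embedding_of_fintype (N : ℕ → ℕ) : ∃ (k : ℕ) (δ : ℝ), 0 < δ ∧
    ∀ (V : Type) [Fintype V] (T : RootedTree V), Packed T.dist N →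
      ∃ f : V → Fin k → ℝ, ∀ x y,
        δ * T.dist x y ≤ Dist.dist (f x) (f y) ∧ Dist.dist (f x) (f y) ≤ 3 * T.dist x y := by
  obtain ⟨k, δ, hδ, h⟩ := exists_embedding_of_spread fun n => N (3 * n)
  refine ⟨k, δ, hδ, fun V _ T hN => ?_⟩
  obtain ⟨T', hc, hs⟩ := T.exists_spread
  have h1 := hc.dist_le_dist
  have h2 := hc.dist_le_mul_dist
  have hN' : Packed T'.dist fun n => N (3 * n) := fun n x s hs S hS hS' => by
    refine hN (3 * n) x (3⁻¹ * s) (by positivity) S (fun y hy => ?_) fun y hy y' hy' hne => ?_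
    · refine (h1 x y).trans ((hS y hy).trans (le_of_eq ?_))
      push_cast; ring
    · linarith [hS' y hy y' hy' hne, h2 y y']
  obtain ⟨f, hf⟩ := h V T' hN' hs
  refine ⟨f, fun x y => ⟨?_, (hf x y).2.trans (h2 x y)⟩⟩
  exact (mul_le_mul_of_nonneg_left (h1 x y) hδ.le).trans (hf x y).1

end RootedTree

namespace MetricTree

variable (T : MetricTree)

theorem path_isPath (u v : T.V) : (T.path u v).IsPath :=
  (T.isTree.existsUnique_path u v).exists.choose_spec

variable {T}

theorem eq_path_s8 {u v : T.V} {p : T.G.Walk u v} (hp : p.IsPath) : p = T.path u v :=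
  (T.isTree.existsUnique_path u v).unique hp (T.path_isPath u v)

/-- The weight of a walk. -/
def weight {u v : T.V} (p : T.G.Walk u v) : ℝ := (p.edges.map T.w).sum

theorem dist_eq_weight {u v : T.V} {p : T.G.Walk u v} (hp : p.IsPath) : T.dist u v = weight p := by
  rw [eq_path_s8 hp]; rfl

theorem exists_path_append {R : RootedTree T.V} (hadj : ∀ v, v ≠ R.root → T.G.Adj v (R.parent v))
    (hw : ∀ v, v ≠ R.root → R.height v = T.w s(v, R.parent v) + R.height (R.parent v))
    {z y : T.V} {q : T.G.Walk z y} (hq : q.IsPath) (x : T.V) (hzx : R.Anc z x)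
    (hqx : ∀ v ∈ q.support, R.Anc v x → v = z) :
    ∃ p : T.G.Walk x y, p.IsPath ∧ weight p = R.height x - R.height z + weight q ∧
      ∀ v ∈ p.support, R.Anc v x ∧ R.Anc z v ∨ v ∈ q.support := by
  induction x using R.strong_induction with
  | h x ih =>
    by_cases hne : z = x
    · subst hne
      exact ⟨q, hq, by simp, fun v => Or.inr⟩
    have hx : x ≠ R.root := by
      rintro rfl
      exact hne (RootedTree.anc_root hzx)
    have hnp := RootedTree.not_anc_parent hx
    obtain ⟨p, h1, h2, h3⟩ := ih (R.parent x) (R.anc_parent x)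
      (fun h => hnp (h.symm ▸ R.anc_refl x)) (hzx.anc_parent hne)
      fun v hv h => hqx v hv h.of_parent
    refine ⟨.cons (hadj x hx) p, ?_, ?_, ?_⟩
    · refine h1.cons fun hmem => ?_
      rcases h3 x hmem with h | h
      · exact hnp h.1
      · exact hne (hqx x h (R.anc_refl x)).symm
    · rw [hw x hx, weight, SimpleGraph.Walk.edges_cons, List.map_cons, List.sum_cons]
      rw [weight] at h2
      rw [h2]
      ring
    · intro v hv
      rw [SimpleGraph.Walk.support_cons, List.mem_cons] at hv
      rcases hv with rfl | hv
      · exact Or.inl ⟨R.anc_refl _, hzx⟩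
      · exact (h3 v hv).imp_left fun h => ⟨h.1.of_parent, h.2⟩

theorem dist_eq_of_adj {R : RootedTree T.V} (hadj : ∀ v, v ≠ R.root → T.G.Adj v (R.parent v))
    (hw : ∀ v, v ≠ R.root → R.height v = T.w s(v, R.parent v) + R.height (R.parent v)) :
    T.dist = R.dist := by
  ext x y
  set z := R.lca x y with hz
  obtain ⟨q, hq, hqw, hqs⟩ := exists_path_append hadj hw (q := (.nil : T.G.Walk z z)) (by simp) y
    (R.lca_anc_right x y) (by simp)
  obtain ⟨p, hp, hpw, -⟩ := exists_path_append hadj hw hq.reverse x (R.lca_anc_left x y)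
    fun v hv hvx => by
      rw [SimpleGraph.Walk.support_reverse, List.mem_reverse] at hv
      rcases hqs v hv with h | h
      · exact (hvx.anc_lca h.1).antisymm h.2
      · simpa using h
  rw [dist_eq_weight hp, hpw, RootedTree.dist]
  have h1 : weight q.reverse = weight q := by simp [weight]
  rw [h1, hqw, weight]
  simp
  ring

variable (T) in
/-- The metric of a metric tree is the metric of a rooted tree. -/
theorem exists_rootedTree : ∃ R : RootedTree T.V, T.dist = R.dist := by
  obtain ⟨r⟩ := T.isTree.connected.nonempty
  have key : ∀ v, v ≠ r → ∃ u, ∃ h : T.G.Adj v u, T.path v r = .cons h (T.path u r) := by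
    intro v hv
    have hp := T.path_isPath v r
    cases hpv : T.path v r with
    | nil => exact absurd rfl hv
    | cons h p =>
      rw [hpv] at hp
      exact ⟨_, h, by rw [← eq_path_s8 hp.of_cons]⟩
  have key' : ∀ v, ∃ u, (v = r → u = r) ∧
      (v ≠ r → ∃ h : T.G.Adj v u, T.path v r = .cons h (T.path u r)) := by
    intro v
    by_cases hv : v = r
    · exact ⟨r, fun _ => rfl, fun h => absurd hv h⟩
    · obtain ⟨u, hu⟩ := key v hv
      exact ⟨u, fun h => absurd h hv, fun _ => hu⟩
  choose p hpr hp using key'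
  have hw : ∀ v, v ≠ r → T.dist v r = T.w s(v, p v) + T.dist (p v) r := by
    intro v hv
    obtain ⟨h, he⟩ := hp v hv
    rw [MetricTree.dist, he]
    simp [MetricTree.dist]
  refine ⟨⟨p, r, fun v => T.dist v r, hpr r rfl, fun v hv => ?_, fun v => ?_⟩,
    dist_eq_of_adj (fun v hv => (hp v hv).1) hw⟩
  · rw [hw v hv]
    have := T.w_pos s(v, p v) (hp v hv).1
    linarith
  · induction hn : (T.path v r).length generalizing v with
    | zero => exact ⟨0, SimpleGraph.Walk.eq_of_length_eq_zero hn⟩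
    | succ n ih =>
      by_cases hv : v = r
      · exact ⟨0, hv⟩
      · obtain ⟨h, he⟩ := hp v hv
        rw [he, SimpleGraph.Walk.length_cons] at hn
        obtain ⟨m, hm⟩ := ih (p v) (by omega)
        exact ⟨m + 1, hm⟩

end MetricTree

section Doubling

variable {X : Type*} {dX : X → X → ℝ}

theorem DoublingWith.exists_cover {lam : ℕ} (h : DoublingWith dX lam) (m : ℕ) (x : X) {R : ℝ}
    (hR : 0 < R) : ∃ S : Finset X, S.card ≤ lam ^ m ∧
      ∀ y, dX x y ≤ R → ∃ z ∈ S, dX z y ≤ R / 2 ^ m := by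
  classical
  induction m with
  | zero => exact ⟨{x}, by simp, fun y hy => ⟨x, by simp, by simpa using hy⟩⟩
  | succ m ih =>
    obtain ⟨S, hS, hS'⟩ := ih
    choose F hF hF' using fun z => h z (R / 2 ^ m) (by positivity)
    refine ⟨S.biUnion F, ?_, fun y hy => ?_⟩
    · rw [pow_succ]
      exact (Finset.card_biUnion_le_card_mul _ _ _ fun z _ => hF z).trans
        (Nat.mul_le_mul_right _ hS)
    · obtain ⟨z, hz, hzy⟩ := hS' y hy
      obtain ⟨u, hu, huy⟩ := hF' z y hzy
      exact ⟨u, Finset.mem_biUnion.2 ⟨z, hz, hu⟩, by rwa [pow_succ, ← div_div]⟩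

theorem DoublingWith.packed {lam : ℕ} (h : DoublingWith dX lam) (hcomm : ∀ x y, dX x y = dX y x)
    (htri : ∀ x y z, dX x z ≤ dX x y + dX y z) : Packed dX fun n => lam ^ (n + 2) := by
  intro n x s hs S hS hS'
  obtain ⟨F, hF, hF'⟩ := h.exists_cover (n + 2) x (R := (n + 1) * s) (by positivity)
  choose! c hc hc' using fun y (hy : y ∈ S) => hF' y ((hS y hy).trans (by gcongr; linarith))
  refine (Finset.card_le_card_of_injOn c hc fun y hy y' hy' he => ?_).trans hF
  by_contra hne
  have h1 := hS' y hy y' hy' hne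
  have h2 := hc' y hy
  have h3 := hc' y' hy'
  have h4 := htri y (c y) y'
  rw [hcomm y (c y)] at h4
  rw [← he] at h3
  have h5 : ((n : ℝ) + 1) * s / 2 ^ (n + 2) < s / 2 := by
    have h6 : ((n : ℝ) + 1) < 2 ^ (n + 1) := by exact_mod_cast Nat.lt_two_pow_self
    rw [div_lt_div_iff₀ (by positivity) two_pos, pow_succ (2 : ℝ) (n + 1)]
    nlinarith
  linarith

/-- A distance space, each of whose finite subsets embeds, embeds. -/
theorem exists_embedding_of_finset {k : ℕ} {δ C : ℝ}
    (h : ∀ F : Finset X, ∃ f : X → Fin k → ℝ, ∀ x ∈ F, ∀ y ∈ F,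
      δ * dX x y ≤ dist (f x) (f y) ∧ dist (f x) (f y) ≤ C * dX x y) :
    ∃ f : X → Fin k → ℝ, ∀ x y,
      δ * dX x y ≤ dist (f x) (f y) ∧ dist (f x) (f y) ≤ C * dX x y := by
  classical
  rcases isEmpty_or_nonempty X with hX | ⟨⟨o⟩⟩
  · exact ⟨fun _ => 0, fun x => hX.elim x⟩
  choose g hg using h
  let U : Ultrafilter (Finset X) := Ultrafilter.of Filter.atTop
  have hmem : ∀ x : X, ∀ᶠ F in (U : Filter (Finset X)), x ∈ F := fun x =>
    Ultrafilter.of_le _ (by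
      filter_upwards [Filter.eventually_ge_atTop ({x} : Finset X)] with F hF
      exact hF (Finset.mem_singleton_self x))
  have hlim : ∀ x, ∃ a, Filter.Tendsto (fun F => g F x - g F o) U (nhds a) := by
    intro x
    obtain ⟨a, -, ha⟩ := (isCompact_closedBall (0 : Fin k → ℝ) (C * dX x o)).ultrafilter_le_nhds
      (U.map fun F => g F x - g F o) (by
        rw [Filter.le_principal_iff, Ultrafilter.coe_map, Filter.mem_map]
        filter_upwards [hmem x, hmem o] with F hx ho
        rw [Set.mem_preimage, mem_closedBall_zero_iff, ← dist_eq_norm]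
        exact (hg F x hx o ho).2)
    exact ⟨a, ha⟩
  choose f hf using hlim
  refine ⟨f, fun x y => ?_⟩
  have hd : Filter.Tendsto (fun F => dist (g F x) (g F y)) U (nhds (dist (f x) (f y))) := by
    simpa only [dist_sub_right] using (hf x).dist (hf y)
  constructor
  · refine ge_of_tendsto hd ?_
    filter_upwards [hmem x, hmem y] with F hx hy using (hg F x hx y hy).1
  · refine le_of_tendsto hd ?_
    filter_upwards [hmem x, hmem y] with F hx hy using (hg F x hx y hy).2

theorem BiLipWith.exists_doublingWith {k : ℕ} {D : ℝ} {f : X → EuclideanSpace ℝ (Fin k)}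
    (hf : BiLipWith dX f D) (hd : ∀ x y, 0 ≤ dX x y) : ∃ lam, DoublingWith dX lam := by
  classical
  obtain ⟨s, hs, hf⟩ := hf
  set D' := max D 1
  have hD : 0 < D' := lt_max_of_lt_right one_pos
  obtain ⟨t, -, ht, hcov⟩ :=
    (isCompact_closedBall (0 : EuclideanSpace ℝ (Fin k)) 1).finite_cover_balls
      (show 0 < 1 / (4 * D') by positivity)
  refine ⟨ht.toFinset.card, fun x R hR => ?_⟩
  set ρ := s * D' * R with hρ
  have hρ0 : 0 < ρ := by positivity
  set u : X → EuclideanSpace ℝ (Fin k) := fun y => ρ⁻¹ • (f y - f x) with hu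
  have hrep : ∀ c, ∃ z, ∀ y, dist (u y) c < 1 / (4 * D') → dist (u z) c < 1 / (4 * D') := by
    intro c
    by_cases hc : ∃ y, dist (u y) c < 1 / (4 * D')
    · obtain ⟨z, hz⟩ := hc
      exact ⟨z, fun _ _ => hz⟩
    · exact ⟨x, fun y hy => absurd ⟨y, hy⟩ hc⟩
  choose z hz using hrep
  refine ⟨ht.toFinset.image z, Finset.card_image_le, fun y hy => ?_⟩
  have hmem : u y ∈ Metric.closedBall (0 : EuclideanSpace ℝ (Fin k)) 1 := by
    rw [mem_closedBall_zero_iff, hu, norm_smul, ← dist_eq_norm, norm_inv,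
      Real.norm_of_nonneg hρ0.le, inv_mul_le_iff₀ hρ0, mul_one, dist_comm]
    refine (hf x y).2.trans ?_
    have := hd x y
    rw [hρ]
    gcongr
    exact le_max_left _ _
  obtain ⟨c, hc, hyc⟩ := Set.mem_iUnion₂.1 (hcov hmem)
  rw [Metric.mem_ball] at hyc
  refine ⟨z c, Finset.mem_image_of_mem _ (ht.mem_toFinset.2 hc), ?_⟩
  have h1 : dist (u (z c)) (u y) < 1 / (4 * D') + 1 / (4 * D') :=
    (dist_triangle_right _ _ c).trans_lt (add_lt_add (hz c y hyc) hyc)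
  have h2 : dist (u (z c)) (u y) = ρ⁻¹ * dist (f (z c)) (f y) := by
    rw [hu, dist_smul₀, dist_sub_right, norm_inv, Real.norm_of_nonneg hρ0.le]
  rw [h2, inv_mul_lt_iff₀ hρ0, hρ] at h1
  have h3 := (hf (z c) y).1.trans h1.le
  have h4 : s * D' * R * (1 / (4 * D') + 1 / (4 * D')) = s * (R / 2) := by
    field_simp; ring
  rw [h4] at h3
  exact le_of_mul_le_mul_left h3 hs

end Doubling

theorem exists_euclidean_dist (k : ℕ) : ∃ K : ℝ, 0 ≤ K ∧ ∀ a b : Fin k → ℝ,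
    dist a b ≤ dist (WithLp.toLp 2 a) (WithLp.toLp 2 b) ∧
    dist (WithLp.toLp 2 a) (WithLp.toLp 2 b) ≤ K * dist a b := by
  refine ⟨_, NNReal.coe_nonneg _, fun a b => ⟨?_, (PiLp.lipschitzWith_toLp 2 _).dist_le_mul a b⟩⟩
  simpa using (PiLp.lipschitzWith_ofLp 2 _).dist_le_mul (WithLp.toLp 2 a) (WithLp.toLp 2 b)

namespace RootedTree

section Restrict

variable {V : Type*} (T : RootedTree V)

theorem finite_setOf_anc (x : V) : {u | T.Anc u x}.Finite := by
  induction x using T.induction with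
  | root => exact (Set.finite_singleton T.root).subset fun u hu => anc_root hu
  | step x hx ih =>
    refine (ih.insert x).subset fun u hu => ?_
    exact hu.eq_or.imp id And.right

variable {T} {A : Set V} (hA : ∀ u v, T.Anc u v → v ∈ A → u ∈ A) (hr : T.root ∈ A)

/-- The restriction of a rooted tree to a set of vertices closed under taking ancestors. -/
def restrict : RootedTree A where
  parent v := ⟨T.parent v, hA _ _ (T.anc_parent v) v.2⟩
  root := ⟨T.root, hr⟩
  height v := T.height v
  parent_root := Subtype.ext T.parent_root
  height_parent_lt v hv := T.height_parent_lt v fun h => hv (Subtype.ext h)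
  reach v := by
    obtain ⟨n, hn⟩ := T.reach v
    refine ⟨n, Subtype.ext (Eq.trans ?_ hn)⟩
    exact (Function.Semiconj.iterate_right (f := Subtype.val) (fun _ => rfl) n) v

theorem restrict_anc {u v : A} : (restrict hA hr).Anc u v ↔ T.Anc u v :=
  exists_congr fun n => by
    rw [Subtype.ext_iff]
    exact Eq.congr_left ((Function.Semiconj.iterate_right (f := Subtype.val)
      (ga := (restrict hA hr).parent) (gb := T.parent) (fun _ => rfl) n) v)

theorem restrict_dist (x y : A) : (restrict hA hr).dist x y = T.dist x y := by
  have hl : T.lca x y ∈ A := hA _ _ (T.lca_anc_left _ _) x.2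
  refine (restrict hA hr).dist_eq (u := ⟨_, hl⟩) ?_ ?_ fun v hx hy => ?_
  · exact (restrict_anc hA hr).2 (T.lca_anc_left _ _)
  · exact (restrict_anc hA hr).2 (T.lca_anc_right _ _)
  · rw [restrict_anc] at hx hy ⊢
    exact hx.anc_lca hy

end Restrict

theorem exists_embedding (N : ℕ → ℕ) : ∃ (k : ℕ) (δ : ℝ), 0 < δ ∧
    ∀ (V : Type) (T : RootedTree V), Packed T.dist N →
      ∃ f : V → Fin k → ℝ, ∀ x y,
        δ * T.dist x y ≤ Dist.dist (f x) (f y) ∧ Dist.dist (f x) (f y) ≤ 3 * T.dist x y := by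
  obtain ⟨k, δ, hδ, h⟩ := exists_embedding_of_fintype N
  refine ⟨k, δ, hδ, fun V T hN => exists_embedding_of_finset fun F => ?_⟩
  set A : Set V := {u | ∃ x ∈ insert T.root (F : Set V), T.Anc u x} with hAdef
  have hfin : A.Finite := by
    have : A = ⋃ x ∈ insert T.root (F : Set V), {u | T.Anc u x} := by
      ext u; simp [hAdef]
    rw [this]
    exact (F.finite_toSet.insert _).biUnion fun x _ => T.finite_setOf_anc x
  have hA : ∀ u v, T.Anc u v → v ∈ A → u ∈ A := fun u v huv ⟨x, hx, hv⟩ => ⟨x, hx, huv.trans hv⟩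
  have hF : ∀ x ∈ F, x ∈ A := fun x hx => ⟨x, Or.inr hx, T.anc_refl x⟩
  have hr : T.root ∈ A := ⟨_, Or.inl rfl, T.anc_refl _⟩
  have := hfin.fintype
  obtain ⟨f, hf⟩ := h A (restrict hA hr) fun n x s hs S hS hS' => by
    rw [← S.card_map (Function.Embedding.subtype (· ∈ A))]
    refine hN n x s hs _ (fun y hy => ?_) fun y hy y' hy' hne => ?_
    · obtain ⟨y, hyS, rfl⟩ := Finset.mem_map.1 hy
      exact (restrict_dist hA hr x y).symm.trans_le (hS y hyS)
    · obtain ⟨y, hyS, rfl⟩ := Finset.mem_map.1 hy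
      obtain ⟨y', hyS', rfl⟩ := Finset.mem_map.1 hy'
      exact (hS' y hyS y' hyS' fun h => hne (h ▸ rfl)).trans_eq (restrict_dist hA hr y y')
  classical
  refine ⟨fun x => if hx : x ∈ A then f ⟨x, hx⟩ else 0, fun x hx y hy => ?_⟩
  simpa only [dif_pos (hF x hx), dif_pos (hF y hy), restrict_dist] using
    hf ⟨x, hF x hx⟩ ⟨y, hF y hy⟩

end RootedTree

/-- A tree metric embeds bi-Lipschitzly into a finite-dimensional Euclidean
space if and only if it is doubling; moreover every doubling tree admits a `D`-embedding into
`ℝ^k` with `D` and `k` depending only on the doubling constant. -/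
theorem doubling_trees_embed :
    (∀ lam : ℕ, ∃ (D : ℝ) (k : ℕ), 1 ≤ D ∧ ∀ T : MetricTree, DoublingWith T.dist lam →
      ∃ f : T.V → EuclideanSpace ℝ (Fin k), BiLipWith T.dist f D) ∧
    (∀ (T : MetricTree) (k : ℕ) (D : ℝ) (f : T.V → EuclideanSpace ℝ (Fin k)),
      BiLipWith T.dist f D → ∃ lam : ℕ, DoublingWith T.dist lam) := by
  refine ⟨fun lam => ?_, fun T k D f hf => ?_⟩
  · obtain ⟨k, δ, hδ, h⟩ := RootedTree.exists_embedding fun n => lam ^ (n + 2)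
    obtain ⟨K, hK, hdist⟩ := exists_euclidean_dist k
    refine ⟨max 1 (K * 3 / δ), k, le_max_left _ _, fun T hT => ?_⟩
    obtain ⟨R, hR⟩ := T.exists_rootedTree
    rw [hR] at hT ⊢
    obtain ⟨f, hf⟩ := h T.V R (hT.packed R.dist_comm R.dist_triangle)
    refine ⟨fun x => WithLp.toLp 2 (f x), δ, hδ, fun x y =>
      ⟨(hf x y).1.trans (hdist _ _).1, (hdist _ _).2.trans ?_⟩⟩
    calc K * dist (f x) (f y) ≤ K * (3 * R.dist x y) := by gcongr; exact (hf x y).2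
      _ = δ * (K * 3 / δ) * R.dist x y := by field_simp
      _ ≤ δ * max 1 (K * 3 / δ) * R.dist x y := by
        have := R.dist_nonneg x y
        gcongr
        exact le_max_right _ _
  · obtain ⟨R, hR⟩ := T.exists_rootedTree
    exact hf.exists_doublingWith fun x y => hR ▸ R.dist_nonneg x y

end TreePaper
end
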